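/- Let 1 < p < ∞ and 0 < p − 1 < λ < Λ_s(p), where Λ_s(p) := (N(p−1)+p)/(N−p) if N > p and Λ_s(p) := ∞ if N ≤ p, and let Ω ≠ ℝ^N be a domain in ℝ^N. Then there exists a constant C = C(p, N, λ) > 0, independent of Ω and u, such that every nonnegative C^1 weak solution u of −Δ_p u = u^λ on Ω satisfies u(x) + |∇u(x)|^{p/(λ+1)} ≤ C · dist(x, ∂Ω)^{−p/(λ+1−p)} for all x ∈ Ω. -/

import Mathlib

open MeasureTheory Metric
open scoped RealInnerProductSpace

abbrev EE (N : ℕ) := EuclideanSpace ℝ (Fin N)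

noncomputable def Phi {N : ℕ} (p : ℝ) (ξ : EE N) : EE N := ‖ξ‖ ^ (p - 2) • ξ

/-- weak solution on the ball of radius `r`, tested with `C¹` functions -/
def IsSol {N : ℕ} (p lam r : ℝ) (u : EE N → ℝ) : Prop :=
  ∀ φ : EE N → ℝ, ContDiff ℝ 1 φ → HasCompactSupport φ → tsupport φ ⊆ ball 0 r →
    ∫ x, ⟪Phi p (gradient u x), gradient φ x⟫ = ∫ x, u x ^ lam * φ x

section grad
variable {N : ℕ}

lemma grad_apply (u : EE N → ℝ) (x y : EE N) : ⟪gradient u x, y⟫ = fderiv ℝ u x y :=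
  inner_gradient_left

lemma norm_grad (u : EE N → ℝ) (x : EE N) : ‖gradient u x‖ = ‖fderiv ℝ u x‖ := by
  unfold gradient; simp

lemma grad_cont {u : EE N → ℝ} (hu : ContDiff ℝ 1 u) : Continuous (gradient u) := by
  have := hu.continuous_fderiv (by norm_num)
  exact (InnerProductSpace.toDual ℝ (EE N)).symm.continuous.comp this

lemma grad_mul {f g : EE N → ℝ} {x : EE N} (hf : DifferentiableAt ℝ f x)
    (hg : DifferentiableAt ℝ g x) :
    gradient (fun y => f y * g y) x = f x • gradient g x + g x • gradient f x := by
  unfold gradient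
  rw [fderiv_fun_mul hf hg]; simp

lemma grad_sub {f g : EE N → ℝ} {x : EE N} (hf : DifferentiableAt ℝ f x)
    (hg : DifferentiableAt ℝ g x) :
    gradient (fun y => f y - g y) x = gradient f x - gradient g x := by
  unfold gradient
  rw [fderiv_fun_sub hf hg]; simp

lemma grad_add {f g : EE N → ℝ} {x : EE N} (hf : DifferentiableAt ℝ f x)
    (hg : DifferentiableAt ℝ g x) :
    gradient (fun y => f y + g y) x = gradient f x + gradient g x := by
  unfold gradient
  rw [fderiv_fun_add hf hg]; simp

lemma grad_comp {h : ℝ → ℝ} {h' : ℝ} {f : EE N → ℝ} {x : EE N} (hh : HasDerivAt h h' (f x))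
    (hf : DifferentiableAt ℝ f x) :
    gradient (fun y => h (f y)) x = h' • gradient f x := by
  unfold gradient
  have := (hh.comp_hasFDerivAt x hf.hasFDerivAt).fderiv
  unfold Function.comp at this
  rw [this]; simp

lemma grad_const_mul {f : EE N → ℝ} {x : EE N} (c : ℝ) (hf : DifferentiableAt ℝ f x) :
    gradient (fun y => c * f y) x = c • gradient f x := by
  unfold gradient
  rw [fderiv_const_mul hf]; simp

lemma grad_translate (f : EE N → ℝ) (x a : EE N) :
    gradient (fun y => f (y + a)) x = gradient f (x + a) := by
  unfold gradient
  rw [fderiv_comp_add_right]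

lemma grad_tsupport (f : EE N → ℝ) {x : EE N} (hx : x ∉ tsupport f) : gradient f x = 0 := by
  unfold gradient
  have : fderiv ℝ f x = 0 := by
    by_contra h
    exact hx (support_fderiv_subset ℝ h)
  simp [this]

lemma grad_hcs {f : EE N → ℝ} (hf : HasCompactSupport f) : HasCompactSupport (gradient f) := by
  refine HasCompactSupport.intro hf (fun x hx => grad_tsupport f hx)

end grad

section Phi
variable {N : ℕ} {p : ℝ}

lemma Phi_zero : Phi p (0 : EE N) = 0 := by simp [Phi]

lemma norm_Phi (hp : 1 < p) (ξ : EE N) : ‖Phi p ξ‖ = ‖ξ‖ ^ (p - 1) := by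
  unfold Phi
  rw [norm_smul, Real.norm_of_nonneg (by positivity)]
  by_cases h : ‖ξ‖ = 0
  · rw [h, Real.zero_rpow (by linarith : p - 1 ≠ 0)]; simp
  · have : 0 < ‖ξ‖ := lt_of_le_of_ne (norm_nonneg _) (Ne.symm h)
    rw [show p - 1 = (p - 2) + 1 by ring, Real.rpow_add_one h]

lemma inner_Phi_self (hp : 1 < p) (ξ : EE N) : ⟪Phi p ξ, ξ⟫ = ‖ξ‖ ^ p := by
  unfold Phi
  rw [real_inner_smul_left, real_inner_self_eq_norm_sq]
  by_cases h : ‖ξ‖ = 0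
  · rw [h, Real.zero_rpow (by linarith : p ≠ 0)]; simp
  · have h0 : 0 < ‖ξ‖ := lt_of_le_of_ne (norm_nonneg _) (Ne.symm h)
    rw [← Real.rpow_natCast, ← Real.rpow_add h0]; congr 1; push_cast; ring

lemma Phi_cont (hp : 1 < p) : Continuous (Phi p : EE N → EE N) := by
  rw [continuous_iff_continuousAt]
  intro ξ
  by_cases h : ξ = 0
  · subst h
    unfold ContinuousAt
    rw [Phi_zero, tendsto_zero_iff_norm_tendsto_zero]
    simp_rw [norm_Phi hp]
    have : ContinuousAt (fun ξ : EE N => ‖ξ‖ ^ (p - 1)) 0 :=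
      continuous_norm.continuousAt.rpow_const (Or.inr (by linarith))
    have h2 := this.tendsto
    simp only [norm_zero] at h2
    rwa [Real.zero_rpow (by linarith : p - 1 ≠ 0)] at h2
  · unfold Phi
    exact (continuous_norm.continuousAt.rpow_const (Or.inl (by simpa using h))).smul continuousAt_id

lemma rpow_two_sided (r : ℝ) {m : ℝ} (M : ℝ) (hm : 0 < m) :
    ∃ c C : ℝ, 0 < c ∧ 0 < C ∧ ∀ x, m ≤ x → x ≤ M → c ≤ x ^ r ∧ x ^ r ≤ C := by
  by_cases h : m ≤ M
  · have hM : 0 < M := hm.trans_le h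
    rcases le_total 0 r with hr | hr
    · exact ⟨m ^ r, M ^ r, by positivity, by positivity, fun x h1 h2 =>
        ⟨Real.rpow_le_rpow hm.le h1 hr, Real.rpow_le_rpow (hm.le.trans h1) h2 hr⟩⟩
    · exact ⟨M ^ r, m ^ r, by positivity, by positivity, fun x h1 h2 =>
        ⟨Real.rpow_le_rpow_of_nonpos (hm.trans_le h1) h2 hr,
          Real.rpow_le_rpow_of_nonpos hm h1 hr⟩⟩
  · exact ⟨1, 1, one_pos, one_pos, fun x h1 h2 => absurd (h1.trans h2) h⟩

lemma scalar_two_point (hp : 1 < p) {m M : ℝ} (hm : 0 < m) :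
    ∃ c C : ℝ, 0 < c ∧ 0 < C ∧ ∀ a b, m ≤ a → a ≤ M → m ≤ b → b ≤ M →
      c * (a - b) ^ 2 ≤ (a ^ (p - 1) - b ^ (p - 1)) * (a - b) ∧
      c * (a + b) ≤ a ^ (p - 1) + b ^ (p - 1) ∧
      |a ^ (p - 1) - b ^ (p - 1)| ≤ C * |a - b| ∧
      a ^ (p - 1) + b ^ (p - 1) ≤ C * (a + b) := by
  obtain ⟨c, C, hc, hC, H⟩ := rpow_two_sided (p - 2) M hm
  have key : ∀ x, m ≤ x → x ≤ M → c * x ≤ x ^ (p - 1) ∧ x ^ (p - 1) ≤ C * x := by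
    intro x h1 h2
    have hx : 0 < x := hm.trans_le h1
    rw [show p - 1 = (p - 2) + 1 by ring, Real.rpow_add_one hx.ne']
    exact ⟨mul_le_mul_of_nonneg_right (H x h1 h2).1 hx.le,
      mul_le_mul_of_nonneg_right (H x h1 h2).2 hx.le⟩
  have key2 : ∀ a b, m ≤ b → b < a → a ≤ M →
      (p - 1) * c * (a - b) ≤ a ^ (p - 1) - b ^ (p - 1) ∧
      a ^ (p - 1) - b ^ (p - 1) ≤ (p - 1) * C * (a - b) := by
    intro a b h1 h2 h3
    obtain ⟨x, hx, hx2⟩ := exists_hasDerivAt_eq_slope (fun x => x ^ (p - 1))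
      (fun x => (p - 1) * x ^ (p - 2)) h2
      (ContinuousOn.rpow_const continuousOn_id (fun x hx => Or.inr (by linarith)))
      (fun x hx => by
        have := Real.hasDerivAt_rpow_const (x := x) (p := p - 1)
          (Or.inl (by have := hx.1; linarith))
        rwa [show p - 1 - 1 = p - 2 by ring] at this)
    rw [eq_div_iff (by linarith)] at hx2
    rw [← hx2]
    have := H x (by linarith [hx.1]) (by linarith [hx.2])
    have hab : 0 < a - b := by linarith
    have hp1 : 0 < p - 1 := by linarith
    constructor
    · gcongr; exact this.1
    · gcongr; exact this.2
  have hp1 : 0 < p - 1 := by linarith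
  have m1 : min 1 (p - 1) * c ≤ c := by nlinarith [min_le_left 1 (p - 1)]
  have m2 : min 1 (p - 1) * c ≤ (p - 1) * c := by nlinarith [min_le_right 1 (p - 1)]
  have m3 : C ≤ max 1 (p - 1) * C := by nlinarith [le_max_left 1 (p - 1)]
  have m4 : (p - 1) * C ≤ max 1 (p - 1) * C := by nlinarith [le_max_right 1 (p - 1)]
  refine ⟨min 1 (p - 1) * c, max 1 (p - 1) * C, by positivity, by positivity, ?_⟩
  intro a b ha1 ha2 hb1 hb2
  have hab : 0 < a + b := by linarith
  refine ⟨?_, ?_, ?_, ?_⟩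
  · rcases lt_trichotomy a b with h | h | h
    · have := (key2 b a ha1 h hb2).1
      have h3 : min 1 (p - 1) * c * (b - a) ≤ b ^ (p - 1) - a ^ (p - 1) := by nlinarith
      nlinarith
    · subst h; simp
    · have := (key2 a b hb1 h ha2).1
      have h3 : min 1 (p - 1) * c * (a - b) ≤ a ^ (p - 1) - b ^ (p - 1) := by nlinarith
      nlinarith
  · have h1 := (key a ha1 ha2).1
    have h2 := (key b hb1 hb2).1
    nlinarith
  · rcases lt_trichotomy a b with h | h | h
    · have h1 := key2 b a ha1 h hb2
      have : 0 ≤ (p - 1) * c * (b - a) := by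
        have : 0 < b - a := by linarith
        positivity
      rw [abs_sub_comm, abs_of_nonneg (by linarith [h1.1]), abs_sub_comm,
        abs_of_nonneg (by linarith)]
      nlinarith [h1.2]
    · subst h; simp
    · have h1 := key2 a b hb1 h ha2
      have : 0 ≤ (p - 1) * c * (a - b) := by
        have : 0 < a - b := by linarith
        positivity
      rw [abs_of_nonneg (by linarith [h1.1]), abs_of_nonneg (by linarith)]
      nlinarith [h1.2]
  · have h1 := (key a ha1 ha2).2
    have h2 := (key b hb1 hb2).2
    nlinarith

lemma inner_Phi_sub (hp : 1 < p) (ξ ζ : EE N) :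
    ⟪Phi p ξ - Phi p ζ, ξ - ζ⟫ =
      ‖ξ‖ ^ p + ‖ζ‖ ^ p - (‖ξ‖ ^ (p - 2) + ‖ζ‖ ^ (p - 2)) * ⟪ξ, ζ⟫ := by
  rw [inner_sub_left, inner_sub_right, inner_sub_right, inner_Phi_self hp, inner_Phi_self hp]
  unfold Phi
  rw [real_inner_smul_left, real_inner_smul_left, real_inner_comm ξ ζ]
  ring

lemma Phi_mono (hp : 1 < p) (ξ ζ : EE N) : 0 ≤ ⟪Phi p ξ - Phi p ζ, ξ - ζ⟫ := by
  rw [inner_sub_left, inner_sub_right, inner_sub_right, inner_Phi_self hp, inner_Phi_self hp]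
  have h1 : ⟪Phi p ξ, ζ⟫ ≤ ‖ξ‖ ^ (p - 1) * ‖ζ‖ := by
    rw [← norm_Phi hp]; exact real_inner_le_norm _ _
  have h2 : ⟪Phi p ζ, ξ⟫ ≤ ‖ζ‖ ^ (p - 1) * ‖ξ‖ := by
    rw [← norm_Phi hp]; exact real_inner_le_norm _ _
  have e : ∀ a : ℝ, 0 ≤ a → a ^ p = a ^ (p - 1) * a := by
    intro a ha
    rcases ha.eq_or_lt with rfl | h
    · simp [Real.zero_rpow (by linarith : p ≠ 0)]
    · rw [← Real.rpow_add_one h.ne']; ring_nf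
  rw [e _ (norm_nonneg ξ), e _ (norm_nonneg ζ)]
  have h3 : 0 ≤ (‖ξ‖ ^ (p - 1) - ‖ζ‖ ^ (p - 1)) * (‖ξ‖ - ‖ζ‖) := by
    rcases le_total ‖ξ‖ ‖ζ‖ with h | h
    · exact mul_nonneg_of_nonpos_of_nonpos
        (by linarith [Real.rpow_le_rpow (norm_nonneg _) h (by linarith : 0 ≤ p - 1)]) (by linarith)
    · exact mul_nonneg
        (by linarith [Real.rpow_le_rpow (norm_nonneg _) h (by linarith : 0 ≤ p - 1)]) (by linarith)
  nlinarith

lemma affine_nonneg {A B t r : ℝ} (h1 : 0 ≤ A + B * r) (h2 : 0 ≤ A - B * r) (h : |t| ≤ r) :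
    0 ≤ A + B * t := by
  rw [abs_le] at h
  rcases le_total 0 B with hB | hB <;> nlinarith

lemma Phi_two_point (hp : 1 < p) {m M : ℝ} (hm : 0 < m) :
    ∃ c C : ℝ, 0 < c ∧ 0 < C ∧ ∀ ξ ζ : EE N, m ≤ ‖ξ‖ → ‖ξ‖ ≤ M → m ≤ ‖ζ‖ → ‖ζ‖ ≤ M →
      c * ‖ξ - ζ‖ ^ 2 ≤ ⟪Phi p ξ - Phi p ζ, ξ - ζ⟫ ∧ ‖Phi p ξ - Phi p ζ‖ ≤ C * ‖ξ - ζ‖ := by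
  obtain ⟨c, C, hc, hC, H⟩ := scalar_two_point (M := M) hp hm
  refine ⟨c, C, hc, hC, ?_⟩
  intro ξ ζ h1 h2 h3 h4
  obtain ⟨k1, k2, k3, k4⟩ := H _ _ h1 h2 h3 h4
  have ha : 0 < ‖ξ‖ := by linarith
  have hb : 0 < ‖ζ‖ := by linarith
  have ht := abs_real_inner_le_norm ξ ζ
  have hs : ‖ξ - ζ‖ ^ 2 = ‖ξ‖ ^ 2 - 2 * ⟪ξ, ζ⟫ + ‖ζ‖ ^ 2 := norm_sub_sq_real ξ ζ
  have ea : ‖ξ‖ ^ (p - 1) = ‖ξ‖ ^ (p - 2) * ‖ξ‖ := by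
    rw [← Real.rpow_add_one ha.ne']; ring_nf
  have eb : ‖ζ‖ ^ (p - 1) = ‖ζ‖ ^ (p - 2) * ‖ζ‖ := by
    rw [← Real.rpow_add_one hb.ne']; ring_nf
  have ea2 : ‖ξ‖ ^ p = ‖ξ‖ ^ (p - 2) * ‖ξ‖ ^ 2 := by
    rw [← Real.rpow_natCast, ← Real.rpow_add ha]; congr 1; push_cast; ring
  have eb2 : ‖ζ‖ ^ p = ‖ζ‖ ^ (p - 2) * ‖ζ‖ ^ 2 := by
    rw [← Real.rpow_natCast, ← Real.rpow_add hb]; congr 1; push_cast; ring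
  have pa : 0 < ‖ξ‖ ^ (p - 2) := by positivity
  have pb : 0 < ‖ζ‖ ^ (p - 2) := by positivity
  rw [ea, eb] at k1 k2 k3 k4
  constructor
  · rw [inner_Phi_sub hp, hs, ea2, eb2]
    generalize ‖ξ‖ ^ (p - 2) = P at *
    generalize ‖ζ‖ ^ (p - 2) = Q at *
    generalize ‖ξ‖ = a at *
    generalize ‖ζ‖ = b at *
    have := affine_nonneg (A := P * a ^ 2 + Q * b ^ 2 - c * (a ^ 2 + b ^ 2))
      (B := 2 * c - (P + Q)) (t := ⟪ξ, ζ⟫) (r := a * b) (by nlinarith)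
      (by nlinarith [mul_le_mul_of_nonneg_right k2 (by positivity : 0 ≤ a + b)]) ht
    linarith
  · have hn : ‖Phi p ξ - Phi p ζ‖ ^ 2 = (‖ξ‖ ^ (p - 2) * ‖ξ‖) ^ 2 + (‖ζ‖ ^ (p - 2) * ‖ζ‖) ^ 2
        - 2 * (‖ξ‖ ^ (p - 2) * ‖ζ‖ ^ (p - 2)) * ⟪ξ, ζ⟫ := by
      rw [norm_sub_sq_real, norm_Phi hp, norm_Phi hp, ea, eb]
      unfold Phi
      rw [real_inner_smul_left, real_inner_smul_right]; ring
    refine abs_le_of_sq_le_sq' ?_ (by positivity) |>.2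
    rw [hn, mul_pow C, hs]
    generalize ‖ξ‖ ^ (p - 2) = P at *
    generalize ‖ζ‖ ^ (p - 2) = Q at *
    generalize ‖ξ‖ = a at *
    generalize ‖ζ‖ = b at *
    have q3 : (P * a - Q * b) ^ 2 ≤ C ^ 2 * (a - b) ^ 2 := by
      rw [← sq_abs (P * a - Q * b), ← sq_abs (a - b), ← mul_pow]
      gcongr
    have q4 : (P * a + Q * b) ^ 2 ≤ C ^ 2 * (a + b) ^ 2 := by
      rw [← mul_pow]
      gcongr
    have := affine_nonneg (A := C ^ 2 * (a ^ 2 + b ^ 2) - (P * a) ^ 2 - (Q * b) ^ 2)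
      (B := 2 * (P * Q) - 2 * C ^ 2) (t := ⟪ξ, ζ⟫) (r := a * b) (by nlinarith)
      (by nlinarith) ht
    linarith

end Phi


section tools
variable {N : ℕ}

/-- standard mollifier -/
structure IsMoll (ε : ℝ) (ρ : EE N → ℝ) : Prop where
  pos : 0 < ε
  smooth : ContDiff ℝ (⊤ : ℕ∞) ρ
  nonneg : ∀ x, 0 ≤ ρ x
  supp : Function.support ρ ⊆ ball 0 ε
  int : ∫ x, ρ x = 1

lemma IsMoll.exists {ε : ℝ} (h : 0 < ε) : ∃ ρ : EE N → ℝ, IsMoll ε ρ := by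
  let b : ContDiffBump (0 : EE N) := ⟨ε / 2, ε, by linarith, by linarith⟩
  exact ⟨b.normed volume, h, b.contDiff_normed, b.nonneg_normed, b.support_normed_eq.subset,
    b.integral_normed⟩

lemma IsMoll.tsupp {ε : ℝ} {ρ : EE N → ℝ} (h : IsMoll ε ρ) : tsupport ρ ⊆ closedBall 0 ε :=
  closure_minimal (h.supp.trans ball_subset_closedBall) isClosed_closedBall

lemma IsMoll.hcs {ε : ℝ} {ρ : EE N → ℝ} (h : IsMoll ε ρ) : HasCompactSupport ρ :=
  (isCompact_closedBall _ _).of_isClosed_subset (isClosed_tsupport _) h.tsupp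

noncomputable def mo {F : Type*} [NormedAddCommGroup F] [NormedSpace ℝ F]
    (ρ : EE N → ℝ) (f : EE N → F) (x : EE N) : F := ∫ y, ρ y • f (x - y)

section
variable {F : Type*} [NormedAddCommGroup F] [NormedSpace ℝ F]
variable {ε : ℝ} {ρ : EE N → ℝ} {f : EE N → F}

open ContinuousLinearMap in
lemma mo_eq : mo ρ f = convolution ρ f (lsmul ℝ ℝ) volume := rfl

lemma mo_contDiff [CompleteSpace F] (h : IsMoll ε ρ) (hf : Continuous f) :
    ContDiff ℝ (⊤ : ℕ∞) (mo ρ f) := by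
  rw [mo_eq]
  exact h.hcs.contDiff_convolution_left _ h.smooth hf.locallyIntegrable

lemma mo_close [CompleteSpace F] (h : IsMoll ε ρ) (hf : Continuous f) {x : EE N} {z : F} {δ : ℝ} (hδ : 0 ≤ δ)
    (hd : ∀ y ∈ ball x ε, dist (f y) z ≤ δ) : dist (mo ρ f x) z ≤ δ := by
  rw [mo_eq]
  exact dist_convolution_le hδ h.supp h.nonneg h.int hf.aestronglyMeasurable hd

lemma mo_int (h : IsMoll ε ρ) (hf : Continuous f) (x : EE N) :
    Integrable (fun y => ρ y • f (x - y)) := by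
  apply Continuous.integrable_of_hasCompactSupport
  · exact h.smooth.continuous.smul (hf.comp (by fun_prop))
  · exact h.hcs.smul_right

lemma mo_hasFDerivAt [CompleteSpace F] (h : IsMoll ε ρ) (hf : ContDiff ℝ 1 f) (x : EE N) :
    HasFDerivAt (mo ρ f) (mo ρ (fderiv ℝ f) x) x := by
  have hc := hf.continuous_fderiv (by norm_num)
  obtain ⟨C, hC⟩ := (isCompact_closedBall x (1 + ε)).exists_bound_of_continuousOn hc.continuousOn
  refine hasFDerivAt_integral_of_dominated_of_fderiv_le (F := fun x y => ρ y • f (x - y))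
    (F' := fun x y => ρ y • fderiv ℝ f (x - y)) (bound := fun y => ρ y * C)
    (ball_mem_nhds x one_pos) ?_ ?_ ?_ ?_ ?_ ?_
  · exact Filter.Eventually.of_forall fun z => (mo_int h hf.continuous z).aestronglyMeasurable
  · exact mo_int h hf.continuous x
  · exact (mo_int h hc x).aestronglyMeasurable
  · refine Filter.Eventually.of_forall fun y z hz => ?_
    rw [norm_smul, Real.norm_of_nonneg (h.nonneg y)]
    by_cases hy : ρ y = 0
    · simp [hy]
    · refine mul_le_mul_of_nonneg_left (hC _ ?_) (h.nonneg y)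
      have := h.supp hy
      rw [mem_ball_zero_iff] at this
      rw [mem_ball, dist_eq_norm] at hz
      rw [mem_closedBall, dist_eq_norm]
      have : z - y - x = (z - x) - y := by abel
      rw [this]
      exact (norm_sub_le _ _).trans (by linarith)
  · exact ((h.smooth.continuous.integrable_of_hasCompactSupport h.hcs).mul_const C)
  · refine Filter.Eventually.of_forall fun y z _ => ?_
    have := (hf.differentiable (by norm_num) (z - y)).hasFDerivAt.comp z
      ((hasFDerivAt_id z).sub_const y)
    exact this.const_smul (ρ y)

lemma mo_fderiv [CompleteSpace F] (h : IsMoll ε ρ) (hf : ContDiff ℝ 1 f) (x : EE N) :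
    fderiv ℝ (mo ρ f) x = mo ρ (fderiv ℝ f) x := (mo_hasFDerivAt h hf x).fderiv

lemma mo_clm {G : Type*} [NormedAddCommGroup G] [NormedSpace ℝ G] [CompleteSpace F] [CompleteSpace G]
    (h : IsMoll ε ρ) (hf : Continuous f) (L : F →L[ℝ] G) (x : EE N) :
    L (mo ρ f x) = mo ρ (fun y => L (f y)) x := by
  unfold mo
  rw [← L.integral_comp_comm (mo_int h hf x)]
  simp

lemma mo_gradient {u : EE N → ℝ} (h : IsMoll ε ρ) (hu : ContDiff ℝ 1 u) (x : EE N) :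
    gradient (mo ρ u) x = mo ρ (gradient u) x := by
  have hc := hu.continuous_fderiv (by norm_num)
  unfold gradient
  rw [mo_fderiv h hu]
  exact mo_clm h hc (InnerProductSpace.toDual ℝ (EE N)).symm.toContinuousLinearEquiv.toContinuousLinearMap x

lemma mo_tsupport (f : EE N → F) (h : IsMoll ε ρ) {K : Set (EE N)} (hK : IsCompact K)
    (hf : tsupport f ⊆ K) : tsupport (mo ρ f) ⊆ cthickening ε K := by
  apply closure_minimal _ isClosed_cthickening
  intro x hx
  by_contra hc
  apply hx
  unfold mo
  have : ∀ y, ρ y • f (x - y) = 0 := by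
    intro y
    by_cases hy : ρ y = 0
    · simp [hy]
    · have hy2 := h.supp hy
      rw [mem_ball_zero_iff] at hy2
      have : f (x - y) = 0 := by
        by_contra h3
        apply hc
        have : x - y ∈ K := hf (subset_tsupport _ h3)
        refine mem_cthickening_of_dist_le x (x - y) ε K this ?_
        rw [dist_eq_norm]; simpa using hy2.le
      simp [this]
  simp [this]

end

/-- uniform approximation -/
lemma mo_unif {F : Type*} [NormedAddCommGroup F] [NormedSpace ℝ F] [CompleteSpace F]
    {f : EE N → F} (hf : Continuous f)
    {K : Set (EE N)} (hK : IsCompact K) {δ : ℝ} (hδ : 0 < δ) :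
    ∃ ε₀ > 0, ∀ ε ρ, IsMoll ε ρ → ε ≤ ε₀ → ∀ x ∈ K, dist (mo ρ f x) (f x) ≤ δ := by
  have hK2 := hK.cthickening (r := 1)
  have := hK2.uniformContinuousOn_of_continuous hf.continuousOn
  rw [Metric.uniformContinuousOn_iff] at this
  obtain ⟨e, he, H⟩ := this δ hδ
  refine ⟨min e 1, by positivity, fun ε ρ h hε x hx => mo_close h hf hδ.le fun y hy => ?_⟩
  have hy' : dist y x < ε := hy
  refine (H y ?_ x ?_ ?_).le
  · exact mem_cthickening_of_dist_le y x 1 K hx (by linarith [min_le_right e 1])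
  · exact self_subset_cthickening _ hx
  · linarith [min_le_left e 1]

lemma exists_cutoff {K U : Set (EE N)} (hK : IsCompact K) (hU : IsOpen U) (hKU : K ⊆ U) :
    ∃ θ : EE N → ℝ, ContDiff ℝ (⊤ : ℕ∞) θ ∧ HasCompactSupport θ ∧ tsupport θ ⊆ U ∧
      (∀ x, 0 ≤ θ x ∧ θ x ≤ 1) ∧ ∃ V, IsOpen V ∧ K ⊆ V ∧ ∀ x ∈ V, θ x = 1 := by
  obtain ⟨L, hL, hKL, hLU⟩ := exists_compact_between hK hU hKU
  obtain ⟨f, h1, h2, h3⟩ := exists_contMDiffMap_one_nhds_of_subset_interior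
    (n := (⊤ : ℕ∞)) (modelWithCornersSelf ℝ (EE N)) hK.isClosed hKL
  have hts : tsupport f ⊆ L := by
    apply closure_minimal _ hL.isClosed
    intro x hx
    by_contra hc
    exact hx (h2 x hc)
  refine ⟨f, f.contMDiff.contDiff, hL.of_isClosed_subset (isClosed_tsupport _) hts, hts.trans hLU,
    fun x => ⟨(h3 x).1, (h3 x).2⟩, ?_⟩
  rw [Filter.eventually_iff, mem_nhdsSet_iff_exists] at h1
  obtain ⟨V, hV, hKV, h⟩ := h1
  exact ⟨V, hV, hKV, fun x hx => h hx⟩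

/-- integration by parts -/
lemma ibp {f g : EE N → ℝ} {v : EE N} (hf : ContDiff ℝ 1 f) (hg : ContDiff ℝ 1 g)
    (hc : HasCompactSupport f) :
    ∫ x, f x * fderiv ℝ g x v = - ∫ x, fderiv ℝ f x v * g x := by
  have h1 : Continuous fun x => fderiv ℝ f x v := by
    have := hf.continuous_fderiv (by norm_num); fun_prop
  have h2 : Continuous fun x => fderiv ℝ g x v := by
    have := hg.continuous_fderiv (by norm_num); fun_prop
  have hf0 := hf.continuous
  have hg0 := hg.continuous
  apply integral_mul_fderiv_eq_neg_fderiv_mul_of_integrable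
  · exact (h1.mul hg0).integrable_of_hasCompactSupport (HasCompactSupport.mul_right (hc.fderiv_apply ℝ v))
  · exact (hf0.mul h2).integrable_of_hasCompactSupport hc.mul_right
  · exact (hf0.mul hg0).integrable_of_hasCompactSupport hc.mul_right
  · exact fun x _ => hf.differentiable (by norm_num) x
  · exact fun x _ => hg.differentiable (by norm_num) x

lemma integral_fderiv_zero {f : EE N → ℝ} {v : EE N} (hf : ContDiff ℝ 1 f)
    (hc : HasCompactSupport f) : ∫ x, fderiv ℝ f x v = 0 := by
  have := ibp (v := v) hf (contDiff_const (c := (1 : ℝ))) hc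
  simpa using this

lemma int_cc {F : Type*} [NormedAddCommGroup F] {f : EE N → F} (hf : Continuous f)
    (K : Set (EE N)) (hK : IsCompact K)
    (h : ∀ x, x ∉ K → f x = 0) : Integrable f :=
  hf.integrable_of_hasCompactSupport (HasCompactSupport.intro hK h)

end tools


section tools2
variable {N : ℕ}

lemma int_bound {G : EE N → ℝ} {L : Set (EE N)} (hL : IsCompact L) {c : ℝ}
    (h0 : ∀ x, x ∉ L → G x = 0) (h1 : ∀ x ∈ L, |G x| ≤ c) :
    |∫ x, G x| ≤ c * volume.real L := by
  rw [← setIntegral_eq_integral_of_forall_compl_eq_zero h0]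
  rw [← Real.norm_eq_abs]
  exact norm_setIntegral_le_of_norm_le_const hL.measure_lt_top fun x hx => h1 x hx

lemma eq_of_close {a b C : ℝ} (h : ∀ δ > 0, |a - b| ≤ C * δ) : a = b := by
  have hC : 0 ≤ C := by have := h 1 one_pos; have := abs_nonneg (a - b); linarith
  by_contra hne
  have hpos : 0 < |a - b| := abs_pos.mpr (sub_ne_zero.mpr hne)
  have := h (|a - b| / (2 * (C + 1))) (by positivity)
  have h2 : C * (|a - b| / (2 * (C + 1))) ≤ |a - b| / 2 := by
    rw [mul_div_assoc', div_le_div_iff₀ (by positivity) (by norm_num)]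
    nlinarith
  linarith

/-- the weak formulation with smooth tests implies it with `C¹` tests -/
lemma weak_ext {V : EE N → EE N} {f : EE N → ℝ} (hV : Continuous V) (hf : Continuous f)
    {U : Set (EE N)} (hU : IsOpen U)
    (h : ∀ φ : EE N → ℝ, ContDiff ℝ (⊤ : ℕ∞) φ → HasCompactSupport φ → tsupport φ ⊆ U →
      ∫ x, ⟪V x, gradient φ x⟫ = ∫ x, f x * φ x)
    {φ : EE N → ℝ} (hφ : ContDiff ℝ 1 φ) (hc : HasCompactSupport φ) (hs : tsupport φ ⊆ U) :
    ∫ x, ⟪V x, gradient φ x⟫ = ∫ x, f x * φ x := by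
  obtain ⟨δ0, hδ0, hsub⟩ := hc.isCompact.exists_cthickening_subset_open hU hs
  set L := cthickening δ0 (tsupport φ) with hLdef
  have hL : IsCompact L := hc.isCompact.cthickening
  have hsL : tsupport φ ⊆ L := self_subset_cthickening _
  obtain ⟨A, hA⟩ := hL.exists_bound_of_continuousOn hV.continuousOn
  obtain ⟨B, hB⟩ := hL.exists_bound_of_continuousOn hf.continuousOn
  have hgc := grad_cont hφ
  apply eq_of_close (C := (A + B) * volume.real L)
  intro δ hδ
  obtain ⟨e1, he1, H1⟩ := mo_unif hφ.continuous hL hδ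
  obtain ⟨e2, he2, H2⟩ := mo_unif hgc hL hδ
  set ε := min (min e1 e2) δ0
  have hε : 0 < ε := by positivity
  obtain ⟨ρ, hρ⟩ := IsMoll.exists (N := N) hε
  have hε1 : ε ≤ e1 := (min_le_left _ _).trans (min_le_left _ _)
  have hε2 : ε ≤ e2 := (min_le_left _ _).trans (min_le_right _ _)
  have hε0 : ε ≤ δ0 := min_le_right _ _
  set ψ := mo ρ φ
  have hψ : ContDiff ℝ (⊤ : ℕ∞) ψ := mo_contDiff hρ hφ.continuous
  have hψ1 : ContDiff ℝ 1 ψ := hψ.of_le (by exact_mod_cast le_top)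
  have hψs : tsupport ψ ⊆ L :=
    (mo_tsupport φ hρ hc.isCompact subset_rfl).trans (cthickening_mono hε0 _)
  have hψc : HasCompactSupport ψ := hL.of_isClosed_subset (isClosed_tsupport _) hψs
  have key := h ψ hψ hψc (hψs.trans hsub)
  have hz : ∀ x, x ∉ L → φ x = 0 ∧ ψ x = 0 ∧ gradient φ x = 0 ∧ gradient ψ x = 0 := fun x hx =>
    ⟨image_eq_zero_of_notMem_tsupport fun h' => hx (hsL h'),
      image_eq_zero_of_notMem_tsupport fun h' => hx (hψs h'),
      grad_tsupport _ fun h' => hx (hsL h'), grad_tsupport _ fun h' => hx (hψs h')⟩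
  have i1 : Integrable fun x => ⟪V x, gradient φ x⟫ :=
    int_cc (hV.inner hgc) L hL fun x hx => by simp [(hz x hx).2.2.1]
  have i2 : Integrable fun x => ⟪V x, gradient ψ x⟫ :=
    int_cc (hV.inner (grad_cont hψ1)) L hL fun x hx => by simp [(hz x hx).2.2.2]
  have i3 : Integrable fun x => f x * φ x :=
    int_cc (hf.mul hφ.continuous) L hL fun x hx => by simp [(hz x hx).1]
  have i4 : Integrable fun x => f x * ψ x :=
    int_cc (hf.mul hψ.continuous) L hL fun x hx => by simp [(hz x hx).2.1]
  have e1 : |∫ x, (⟪V x, gradient φ x⟫ - ⟪V x, gradient ψ x⟫)| ≤ (A * δ) * volume.real L := by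
    apply int_bound hL
    · intro x hx; simp [(hz x hx).2.2.1, (hz x hx).2.2.2]
    · intro x hx
      rw [← inner_sub_right]
      refine (abs_real_inner_le_norm _ _).trans ?_
      have := H2 ε ρ hρ hε2 x hx
      rw [← mo_gradient hρ hφ, dist_comm, dist_eq_norm] at this
      exact mul_le_mul (hA x hx) this (norm_nonneg _) ((norm_nonneg _).trans (hA x hx))
  have e2 : |∫ x, (f x * φ x - f x * ψ x)| ≤ (B * δ) * volume.real L := by
    apply int_bound hL
    · intro x hx; simp [(hz x hx).1, (hz x hx).2.1]
    · intro x hx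
      rw [← mul_sub, abs_mul]
      have := H1 ε ρ hρ hε1 x hx
      rw [dist_comm, dist_eq_norm] at this
      exact mul_le_mul (hB x hx) this (abs_nonneg _) ((norm_nonneg _).trans (hB x hx))
  rw [integral_sub i1 i2] at e1
  rw [integral_sub i3 i4] at e2
  rw [abs_le] at *
  constructor <;> nlinarith

/-- pushing a function supported in the ball: modify outside -/
lemma IsSol.congr {p lam r : ℝ} {u w : EE N → ℝ} (h : IsSol p lam r u)
    (e : ∀ x ∈ ball (0 : EE N) r, w x = u x) : IsSol p lam r w := by
  intro φ h1 h2 h3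
  have := h φ h1 h2 h3
  have e1 : ∀ x, ⟪Phi p (gradient w x), gradient φ x⟫ = ⟪Phi p (gradient u x), gradient φ x⟫ := by
    intro x
    by_cases hx : x ∈ tsupport φ
    · have : w =ᶠ[nhds x] u := by
        filter_upwards [isOpen_ball.mem_nhds (h3 hx)] with y hy using e y hy
      unfold gradient
      rw [this.fderiv_eq]
    · simp [grad_tsupport φ hx]
  have e2 : ∀ x, w x ^ lam * φ x = u x ^ lam * φ x := by
    intro x
    by_cases hx : x ∈ tsupport φ
    · rw [e x (h3 hx)]
    · simp [image_eq_zero_of_notMem_tsupport hx]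
  simp_rw [e1, e2]; exact this

lemma IsSol.mono {p lam r r' : ℝ} {u : EE N → ℝ} (h : IsSol p lam r u) (hr : r' ≤ r) :
    IsSol p lam r' u := fun φ h1 h2 h3 => h φ h1 h2 (h3.trans (ball_subset_ball hr))

/-- translation of the equation -/
lemma IsSol.diff {p lam r : ℝ} {u : EE N → ℝ} (h : IsSol p lam r u) (hp : 1 < p) (hl : 0 ≤ lam)
    (hu : ContDiff ℝ 1 u) (a : EE N)
    {φ : EE N → ℝ} (h1 : ContDiff ℝ 1 φ) (h2 : HasCompactSupport φ)
    (h3 : tsupport φ ⊆ ball 0 (r - ‖a‖)) :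
    ∫ x, ⟪Phi p (gradient u (x + a)) - Phi p (gradient u x), gradient φ x⟫ =
      ∫ x, (u (x + a) ^ lam - u x ^ lam) * φ x := by
  have hV : Continuous fun x => Phi p (gradient u x) := (Phi_cont hp).comp (grad_cont hu)
  have hf : Continuous fun x => u x ^ lam := hu.continuous.rpow_const fun x => Or.inr hl
  have hg := grad_cont h1
  have k1 := h φ h1 h2 (h3.trans (ball_subset_ball (by linarith [norm_nonneg a])))
  have ht : tsupport (fun x => φ (x - a)) ⊆ (fun x => x - a) ⁻¹' tsupport φ := by
    apply closure_minimal
    · intro x hx; exact subset_tsupport _ hx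
    · exact (isClosed_tsupport φ).preimage (by fun_prop)
  have k2 := h (fun x => φ (x - a)) (h1.comp (by fun_prop))
    (h2.comp_homeomorph (Homeomorph.subRight a)) (by
      intro x hx
      have := h3 (ht hx)
      rw [mem_ball_zero_iff] at this ⊢
      calc ‖x‖ = ‖(x - a) + a‖ := by simp
        _ ≤ ‖x - a‖ + ‖a‖ := norm_add_le _ _
        _ < r := by linarith)
  have k3 : ∫ x, ⟪Phi p (gradient u x), gradient (fun x => φ (x - a)) x⟫ =
      ∫ x, ⟪Phi p (gradient u (x + a)), gradient φ x⟫ := by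
    rw [← integral_add_right_eq_self _ a]
    congr 1; ext x
    have := grad_translate φ (x + a) (-a)
    simp only [← sub_eq_add_neg, add_sub_cancel_right] at this
    rw [this]
  have k4 : ∫ x, u x ^ lam * φ (x - a) = ∫ x, u (x + a) ^ lam * φ x := by
    rw [← integral_add_right_eq_self _ a]
    simp
  rw [k3, k4] at k2
  simp_rw [inner_sub_left, sub_mul]
  have hz : ∀ x, x ∉ tsupport φ → φ x = 0 ∧ gradient φ x = 0 := fun x hx =>
    ⟨image_eq_zero_of_notMem_tsupport hx, grad_tsupport _ hx⟩
  have hVa : Continuous fun x => Phi p (gradient u (x + a)) := hV.comp (continuous_add_const a)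
  have hfa : Continuous fun x => u (x + a) ^ lam := hf.comp (continuous_add_const a)
  rw [integral_sub, integral_sub, k1, k2]
  · exact int_cc (hfa.mul h1.continuous) _ h2.isCompact fun x hx => by simp [(hz x hx).1]
  · exact int_cc (hf.mul h1.continuous) _ h2.isCompact fun x hx => by simp [(hz x hx).1]
  · exact int_cc (hVa.inner hg) _ h2.isCompact fun x hx => by simp [(hz x hx).2]
  · exact int_cc (hV.inner hg) _ h2.isCompact fun x hx => by simp [(hz x hx).2]

end tools2


section FK

lemma euc1_bound (f : EE 1 → ℝ) (hf : ContDiff ℝ 1 f) (hc : HasCompactSupport f) (x : EE 1) :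
    |f x| ≤ ∫ y, ‖fderiv ℝ f y‖ := by
  let e0 : EE 1 := EuclideanSpace.single 0 1
  have he0 : ‖e0‖ = 1 := by simp [e0]
  have hfc := hf.continuous_fderiv (by norm_num)
  -- transfer to the line
  let g : ℝ → ℝ := fun t => f (t • e0)
  have hg' : ∀ t, HasDerivAt g (fderiv ℝ f (t • e0) e0) t := by
    intro t
    have h1 : HasDerivAt (fun t : ℝ => t • e0) e0 t := by
      simpa using (hasDerivAt_id t).smul_const e0
    exact (hf.differentiable (by norm_num) (t • e0)).hasFDerivAt.comp_hasDerivAt t h1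
  have hcemb : Topology.IsClosedEmbedding (fun t : ℝ => t • e0) := by
    apply Isometry.isClosedEmbedding
    apply Isometry.of_dist_eq
    intro s t
    rw [dist_eq_norm, ← sub_smul, norm_smul, he0, mul_one, dist_eq_norm]
  have hgc : HasCompactSupport (fun t => fderiv ℝ f (t • e0) e0) :=
    (hc.fderiv_apply ℝ e0).comp_isClosedEmbedding hcemb
  have hgc0 : HasCompactSupport g := hc.comp_isClosedEmbedding hcemb
  have hgint : Integrable (fun t : ℝ => fderiv ℝ f (t • e0) e0) := by
    apply Continuous.integrable_of_hasCompactSupport _ hgc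
    fun_prop
  have htr : ∫ t : ℝ, ‖fderiv ℝ f (t • e0)‖ = ∫ y, ‖fderiv ℝ f y‖ := by
    have m1 := (EuclideanSpace.volume_preserving_symm_measurableEquiv_toLp (Fin 1))
    have m2 := (volume_preserving_funUnique (Fin 1) ℝ)
    have m3 := (m1.trans m2).symm
    rw [← m3.integral_comp' (g := fun y => ‖fderiv ℝ f y‖)]
    congr 1; ext t
    congr 2
    ext i; fin_cases i; simp [e0]
  have hx : x = (x 0) • e0 := by ext i; fin_cases i; simp [e0]
  have hint2 : Integrable (fun t : ℝ => ‖fderiv ℝ f (t • e0)‖) := by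
    apply Continuous.integrable_of_hasCompactSupport
    · fun_prop
    · exact ((hc.fderiv ℝ).comp_isClosedEmbedding hcemb).norm
  have hlim : Filter.Tendsto g Filter.atBot (nhds 0) := by
    have := hgc0.is_zero_at_infty
    rw [cocompact_eq_atBot_atTop] at this
    exact this.mono_left le_sup_left
  have hft := integral_Iic_of_hasDerivAt_of_tendsto' (a := x 0) (f := g) (fun t _ => hg' t)
    hgint.integrableOn hlim
  have : f x = ∫ t in Set.Iic (x 0), fderiv ℝ f (t • e0) e0 := by
    rw [hft, sub_zero]; conv_lhs => rw [hx]
  rw [this, ← htr, ← Real.norm_eq_abs]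
  calc ‖∫ t in Set.Iic (x 0), fderiv ℝ f (t • e0) e0‖
      ≤ ∫ t in Set.Iic (x 0), ‖fderiv ℝ f (t • e0) e0‖ := norm_integral_le_integral_norm _
    _ ≤ ∫ t in Set.Iic (x 0), ‖fderiv ℝ f (t • e0)‖ := by
        apply integral_mono hgint.integrableOn.norm hint2.integrableOn
        intro t
        have := (fderiv ℝ f (t • e0)).le_opNorm e0
        rwa [he0, mul_one] at this
    _ ≤ ∫ t, ‖fderiv ℝ f (t • e0)‖ :=
        setIntegral_le_integral hint2 (Filter.Eventually.of_forall fun t => norm_nonneg _)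

lemma sobolev11 {N : ℕ} (hN : 1 ≤ N) : ∃ C : ℝ, 0 < C ∧ ∀ f : EE N → ℝ, ContDiff ℝ 1 f →
    HasCompactSupport f → ∀ m : ℝ, volume.real (Function.support f) ≤ m →
    ∫ x, |f x| ≤ C * m ^ ((1 : ℝ) / N) * ∫ x, ‖fderiv ℝ f x‖ := by
  rcases Nat.lt_or_ge 1 N with h2 | h2
  · have hN0 : (0:ℝ) < N := by positivity
    have hN1 : (1:ℝ) < N := by exact_mod_cast h2
    set q : NNReal := Real.toNNReal (N / (N - 1)) with hq
    have hqr : (q : ℝ) = N / (N - 1) := Real.coe_toNNReal _ (by apply div_nonneg <;> linarith)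
    have hconj : NNReal.HolderConjugate (Module.finrank ℝ (EE N)) q := by
      rw [NNReal.holderConjugate_iff_eq_conjExponent]
      · simp only [finrank_euclideanSpace, Fintype.card_fin]
        ext
        rw [hqr]
        push_cast [NNReal.coe_sub (show (1:NNReal) ≤ (N:NNReal) by exact_mod_cast h2.le)]
        rfl
      · simp; exact_mod_cast h2
    set K := eLpNormLESNormFDerivOneConst (volume : Measure (EE N)) q
    refine ⟨K + 1, by positivity, ?_⟩
    intro f hf hc m hm
    have hm0 : 0 ≤ m := le_trans measureReal_nonneg hm
    have h1 := eLpNorm_le_eLpNorm_fderiv_one (volume : Measure (EE N)) hf hc hconj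
    have hfi : Integrable f := hf.continuous.integrable_of_hasCompactSupport hc
    have hfdc := hf.continuous_fderiv (by norm_num)
    have hdi : Integrable (fderiv ℝ f) := hfdc.integrable_of_hasCompactSupport (hc.fderiv ℝ)
    set S := Function.support f
    have hSm : MeasurableSet S := measurableSet_support hf.continuous.measurable
    have hSfin : volume S ≠ ⊤ := ((measure_mono (subset_tsupport f)).trans_lt
      hc.isCompact.measure_lt_top).ne
    have hq1 : (1:ENNReal) ≤ q := by
      have : (1:ℝ) ≤ q := by rw [hqr, le_div_iff₀ (by linarith)]; linarith
      exact_mod_cast this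
    have h3 := eLpNorm_le_eLpNorm_mul_rpow_measure_univ (μ := volume.restrict S) hq1
      (f := f) hf.continuous.aestronglyMeasurable
    have h4 : eLpNorm f 1 (volume.restrict S) = eLpNorm f 1 volume := by
      rw [eLpNorm_one_eq_lintegral_enorm, eLpNorm_one_eq_lintegral_enorm]
      rw [setLIntegral_eq_of_support_subset]
      intro x hx
      by_contra h
      apply hx
      simp [Function.notMem_support.mp h]
    have h5 : eLpNorm f q (volume.restrict S) ≤ eLpNorm f q volume :=
      eLpNorm_mono_measure _ Measure.restrict_le_self
    have hexp : 1 / (1 : ENNReal).toReal - 1 / (q : ENNReal).toReal = 1 / N := by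
      simp only [ENNReal.toReal_one, ENNReal.coe_toReal, hqr]; field_simp; ring
    rw [h4, hexp, Measure.restrict_apply_univ] at h3
    have h6 : eLpNorm f 1 volume ≤ K * eLpNorm (fderiv ℝ f) 1 volume * volume S ^ ((1:ℝ) / N) :=
      h3.trans (mul_le_mul_left (h5.trans h1) _)
    have h7 := ENNReal.toReal_mono (by
      apply ENNReal.mul_ne_top (ENNReal.mul_ne_top (by simp) _)
      · exact ENNReal.rpow_ne_top_of_nonneg (by positivity) hSfin
      · exact (memLp_one_iff_integrable.mpr hdi).eLpNorm_ne_top) h6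
    rw [ENNReal.toReal_mul, ENNReal.toReal_mul, ← ENNReal.toReal_rpow] at h7
    have e1 : (eLpNorm f 1 volume).toReal = ∫ x, |f x| := by
      rw [eLpNorm_one_eq_lintegral_enorm, ← integral_norm_eq_lintegral_enorm hfi.aestronglyMeasurable]
      rfl
    have e2 : (eLpNorm (fderiv ℝ f) 1 volume).toReal = ∫ x, ‖fderiv ℝ f x‖ := by
      rw [eLpNorm_one_eq_lintegral_enorm, ← integral_norm_eq_lintegral_enorm hdi.aestronglyMeasurable]
    rw [e1, e2] at h7
    refine h7.trans ?_
    have e3 : (volume S).toReal ^ ((1:ℝ)/N) ≤ m ^ ((1:ℝ)/N) :=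
      Real.rpow_le_rpow ENNReal.toReal_nonneg hm (by positivity)
    have e4 : 0 ≤ ∫ x, ‖fderiv ℝ f x‖ := integral_nonneg fun x => norm_nonneg _
    calc _ = K * (volume S).toReal ^ ((1:ℝ)/N) * ∫ x, ‖fderiv ℝ f x‖ := by
            simp only [ENNReal.coe_toReal]; ring
      _ ≤ _ := by
        gcongr
        linarith
  · obtain rfl : N = 1 := by omega
    refine ⟨1, one_pos, ?_⟩
    intro f hf hc m hm
    set S := Function.support f
    have hSfin : volume S < ⊤ := (measure_mono (subset_tsupport f)).trans_lt
      hc.isCompact.measure_lt_top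
    have e4 : 0 ≤ ∫ x, ‖fderiv ℝ f x‖ := integral_nonneg fun x => norm_nonneg _
    rw [← setIntegral_eq_integral_of_forall_compl_eq_zero (s := S)
      (fun x hx => by simp [Function.notMem_support.mp hx])]
    have := norm_setIntegral_le_of_norm_le_const (f := fun x => |f x|) hSfin
      (fun x _ => by simpa using euc1_bound f hf hc x)
    refine (Real.le_norm_self _).trans (this.trans ?_)
    simp only [Nat.cast_one, div_one, Real.rpow_one, one_mul]
    rw [mul_comm]
    gcongr

set_option maxHeartbeats 200000 in
/-- Faber-Krahn type inequality -/
lemma faber_krahn {N : ℕ} (hN : 1 ≤ N) : ∃ C : ℝ, 0 < C ∧ ∀ g : EE N → ℝ, ContDiff ℝ 1 g →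
    HasCompactSupport g → ∀ m : ℝ, 0 < m → volume.real (Function.support g) ≤ m →
    ∫ x, g x ^ 2 ≤ C * m ^ ((2 : ℝ) / N) * ∫ x, ‖gradient g x‖ ^ 2 := by
  obtain ⟨C, hC, H⟩ := sobolev11 hN
  refine ⟨4 * C ^ 2, by positivity, ?_⟩
  intro g hg hc m hm hs
  have hgc := grad_cont hg
  have hg2 : ContDiff ℝ 1 (fun x => g x ^ 2) := hg.pow 2
  have hc2 : HasCompactSupport (fun x => g x ^ 2) := hc.comp_left (g := fun t : ℝ => t ^ 2) (by simp)
  have hsupp : Function.support (fun x => g x ^ 2) = Function.support g := by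
    ext x; simp
  have h1 := H _ hg2 hc2 m (by rw [hsupp]; exact hs)
  obtain ⟨A, hA⟩ : ∃ A, A = C * m ^ ((1:ℝ) / N) := ⟨_, rfl⟩
  have hApos : 0 < A := by rw [hA]; positivity
  rw [← hA] at h1
  have hA2 : 4 * C ^ 2 * m ^ ((2:ℝ)/N) = 4 * A ^ 2 := by
    rw [hA, mul_pow, ← Real.rpow_natCast (m ^ _), ← Real.rpow_mul hm.le]
    rw [show (1:ℝ) / N * (2:ℕ) = 2 / N by push_cast; ring]; ring
  rw [hA2]
  have i1 : Integrable fun x => g x ^ 2 := hg2.continuous.integrable_of_hasCompactSupport hc2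
  have i2 : Integrable fun x => ‖gradient g x‖ ^ 2 :=
    int_cc (hgc.norm.pow 2) _ hc.isCompact fun x hx => by simp [grad_tsupport g hx]
  have h2 : ∫ x, ‖fderiv ℝ (fun x => g x ^ 2) x‖ ≤
      ∫ x, ((1 / (2 * A)) * g x ^ 2 + 2 * A * ‖gradient g x‖ ^ 2) := by
    apply integral_mono
    · exact ((hg2.continuous_fderiv (by norm_num)).integrable_of_hasCompactSupport
        (hc2.fderiv ℝ)).norm
    · exact (i1.const_mul _).add (i2.const_mul _)
    · intro x
      have : ‖fderiv ℝ (fun x => g x ^ 2) x‖ = 2 * |g x| * ‖gradient g x‖ := by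
        rw [← norm_grad, grad_comp (h := fun t => t ^ 2) (h' := 2 * g x)
          (by simpa using hasDerivAt_pow 2 (g x)) (hg.differentiable (by norm_num) x), norm_smul]
        simp
      simp only [this]
      have e1 : g x ^ 2 = |g x| ^ 2 := (sq_abs _).symm
      rw [e1]
      have : 0 ≤ (1 / (2 * A)) * (|g x| - 2 * A * ‖gradient g x‖) ^ 2 := by positivity
      have e2 : (1 / (2 * A)) * (|g x| - 2 * A * ‖gradient g x‖) ^ 2 =
        1 / (2 * A) * |g x| ^ 2 + 2 * A * ‖gradient g x‖ ^ 2 - 2 * |g x| * ‖gradient g x‖ := by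
        field_simp; ring
      linarith
  rw [integral_add (i1.const_mul _) (i2.const_mul _), integral_const_mul, integral_const_mul] at h2
  have h3 : ∫ x, |g x ^ 2| = ∫ x, g x ^ 2 := by congr 1; ext x; exact abs_of_nonneg (sq_nonneg _)
  rw [h3] at h1
  have h4 := h1.trans (mul_le_mul_of_nonneg_left h2 hApos.le)
  have e : A * (1 / (2 * A) * ∫ x, g x ^ 2) = (1/2) * ∫ x, g x ^ 2 := by field_simp
  rw [mul_add, e] at h4
  have e5 : A * (2 * A * ∫ x, ‖gradient g x‖ ^ 2) = 2 * A ^ 2 * ∫ x, ‖gradient g x‖ ^ 2 := by ring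
  rw [e5] at h4
  linarith

end FK


section pospart

lemma posrpow_hasDerivAt {r : ℝ} (hr : 1 < r) (t : ℝ) :
    HasDerivAt (fun t : ℝ => (max t 0) ^ r) (r * (max t 0) ^ (r - 1)) t := by
  rcases lt_trichotomy t 0 with h | h | h
  · rw [max_eq_right h.le, Real.zero_rpow (by linarith), mul_zero]
    apply (hasDerivAt_const t (0:ℝ)).congr_of_eventuallyEq
    filter_upwards [eventually_lt_nhds h] with s hs
    rw [max_eq_right hs.le, Real.zero_rpow (by linarith)]
  · subst h
    rw [max_self, Real.zero_rpow (by linarith), mul_zero, ← hasDerivWithinAt_univ,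
      ← Set.Iic_union_Ici (a := (0:ℝ))]
    apply HasDerivWithinAt.union
    · apply (hasDerivWithinAt_const (0:ℝ) (Set.Iic 0) (0:ℝ)).congr
      · intro s hs
        rw [max_eq_right hs, Real.zero_rpow (by linarith)]
      · rw [max_self, Real.zero_rpow (by linarith)]
    · have := (Real.hasDerivAt_rpow_const (x := 0) (p := r) (Or.inr hr.le)).hasDerivWithinAt
        (s := Set.Ici 0)
      rw [Real.zero_rpow (by linarith), mul_zero] at this
      apply this.congr
      · intro s hs
        rw [max_eq_left hs]
      · rw [max_self]
  · rw [max_eq_left h.le]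
    apply (Real.hasDerivAt_rpow_const (Or.inr hr.le)).congr_of_eventuallyEq
    filter_upwards [eventually_gt_nhds h] with s hs
    rw [max_eq_left hs.le]

lemma posrpow_contDiff {r : ℝ} (hr : 1 < r) : ContDiff ℝ 1 (fun t : ℝ => (max t 0) ^ r) := by
  rw [contDiff_one_iff_deriv]
  refine ⟨fun t => (posrpow_hasDerivAt hr t).differentiableAt, ?_⟩
  have : deriv (fun t : ℝ => (max t 0) ^ r) = fun t => r * (max t 0) ^ (r - 1) := by
    ext t; exact (posrpow_hasDerivAt hr t).deriv
  rw [this]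
  apply continuous_const.mul
  exact (continuous_id.max continuous_const).rpow_const fun x => Or.inr (by linarith)

end pospart

section shift
variable {N : ℕ}

lemma shift_int {φ : EE N → ℝ} (hφ : ContDiff ℝ 1 φ) (hc : HasCompactSupport φ) (a : EE N) :
    ∫ x, |φ (x + a) - φ x| ≤ ‖a‖ * ∫ x, ‖gradient φ x‖ := by
  have hfc := hφ.continuous_fderiv (by norm_num)
  have hgc := grad_cont hφ
  have ig : Integrable (gradient φ) := hgc.integrable_of_hasCompactSupport (grad_hcs hc)
  have ca : Continuous fun x => φ (x + a) - φ x := by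
    have := hφ.continuous; fun_prop
  have key : ∫⁻ x, ‖φ (x + a) - φ x‖ₑ ≤ ENNReal.ofReal (‖a‖) * ∫⁻ x, ‖gradient φ x‖ₑ := by
    calc ∫⁻ x, ‖φ (x + a) - φ x‖ₑ
        ≤ ∫⁻ x, ∫⁻ t in Set.Ioc (0:ℝ) 1, ENNReal.ofReal ‖a‖ * ‖gradient φ (x + t • a)‖ₑ := by
          apply lintegral_mono
          intro x
          have hd : ∀ t ∈ Set.uIcc (0:ℝ) 1, HasDerivAt (fun t : ℝ => φ (x + t • a))
              (fderiv ℝ φ (x + t • a) a) t := by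
            intro t _
            have h1 : HasDerivAt (fun t : ℝ => x + t • a) a t := by
              simpa using ((hasDerivAt_id t).smul_const a).const_add x
            exact (hφ.differentiable (by norm_num) (x + t • a)).hasFDerivAt.comp_hasDerivAt t h1
          have hci : Continuous fun t : ℝ => fderiv ℝ φ (x + t • a) a := by fun_prop
          have := intervalIntegral.integral_eq_sub_of_hasDerivAt hd (hci.intervalIntegrable 0 1)
          simp only [one_smul, zero_smul, add_zero] at this
          simp only
          rw [← this, intervalIntegral.integral_of_le zero_le_one]
          refine (enorm_integral_le_lintegral_enorm _).trans (lintegral_mono fun t => ?_)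
          simp only
          rw [← ofReal_norm, ← ofReal_norm, ← ENNReal.ofReal_mul (norm_nonneg _)]
          apply ENNReal.ofReal_le_ofReal
          rw [norm_grad, mul_comm]
          exact (fderiv ℝ φ (x + t • a)).le_opNorm a
      _ = ∫⁻ t in Set.Ioc (0:ℝ) 1, ∫⁻ x, ENNReal.ofReal ‖a‖ * ‖gradient φ (x + t • a)‖ₑ := by
          apply lintegral_lintegral_swap
          apply Continuous.aemeasurable
          have : Continuous fun z : EE N × ℝ => gradient φ (z.1 + z.2 • a) := by fun_prop
          exact ENNReal.continuous_const_mul ENNReal.ofReal_ne_top |>.comp this.enorm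
      _ = ∫⁻ t in Set.Ioc (0:ℝ) 1, ENNReal.ofReal ‖a‖ * ∫⁻ x, ‖gradient φ x‖ₑ := by
          congr 1; ext t
          rw [lintegral_const_mul' _ _ ENNReal.ofReal_ne_top]
          congr 1
          exact lintegral_add_right_eq_self (fun x => ‖gradient φ x‖ₑ) (t • a)
      _ = _ := by simp
  have h1 := integral_norm_eq_lintegral_enorm (μ := volume) ca.aestronglyMeasurable
  have h2 := integral_norm_eq_lintegral_enorm (μ := volume) hgc.aestronglyMeasurable
  have h3 : ∫ x, |φ (x + a) - φ x| = ∫ x, ‖φ (x + a) - φ x‖ := rfl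
  rw [h3, h1, h2]
  have := ENNReal.toReal_mono (ENNReal.mul_ne_top ENNReal.ofReal_ne_top
    (by exact ig.2.ne)) key
  rwa [ENNReal.toReal_mul, ENNReal.toReal_ofReal (norm_nonneg _)] at this

end shift


section caccio
variable {N : ℕ}

/-- difference quotient -/
noncomputable def dq (u : EE N → ℝ) (a : EE N) (h : ℝ) (x : EE N) : ℝ := h⁻¹ * (u (x + a) - u x)

lemma dq_contDiff {u : EE N → ℝ} (hu : ContDiff ℝ 1 u) (a : EE N) (h : ℝ) :
    ContDiff ℝ 1 (dq u a h) := by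
  unfold dq
  exact contDiff_const.mul ((hu.comp (by fun_prop)).sub hu)

lemma dq_grad {u : EE N → ℝ} (hu : ContDiff ℝ 1 u) (a : EE N) (h : ℝ) (x : EE N) :
    gradient (dq u a h) x = h⁻¹ • (gradient u (x + a) - gradient u x) := by
  have hd := hu.differentiable (by norm_num)
  have hd2 : Differentiable ℝ fun y => u (y + a) := hd.comp (by fun_prop)
  have h3 : DifferentiableAt ℝ (fun y => u (y + a) - u y) x := (hd2 x).sub (hd x)
  unfold dq
  rw [grad_const_mul _ h3, grad_sub (hd2 x) (hd x), grad_translate]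

lemma caccio_alg {c1 C1 h η P X G iVD iVG : ℝ} (hc1 : 0 < c1) (hh : 0 < h) (hη : 0 ≤ η)
    (hP : 0 ≤ P) (hX : 0 ≤ X) (hG : 0 ≤ G) (h1 : c1 * h * X ^ 2 ≤ iVD)
    (h2 : -(C1 * h * X * G) ≤ iVG) :
    h * (c1 * (η ^ 2 * P * X ^ 2) -
      ((2 * C1 ^ 2 / c1) * (P ^ 3 * G ^ 2) + (2 / c1) * (η ^ 2 * P) + 2 * (η * P ^ 2 * G))) ≤
    (2 * η * P ^ 2) * iVG + (2 * η ^ 2 * P) * iVD -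
      h * (2 * η * P ^ 2 * G + 2 * η ^ 2 * P * X) := by
  have k1 : (2 * η * P ^ 2) * (-(C1 * h * X * G)) ≤ (2 * η * P ^ 2) * iVG :=
    mul_le_mul_of_nonneg_left h2 (by positivity)
  have k2 : (2 * η ^ 2 * P) * (c1 * h * X ^ 2) ≤ (2 * η ^ 2 * P) * iVD :=
    mul_le_mul_of_nonneg_left h1 (by positivity)
  have k3 : 0 ≤ h * P * (1 / (2 * c1)) * (c1 * η * X - 2 * C1 * P * G) ^ 2 := by positivity
  have k4 : 0 ≤ h * P * η ^ 2 * (1 / (2 * c1)) * (c1 * X - 2) ^ 2 := by positivity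
  have e3 : h * P * (1 / (2 * c1)) * (c1 * η * X - 2 * C1 * P * G) ^ 2 =
    h * ((c1 / 2) * (η ^ 2 * P * X ^ 2) - 2 * C1 * η * P ^ 2 * X * G
      + (2 * C1 ^ 2 / c1) * (P ^ 3 * G ^ 2)) := by field_simp; ring
  have e4 : h * P * η ^ 2 * (1 / (2 * c1)) * (c1 * X - 2) ^ 2 =
    h * ((c1 / 2) * (η ^ 2 * P * X ^ 2) - 2 * η ^ 2 * P * X + (2 / c1) * (η ^ 2 * P)) := by
    field_simp; ring
  nlinarith

lemma caccio {p lam r c1 C1 k h : ℝ} (hp : 1 < p) (hl : 0 ≤ lam) (hc1 : 0 < c1)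
    {u : EE N → ℝ} (hu : ContDiff ℝ 1 u) (hu0 : ∀ x, 0 ≤ u x) (hsol : IsSol p lam r u)
    (hf1 : ∀ x ∈ ball (0 : EE N) r, u x ^ lam ≤ 1) (hh : 0 < h) {e : EE N} (he : ‖e‖ = 1)
    {η : EE N → ℝ} (hη : ContDiff ℝ 1 η) (hηc : HasCompactSupport η)
    (hηs : tsupport η ⊆ ball 0 (r - h)) (hη0 : ∀ x, 0 ≤ η x)
    (hann : ∀ x ∈ tsupport η, k < dq u (h • e) h x →
      c1 * ‖gradient u (x + h • e) - gradient u x‖ ^ 2 ≤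
        ⟪Phi p (gradient u (x + h • e)) - Phi p (gradient u x),
          gradient u (x + h • e) - gradient u x⟫ ∧
      ‖Phi p (gradient u (x + h • e)) - Phi p (gradient u x)‖ ≤
        C1 * ‖gradient u (x + h • e) - gradient u x‖) :
    c1 * ∫ x, η x ^ 2 * max (dq u (h • e) h x - k) 0 * ‖gradient (dq u (h • e) h) x‖ ^ 2 ≤
      ∫ x, ((2 * C1 ^ 2 / c1) * (max (dq u (h • e) h x - k) 0 ^ 3 * ‖gradient η x‖ ^ 2) +
        (2 / c1) * (η x ^ 2 * max (dq u (h • e) h x - k) 0) +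
        2 * (η x * max (dq u (h • e) h x - k) 0 ^ 2 * ‖gradient η x‖)) := by
  set a := h • e with ha
  have hna : ‖a‖ = h := by rw [ha, norm_smul, he, Real.norm_of_nonneg hh.le, mul_one]
  set d := dq u a h with hd
  have hdC : ContDiff ℝ 1 d := dq_contDiff hu a h
  have hdd := hdC.differentiable (by norm_num)
  have hηd := hη.differentiable (by norm_num)
  set P : EE N → ℝ := fun x => max (d x - k) 0 with hP
  have hPc : Continuous P := by have := hdC.continuous; fun_prop
  have hP0 : ∀ x, 0 ≤ P x := fun x => le_max_right _ _
  have hP2 : ContDiff ℝ 1 fun x => P x ^ 2 := by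
    have := (posrpow_contDiff (r := 2) (by norm_num)).comp (hdC.sub (contDiff_const (c := k)))
    have e1 : (fun x => P x ^ 2) = (fun t : ℝ => (max t 0) ^ (2 : ℝ)) ∘ (fun x => d x - k) := by
      ext x; simp [hP]
    rw [e1]; exact this
  have gP2 : ∀ x, gradient (fun x => P x ^ 2) x = (2 * P x) • gradient d x := by
    intro x
    have h1 : HasDerivAt (fun t : ℝ => max (t - k) 0 ^ 2) (2 * P x) (d x) := by
      have := (posrpow_hasDerivAt (r := 2) (by norm_num) (d x - k)).comp (d x)
        ((hasDerivAt_id (d x)).sub_const k)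
      norm_num at this
      exact this
    exact grad_comp (h := fun t : ℝ => max (t - k) 0 ^ 2) h1 (hdd x)
  set φ : EE N → ℝ := fun x => η x ^ 2 * P x ^ 2 with hφ
  have hφC : ContDiff ℝ 1 φ := (hη.pow 2).mul hP2
  have hφs : tsupport φ ⊆ tsupport η := by
    apply closure_mono
    intro x hx h0
    apply hx
    simp [hφ, h0]
  have hφc : HasCompactSupport φ := hηc.isCompact.of_isClosed_subset (isClosed_tsupport _) hφs
  have gφ : ∀ x, gradient φ x = (2 * η x * P x ^ 2) • gradient η x
      + (2 * η x ^ 2 * P x) • gradient d x := by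
    intro x
    rw [hφ, grad_mul ((hη.pow 2).differentiable (by norm_num) x)
      (hP2.differentiable (by norm_num) x), gP2,
      grad_comp (h := fun t : ℝ => t ^ 2) (h' := 2 * η x)
          (by simpa using hasDerivAt_pow 2 (η x)) (hηd x)]
    simp only [smul_smul]
    rw [add_comm]
    congr 2 <;> ring
  have hD : ∀ x, gradient u (x + a) - gradient u x = h • gradient d x := by
    intro x
    rw [hd, dq_grad hu, smul_smul, mul_inv_cancel₀ hh.ne', one_smul]
  have hdiff := hsol.diff hp hl hu a hφC hφc (by rw [hna]; exact hφs.trans hηs)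
  -- bound on the right-hand side
  have hfcont : Continuous fun x => u x ^ lam := hu.continuous.rpow_const fun x => Or.inr hl
  have hφcont := hφC.continuous
  have gφc := grad_cont hφC
  have gηc := grad_cont hη
  have gdc := grad_cont hdC
  have hz : ∀ x, x ∉ tsupport η → η x = 0 ∧ gradient η x = 0 := fun x hx =>
    ⟨image_eq_zero_of_notMem_tsupport hx, grad_tsupport _ hx⟩
  have hrhs : ∫ x, (u (x + a) ^ lam - u x ^ lam) * φ x ≤ h * ∫ x, ‖gradient φ x‖ := by
    have i1 : Integrable fun x => u (x + a) ^ lam * φ x :=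
      int_cc ((hfcont.comp (continuous_add_const a)).mul hφcont) _ hφc.isCompact
        fun x hx => by simp [image_eq_zero_of_notMem_tsupport hx]
    have i2 : Integrable fun x => u x ^ lam * φ x :=
      int_cc (hfcont.mul hφcont) _ hφc.isCompact
        fun x hx => by simp [image_eq_zero_of_notMem_tsupport hx]
    have s1 : ∫ x, u (x + a) ^ lam * φ x = ∫ x, u x ^ lam * φ (x - a) := by
      rw [← integral_add_right_eq_self (fun x => u x ^ lam * φ (x - a)) a]
      simp
    have i3 : Integrable fun x => u x ^ lam * φ (x - a) := by
      have := i1.comp_sub_right a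
      simpa using this
    have i4 : Integrable fun x => |φ (x + -a) - φ x| := by
      have : Integrable φ := hφcont.integrable_of_hasCompactSupport hφc
      exact ((this.comp_add_right (-a)).sub this).abs
    simp_rw [sub_mul]
    rw [integral_sub i1 i2, s1, ← integral_sub i3 i2]
    have hs := shift_int hφC hφc (-a)
    rw [norm_neg, hna] at hs
    refine le_trans (integral_mono (i3.sub i2) i4 fun x => ?_) hs
    simp only
    rw [← mul_sub, ← sub_eq_add_neg]
    by_cases hx : x ∈ ball (0 : EE N) r
    · have h0 : 0 ≤ u x ^ lam := Real.rpow_nonneg (hu0 x) _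
      calc _ ≤ u x ^ lam * |φ (x - a) - φ x| := mul_le_mul_of_nonneg_left (le_abs_self _) h0
        _ ≤ 1 * |φ (x - a) - φ x| := mul_le_mul_of_nonneg_right (hf1 x hx) (abs_nonneg _)
        _ = _ := one_mul _
    · have z1 : φ x = 0 := by
        apply image_eq_zero_of_notMem_tsupport
        intro h'
        exact hx (ball_subset_ball (by linarith) (hηs (hφs h')))
      have z2 : φ (x - a) = 0 := by
        apply image_eq_zero_of_notMem_tsupport
        intro h'
        apply hx
        have := hηs (hφs h')
        rw [mem_ball_zero_iff] at this ⊢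
        calc ‖x‖ = ‖(x - a) + a‖ := by simp
          _ ≤ ‖x - a‖ + ‖a‖ := norm_add_le _ _
          _ < r := by linarith
      simp [z1, z2]
  have hVc : Continuous fun x => Phi p (gradient u (x + a)) - Phi p (gradient u x) := by
    have h1 := grad_cont hu
    have h2 := Phi_cont (N := N) hp
    fun_prop
  have j1 : Integrable fun x => ⟪Phi p (gradient u (x + a)) - Phi p (gradient u x), gradient φ x⟫ :=
    int_cc (hVc.inner gφc) _ hφc.isCompact fun x hx => by simp [grad_tsupport φ hx]
  have j2 : Integrable fun x => ‖gradient φ x‖ :=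
    int_cc gφc.norm _ hφc.isCompact fun x hx => by simp [grad_tsupport φ hx]
  have hηcont := hη.continuous
  have j3 : Integrable fun x => η x ^ 2 * P x * ‖gradient d x‖ ^ 2 :=
    int_cc (by fun_prop) _ hηc.isCompact fun x hx => by simp [hz x hx]
  have j4 : Integrable fun x => (2 * C1 ^ 2 / c1) * (P x ^ 3 * ‖gradient η x‖ ^ 2) +
        (2 / c1) * (η x ^ 2 * P x) + 2 * (η x * P x ^ 2 * ‖gradient η x‖) :=
    int_cc (by fun_prop) _ hηc.isCompact fun x hx => by simp [hz x hx]
  have main : h * ∫ x, (c1 * (η x ^ 2 * P x * ‖gradient d x‖ ^ 2) -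
      ((2 * C1 ^ 2 / c1) * (P x ^ 3 * ‖gradient η x‖ ^ 2) + (2 / c1) * (η x ^ 2 * P x) +
        2 * (η x * P x ^ 2 * ‖gradient η x‖))) ≤ 0 := by
    rw [← integral_const_mul]
    refine le_trans (integral_mono (((j3.const_mul c1).sub j4).const_mul h)
      (j1.sub (j2.const_mul h)) fun x => ?_) ?_
    · simp only [Pi.sub_apply]
      have hn : ‖gradient φ x‖ ≤ 2 * η x * P x ^ 2 * ‖gradient η x‖ +
          2 * η x ^ 2 * P x * ‖gradient d x‖ := by
        rw [gφ]
        refine (norm_add_le _ _).trans ?_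
        rw [norm_smul, norm_smul, Real.norm_of_nonneg, Real.norm_of_nonneg]
        · have := hP0 x; positivity
        · have := hP0 x; have := hη0 x; positivity
      have hin : ⟪Phi p (gradient u (x + a)) - Phi p (gradient u x), gradient φ x⟫ =
          (2 * η x * P x ^ 2) * ⟪Phi p (gradient u (x + a)) - Phi p (gradient u x), gradient η x⟫ +
          (2 * η x ^ 2 * P x) * ⟪Phi p (gradient u (x + a)) - Phi p (gradient u x), gradient d x⟫ := by
        rw [gφ, inner_add_right, real_inner_smul_right, real_inner_smul_right]
      rw [hin]
      by_cases hx : x ∈ tsupport η ∧ k < d x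
      · obtain ⟨a1, a2⟩ := hann x hx.1 hx.2
        rw [hD, norm_smul, Real.norm_of_nonneg hh.le] at a1 a2
        rw [real_inner_smul_right] at a1
        have b1 : c1 * h * ‖gradient d x‖ ^ 2 ≤
            ⟪Phi p (gradient u (x + a)) - Phi p (gradient u x), gradient d x⟫ := by
          have : h * (c1 * h * ‖gradient d x‖ ^ 2) ≤
            h * ⟪Phi p (gradient u (x + a)) - Phi p (gradient u x), gradient d x⟫ := by
            nlinarith
          exact le_of_mul_le_mul_left this hh
        have b2 : -(C1 * h * ‖gradient d x‖ * ‖gradient η x‖) ≤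
            ⟪Phi p (gradient u (x + a)) - Phi p (gradient u x), gradient η x⟫ := by
          have := abs_real_inner_le_norm (Phi p (gradient u (x + a)) - Phi p (gradient u x))
            (gradient η x)
          have t2 := mul_le_mul_of_nonneg_right a2 (norm_nonneg (gradient η x))
          have := neg_abs_le ⟪Phi p (gradient u (x + a)) - Phi p (gradient u x), gradient η x⟫
          nlinarith
        have := caccio_alg hc1 hh (hη0 x) (hP0 x) (norm_nonneg (gradient d x))
          (norm_nonneg (gradient η x)) b1 b2
        have t3 := mul_le_mul_of_nonneg_left hn hh.le
        linarith
      · have hz2 : η x ^ 2 * P x = 0 ∧ P x * ‖gradient η x‖ = 0 ∧ η x * P x ^ 2 = 0 := by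
          by_cases h1 : x ∈ tsupport η
          · have : P x = 0 := max_eq_right (by
              have : ¬ k < d x := fun h2 => hx ⟨h1, h2⟩
              linarith)
            simp [this]
          · simp [hz x h1]
        have hn0 : ‖gradient φ x‖ = 0 := by
          rw [gφ, show 2 * η x * P x ^ 2 = 2 * (η x * P x ^ 2) by ring,
            show 2 * η x ^ 2 * P x = 2 * (η x ^ 2 * P x) by ring, hz2.1, hz2.2.2]; simp
        rw [hn0, show 2 * η x * P x ^ 2 = 2 * (η x * P x ^ 2) by ring,
            show 2 * η x ^ 2 * P x = 2 * (η x ^ 2 * P x) by ring, hz2.1, hz2.2.2,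
            show P x ^ 3 * ‖gradient η x‖ ^ 2 = (P x * ‖gradient η x‖) * P x ^ 2 * ‖gradient η x‖ by ring,
            hz2.2.1]
        simp
    · have : ∫ x, (fun x => ⟪Phi p (gradient u (x + a)) - Phi p (gradient u x), gradient φ x⟫ -
          h * ‖gradient φ x‖) x = (∫ x, ⟪Phi p (gradient u (x + a)) - Phi p (gradient u x), gradient φ x⟫)
          - h * ∫ x, ‖gradient φ x‖ := by
        simp only
        rw [integral_sub j1 (j2.const_mul h), integral_const_mul]
      exact this.trans_le (by linarith [hdiff, hrhs])
  have main2 := nonpos_of_mul_nonpos_right main hh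
  rw [integral_sub (j3.const_mul c1) j4, integral_const_mul] at main2
  linarith

end caccio


section degiorgi
variable {N : ℕ}

lemma st_deriv_bound : ∃ A : ℝ, 0 < A ∧ ∀ t, |deriv Real.smoothTransition t| ≤ A := by
  have hc : Continuous (deriv Real.smoothTransition) :=
    (Real.smoothTransition.contDiff (n := 1)).continuous_deriv (by norm_num)
  obtain ⟨A, hA⟩ := (isCompact_Icc (a := (0:ℝ)) (b := 1)).exists_bound_of_continuousOn hc.continuousOn
  refine ⟨max A 1, by positivity, fun t => ?_⟩
  by_cases ht : t ∈ Set.Icc (0:ℝ) 1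
  · exact (hA t ht).trans (le_max_left _ _)
  · have : deriv Real.smoothTransition t = 0 := by
      rw [Set.mem_Icc, not_and_or, not_le, not_le] at ht
      rcases ht with h | h
      · have : Real.smoothTransition =ᶠ[nhds t] fun _ => 0 := by
          filter_upwards [eventually_lt_nhds h] with s hs
          exact Real.smoothTransition.zero_of_nonpos hs.le
        rw [this.deriv_eq]; simp
      · have : Real.smoothTransition =ᶠ[nhds t] fun _ => 1 := by
          filter_upwards [eventually_gt_nhds h] with s hs
          exact Real.smoothTransition.one_of_one_le hs.le
        rw [this.deriv_eq]; simp
    rw [this]; simp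

/-- radial cutoff -/
noncomputable def rcut (s ρ : ℝ) (x : EE N) : ℝ := Real.smoothTransition (s * (ρ - ‖x‖ ^ 2))

lemma rcut_contDiff {s ρ : ℝ} {n : ℕ∞} : ContDiff ℝ n (rcut s ρ : EE N → ℝ) := by
  unfold rcut
  exact Real.smoothTransition.contDiff.comp
    (contDiff_const.mul (contDiff_const.sub (contDiff_norm_sq ℝ)))

lemma rcut_nonneg {s ρ : ℝ} (x : EE N) : 0 ≤ rcut s ρ x := Real.smoothTransition.nonneg _
lemma rcut_le_one {s ρ : ℝ} (x : EE N) : rcut s ρ x ≤ 1 := Real.smoothTransition.le_one _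

lemma rcut_one {s ρ : ℝ} {x : EE N} (h : 1 ≤ s * (ρ - ‖x‖ ^ 2)) : rcut s ρ x = 1 :=
  Real.smoothTransition.one_of_one_le h

lemma rcut_tsupport {s ρ : ℝ} (hs : 0 < s) :
    tsupport (rcut s ρ : EE N → ℝ) ⊆ {x | ‖x‖ ^ 2 ≤ ρ} := by
  apply closure_minimal
  · intro x hx
    by_contra h
    apply hx
    apply Real.smoothTransition.zero_of_nonpos
    simp only [Set.mem_setOf_eq, not_le] at h
    nlinarith
  · exact isClosed_le (by fun_prop) (by fun_prop)

lemma rcut_tsupport_ball {s ρ r : ℝ} (hs : 0 < s) (hr : 0 < r) (h : ρ < r ^ 2) :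
    tsupport (rcut s ρ : EE N → ℝ) ⊆ ball 0 r := by
  intro x hx
  have := rcut_tsupport hs hx
  rw [mem_ball_zero_iff]
  simp only [Set.mem_setOf_eq] at this
  exact lt_of_pow_lt_pow_left₀ 2 hr.le (by linarith)

lemma rcut_hcs {s ρ : ℝ} (hs : 0 < s) : HasCompactSupport (rcut s ρ : EE N → ℝ) := by
  apply (isCompact_closedBall (0 : EE N) (|ρ| + 1)).of_isClosed_subset (isClosed_tsupport _)
  refine (rcut_tsupport_ball hs (by positivity) ?_).trans ball_subset_closedBall
  have := le_abs_self ρ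
  have := abs_nonneg ρ
  nlinarith

lemma rcut_grad {A : ℝ} (hA : ∀ t, |deriv Real.smoothTransition t| ≤ A) {s ρ : ℝ} (hs : 0 < s)
    (x : EE N) : ‖gradient (rcut s ρ) x‖ ≤ A * (2 * s * ‖x‖) := by
  have hst : DifferentiableAt ℝ Real.smoothTransition (s * (ρ - ‖x‖ ^ 2)) :=
    (Real.smoothTransition.contDiff (n := 1)).differentiable (by norm_num) _
  have h1 : HasFDerivAt (fun x : EE N => s * (ρ - ‖x‖ ^ 2)) (s • (-((2:ℕ) • (innerSL ℝ x : EE N →L[ℝ] ℝ)))) x :=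
    ((hasStrictFDerivAt_norm_sq x).hasFDerivAt.const_sub ρ).const_mul s
  rw [norm_grad]
  have h2 : fderiv ℝ (rcut s ρ) x = _ := (hst.hasDerivAt.comp_hasFDerivAt x h1).fderiv
  rw [h2, norm_smul]
  apply mul_le_mul (hA _) _ (norm_nonneg _) ((abs_nonneg _).trans (hA 0))
  rw [norm_smul, norm_neg, Real.norm_of_nonneg hs.le, two_nsmul]
  have h3 := norm_add_le (innerSL ℝ x) (innerSL ℝ x)
  rw [innerSL_apply_norm] at h3
  nlinarith

set_option maxHeartbeats 1000000 in
lemma dg_step (hN : 1 ≤ N) {c1 A1 A2 : ℝ} (hc1 : 0 < c1) (hA1 : 0 ≤ A1) (hA2 : 0 ≤ A2) :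
    ∃ C : ℝ, 0 < C ∧ ∀ d : EE N → ℝ, ContDiff ℝ 1 d → ∀ k δ G : ℝ, 0 < δ → δ ≤ 1 → 1 ≤ G →
    ∀ η θ : EE N → ℝ, ContDiff ℝ 1 η → HasCompactSupport η → (∀ x, 0 ≤ η x ∧ η x ≤ 1) →
    (∀ x, ‖gradient η x‖ ≤ G) → ContDiff ℝ 1 θ → HasCompactSupport θ →
    (∀ x ∈ tsupport η, θ x = 1) →
    (c1 * ∫ x, η x ^ 2 * max (d x - (k + δ)) 0 * ‖gradient d x‖ ^ 2 ≤
      ∫ x, (A1 * (max (d x - (k + δ)) 0 ^ 3 * ‖gradient η x‖ ^ 2) +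
        A2 * (η x ^ 2 * max (d x - (k + δ)) 0) +
        2 * (η x * max (d x - (k + δ)) 0 ^ 2 * ‖gradient η x‖))) →
    ∫ x, η x ^ 2 * max (d x - (k + δ)) 0 ^ 3 ≤
      C * ((∫ x, θ x ^ 2 * max (d x - k) 0 ^ 3) / δ ^ 3) ^ ((2:ℝ) / N) * (G ^ 2 / δ ^ 2) *
        ∫ x, θ x ^ 2 * max (d x - k) 0 ^ 3 := by
  obtain ⟨C, hC, FK⟩ := faber_krahn hN
  set D : ℝ := 9 / 2 * c1⁻¹ * (A1 + A2 + 2) + 2 with hD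
  have hD0 : 0 < D := by positivity
  refine ⟨C * D, by positivity, ?_⟩
  intro d hd k δ G hδ hδ1 hG η θ hη hηc hη01 hηG hθ hθc hθ1 hcac
  set y := ∫ x, θ x ^ 2 * max (d x - k) 0 ^ 3 with hy
  have hdc := hd.continuous
  have hηct := hη.continuous
  have hθct := hθ.continuous
  have gηct := grad_cont hη
  have gdct := grad_cont hd
  have hz : ∀ x, x ∉ tsupport η → η x = 0 ∧ gradient η x = 0 := fun x hx =>
    ⟨image_eq_zero_of_notMem_tsupport hx, grad_tsupport _ hx⟩
  have iy : Integrable fun x => θ x ^ 2 * max (d x - k) 0 ^ 3 :=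
    int_cc (by fun_prop) _ hθc.isCompact fun x hx => by
      simp [image_eq_zero_of_notMem_tsupport hx]
  have iy' : Integrable fun x => η x ^ 2 * max (d x - (k + δ)) 0 ^ 3 :=
    int_cc (by fun_prop) _ hηc.isCompact fun x hx => by simp [hz x hx]
  have hy0 : 0 ≤ y := integral_nonneg fun x => by positivity
  set P : EE N → ℝ := fun x => max (d x - k) 0 with hP
  set Q : EE N → ℝ := fun x => max (d x - (k + δ)) 0 with hQ
  have hPc : Continuous P := by fun_prop
  have hQc : Continuous Q := by fun_prop
  have hP0 : ∀ x, 0 ≤ P x := fun x => le_max_right _ _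
  have hQ0 : ∀ x, 0 ≤ Q x := fun x => le_max_right _ _
  have hQP : ∀ x, Q x ≤ P x := fun x => max_le_max_right _ (by linarith)
  -- dichotomy
  have hQP2 : ∀ x, Q x = 0 ∨ δ ≤ P x := by
    intro x
    by_cases h : d x - (k + δ) ≤ 0
    · left; exact max_eq_right h
    · right; exact le_trans (by linarith) (le_max_left _ _)
  -- key pointwise: x ∈ tsupport η
  have pw3 : ∀ x ∈ tsupport η, Q x ^ 3 ≤ θ x ^ 2 * P x ^ 3 := by
    intro x hx; rw [hθ1 x hx, one_pow, one_mul]; gcongr; exact hQP x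
  have pw2 : ∀ x ∈ tsupport η, Q x ^ 2 * δ ≤ θ x ^ 2 * P x ^ 3 := by
    intro x hx; rw [hθ1 x hx, one_pow, one_mul]
    rcases hQP2 x with h | h
    · rw [h]; have := hP0 x; simp; positivity
    · calc Q x ^ 2 * δ ≤ P x ^ 2 * P x := by gcongr; exact hQP x
        _ = _ := by ring
  have pw1 : ∀ x ∈ tsupport η, Q x * δ ^ 2 ≤ θ x ^ 2 * P x ^ 3 := by
    intro x hx; rw [hθ1 x hx, one_pow, one_mul]
    rcases hQP2 x with h | h
    · rw [h]; have := hP0 x; simp; positivity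
    · calc Q x * δ ^ 2 ≤ P x * P x ^ 2 := by gcongr; exact hQP x
        _ = _ := by ring
  by_cases hy00 : y = 0
  · refine le_trans (integral_mono iy' iy ?_) (by rw [← hy, hy00]; simp)
    intro x
    by_cases hx : x ∈ tsupport η
    · have h1 : η x ^ 2 ≤ 1 := pow_le_one₀ (hη01 x).1 (hη01 x).2
      have := pw3 x hx
      have h3 : 0 ≤ Q x ^ 3 := by have := hQ0 x; positivity
      show η x ^ 2 * Q x ^ 3 ≤ _
      nlinarith
    · have h1 : 0 ≤ P x ^ 3 := by have := hP0 x; positivity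
      show η x ^ 2 * Q x ^ 3 ≤ θ x ^ 2 * P x ^ 3
      rw [(hz x hx).1]
      have : 0 ≤ θ x ^ 2 * P x ^ 3 := by positivity
      linarith
  have hypos : 0 < y := lt_of_le_of_ne hy0 (Ne.symm hy00)
  set g : EE N → ℝ := fun x => η x * Q x ^ ((3:ℝ)/2) with hg
  have hQC : ContDiff ℝ 1 fun x => Q x ^ ((3:ℝ)/2) :=
    (posrpow_contDiff (r := 3/2) (by norm_num)).comp (hd.sub (contDiff_const (c := k + δ)))
  have hgC : ContDiff ℝ 1 g := hη.mul hQC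
  have hgs : ∀ x, x ∉ tsupport η → g x = 0 := fun x hx => by simp [hg, hz x hx]
  have hgc : HasCompactSupport g := HasCompactSupport.intro hηc hgs
  have hdd := hd.differentiable (by norm_num)
  have gg : ∀ x, gradient g x = (η x * ((3/2) * Q x ^ ((1:ℝ)/2))) • gradient d x
      + Q x ^ ((3:ℝ)/2) • gradient η x := by
    intro x
    have h1 : HasDerivAt (fun t : ℝ => max (t - (k + δ)) 0 ^ ((3:ℝ)/2)) ((3/2) * Q x ^ ((1:ℝ)/2)) (d x) := by
      have := (posrpow_hasDerivAt (r := 3/2) (by norm_num) (d x - (k+δ))).comp (d x)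
        ((hasDerivAt_id (d x)).sub_const (k+δ))
      rw [mul_one, show (3:ℝ)/2 - 1 = 1/2 by norm_num] at this
      exact this
    have h2 := grad_comp (h := fun t : ℝ => max (t - (k + δ)) 0 ^ ((3:ℝ)/2)) h1 (hdd x)
    have h3 : gradient (fun x => Q x ^ ((3:ℝ)/2)) x = ((3/2) * Q x ^ ((1:ℝ)/2)) • gradient d x := h2
    rw [hg, grad_mul (hη.differentiable (by norm_num) x) (hQC.differentiable (by norm_num) x), h3,
      smul_smul]
  have sq1 : ∀ x, (Q x ^ ((1:ℝ)/2)) ^ 2 = Q x := fun x => by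
    rw [← Real.rpow_natCast, ← Real.rpow_mul (hQ0 x)]; norm_num
  have sq3 : ∀ x, (Q x ^ ((3:ℝ)/2)) ^ 2 = Q x ^ 3 := fun x => by
    rw [← Real.rpow_natCast, ← Real.rpow_mul (hQ0 x), ← Real.rpow_natCast]; norm_num
  have gb : ∀ x, ‖gradient g x‖ ^ 2 ≤ 9 / 2 * (η x ^ 2 * Q x * ‖gradient d x‖ ^ 2) +
      2 * (Q x ^ 3 * ‖gradient η x‖ ^ 2) := by
    intro x
    have h0 := hQ0 x
    have h1 : ‖gradient g x‖ ≤ (η x * ((3/2) * Q x ^ ((1:ℝ)/2))) * ‖gradient d x‖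
      + Q x ^ ((3:ℝ)/2) * ‖gradient η x‖ := by
      rw [gg]
      refine (norm_add_le _ _).trans ?_
      rw [norm_smul, norm_smul, Real.norm_of_nonneg, Real.norm_of_nonneg]
      · positivity
      · have := (hη01 x).1; positivity
    have h2 := pow_le_pow_left₀ (norm_nonneg _) h1 2
    refine h2.trans ?_
    have e1 : ((η x * ((3/2) * Q x ^ ((1:ℝ)/2))) * ‖gradient d x‖) ^ 2 =
      9 / 4 * (η x ^ 2 * Q x * ‖gradient d x‖ ^ 2) := by
      calc _ = 9 / 4 * (η x ^ 2 * (Q x ^ ((1:ℝ)/2)) ^ 2 * ‖gradient d x‖ ^ 2) := by ring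
        _ = _ := by rw [sq1 x]
    have e2 : (Q x ^ ((3:ℝ)/2) * ‖gradient η x‖) ^ 2 = Q x ^ 3 * ‖gradient η x‖ ^ 2 := by
      rw [← sq3 x]; ring
    have := sq_nonneg ((η x * ((3/2) * Q x ^ ((1:ℝ)/2))) * ‖gradient d x‖ -
      Q x ^ ((3:ℝ)/2) * ‖gradient η x‖)
    nlinarith
  have hvol : volume.real (Function.support g) ≤ y / δ ^ 3 := by
    rw [le_div_iff₀ (by positivity)]
    have hm : MeasurableSet (Function.support g) := hgC.continuous.isOpen_support.measurableSet
    have hfin : volume (Function.support g) ≠ ⊤ :=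
      (lt_of_le_of_lt (measure_mono (subset_tsupport g)) hgc.isCompact.measure_lt_top).ne
    have : volume.real (Function.support g) * δ ^ 3 = ∫ x, (Function.support g).indicator (fun _ => δ ^ 3) x := by
      rw [integral_indicator hm, setIntegral_const, smul_eq_mul]
    rw [this]
    apply integral_mono ((integrable_indicator_iff hm).2 (integrableOn_const hfin)) iy
    intro x
    by_cases hx : x ∈ Function.support g
    · rw [Set.indicator_of_mem hx]
      have hxη : x ∈ tsupport η := by
        by_contra h; exact hx (hgs x h)
      show _ ≤ θ x ^ 2 * P x ^ 3
      rw [hθ1 x hxη, one_pow, one_mul]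
      rcases hQP2 x with h | h
      · exfalso; apply hx; simp [hg, h]
      · gcongr
    · rw [Set.indicator_of_notMem hx]
      have h1 : 0 ≤ P x ^ 3 := by have := hP0 x; positivity
      positivity
  have hfk := FK g hgC hgc (y / δ ^ 3) (by positivity) hvol
  have e0 : ∫ x, g x ^ 2 = ∫ x, η x ^ 2 * Q x ^ 3 := by
    congr 1; ext x; rw [hg]; simp only; rw [mul_pow, sq3]
  have i1 : Integrable fun x => η x ^ 2 * Q x * ‖gradient d x‖ ^ 2 :=
    int_cc (by fun_prop) _ hηc.isCompact fun x hx => by simp [hz x hx]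
  have i2 : Integrable fun x => Q x ^ 3 * ‖gradient η x‖ ^ 2 :=
    int_cc (by fun_prop) _ hηc.isCompact fun x hx => by simp [hz x hx]
  have i3 : Integrable fun x => A1 * (Q x ^ 3 * ‖gradient η x‖ ^ 2) + A2 * (η x ^ 2 * Q x) +
        2 * (η x * Q x ^ 2 * ‖gradient η x‖) :=
    int_cc (by fun_prop) _ hηc.isCompact fun x hx => by simp [hz x hx]
  have ggc := grad_cont hgC
  have i0 : Integrable fun x => ‖gradient g x‖ ^ 2 :=
    int_cc (by fun_prop) _ hgc.isCompact fun x hx => by simp [grad_tsupport g hx]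
  have hGd : 1 ≤ G ^ 2 := one_le_pow₀ hG
  have hδ2 : δ ^ 2 ≤ 1 := pow_le_one₀ hδ.le hδ1
  set Z := G ^ 2 / δ ^ 2 with hZ
  -- pointwise bounds by Z θ²P³
  have b3 : ∀ x, Q x ^ 3 * ‖gradient η x‖ ^ 2 ≤ Z * (θ x ^ 2 * P x ^ 3) := by
    intro x
    have h1 : 0 ≤ P x ^ 3 := by have := hP0 x; positivity
    by_cases hx : x ∈ tsupport η
    · rw [hZ, div_mul_eq_mul_div, le_div_iff₀ (by positivity)]
      have h3 : 0 ≤ Q x ^ 3 := by have := hQ0 x; positivity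
      calc Q x ^ 3 * ‖gradient η x‖ ^ 2 * δ ^ 2 ≤ Q x ^ 3 * G ^ 2 * 1 := by
            gcongr; exact hηG x
        _ ≤ _ := by have := pw3 x hx; nlinarith
    · simp [hz x hx]; positivity
  have b2 : ∀ x, η x * Q x ^ 2 * ‖gradient η x‖ ≤ Z * (θ x ^ 2 * P x ^ 3) := by
    intro x
    have h1 : 0 ≤ P x ^ 3 := by have := hP0 x; positivity
    by_cases hx : x ∈ tsupport η
    · rw [hZ, div_mul_eq_mul_div, le_div_iff₀ (by positivity)]
      have h3 := hQ0 x
      calc η x * Q x ^ 2 * ‖gradient η x‖ * δ ^ 2 ≤ 1 * Q x ^ 2 * G ^ 2 * (δ * 1) := by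
            have : ‖gradient η x‖ ≤ G ^ 2 := (hηG x).trans (by nlinarith)
            rw [sq δ]
            gcongr
            exact (hη01 x).2
        _ ≤ _ := by have := pw2 x hx; nlinarith
    · simp [hz x hx]; positivity
  have b1 : ∀ x, η x ^ 2 * Q x ≤ Z * (θ x ^ 2 * P x ^ 3) := by
    intro x
    have h1 : 0 ≤ P x ^ 3 := by have := hP0 x; positivity
    by_cases hx : x ∈ tsupport η
    · rw [hZ, div_mul_eq_mul_div, le_div_iff₀ (by positivity)]
      have h3 := hQ0 x
      have h4 : η x ^ 2 ≤ 1 := pow_le_one₀ (hη01 x).1 (hη01 x).2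
      calc η x ^ 2 * Q x * δ ^ 2 ≤ 1 * Q x * δ ^ 2 := by gcongr
        _ ≤ _ := by
          have := pw1 x hx
          have h5 : 0 ≤ θ x ^ 2 * P x ^ 3 := by positivity
          nlinarith
    · simp [hz x hx]; positivity
  have I3 : ∫ x, (A1 * (Q x ^ 3 * ‖gradient η x‖ ^ 2) + A2 * (η x ^ 2 * Q x) +
        2 * (η x * Q x ^ 2 * ‖gradient η x‖)) ≤ (A1 + A2 + 2) * (Z * y) := by
    have : (A1 + A2 + 2) * (Z * y) = ∫ x, (A1 + A2 + 2) * (Z * (θ x ^ 2 * P x ^ 3)) := by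
      rw [integral_const_mul, integral_const_mul]
    rw [this]
    apply integral_mono i3 ((iy.const_mul _).const_mul _)
    intro x
    have t3 := mul_le_mul_of_nonneg_left (b3 x) hA1
    have t1 := mul_le_mul_of_nonneg_left (b1 x) hA2
    have t2 := b2 x
    simp only
    linarith
  have I2 : ∫ x, Q x ^ 3 * ‖gradient η x‖ ^ 2 ≤ Z * y := by
    rw [hy, ← integral_const_mul]
    exact integral_mono i2 (iy.const_mul _) b3
  have I0 : ∫ x, ‖gradient g x‖ ^ 2 ≤ D * (Z * y) := by
    have h1 := integral_mono i0 ((i1.const_mul (9/2)).add (i2.const_mul 2)) gb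
    have h2 : ∫ x, ((fun x => 9 / 2 * (η x ^ 2 * Q x * ‖gradient d x‖ ^ 2)) +
      (fun x => 2 * (Q x ^ 3 * ‖gradient η x‖ ^ 2)) : EE N → ℝ) x = 9 / 2 * (∫ x, η x ^ 2 * Q x * ‖gradient d x‖ ^ 2)
       + 2 * ∫ x, Q x ^ 3 * ‖gradient η x‖ ^ 2 := by
      rw [integral_add' (i1.const_mul (9/2)) (i2.const_mul 2), integral_const_mul, integral_const_mul]
    rw [h2] at h1
    have h3 : ∫ x, η x ^ 2 * Q x * ‖gradient d x‖ ^ 2 ≤ c1⁻¹ * ((A1 + A2 + 2) * (Z * y)) := by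
      rw [← div_eq_inv_mul, le_div_iff₀' hc1]
      exact hcac.trans I3
    rw [hD]
    nlinarith
  rw [e0] at hfk
  calc ∫ x, η x ^ 2 * Q x ^ 3 ≤ C * (y / δ ^ 3) ^ ((2:ℝ) / N) * ∫ x, ‖gradient g x‖ ^ 2 := hfk
    _ ≤ C * (y / δ ^ 3) ^ ((2:ℝ) / N) * (D * (Z * y)) := by gcongr
    _ = _ := by ring

end degiorgi


section degiorgi2
variable {N : ℕ}

lemma iter_num {C0 B s : ℝ} (hC0 : 0 < C0) (hB : 0 < B) (hs : 0 < s) :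
    ∃ Y0 τ : ℝ, 0 < Y0 ∧ 0 < τ ∧ τ < 1 ∧ ∀ y : ℕ → ℝ, (∀ j, 0 ≤ y j) → y 0 ≤ Y0 →
      (∀ j, y (j+1) ≤ C0 * B ^ j * (y j) ^ s * y j) → ∀ j, y j ≤ Y0 * τ ^ j := by
  -- τ with B τ^s ≤ 1
  obtain ⟨τ, hτ0, hτ1, hτB⟩ : ∃ τ : ℝ, 0 < τ ∧ τ < 1 ∧ B * τ ^ s ≤ 1 := by
    refine ⟨min (1/2) ((B⁻¹) ^ (s⁻¹)), by positivity, by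
      exact lt_of_le_of_lt (min_le_left _ _) (by norm_num), ?_⟩
    calc B * (min (1/2) ((B⁻¹) ^ (s⁻¹))) ^ s ≤ B * ((B⁻¹) ^ (s⁻¹)) ^ s := by
          gcongr; exact min_le_right _ _
      _ = 1 := by
          rw [← Real.rpow_mul (by positivity), inv_mul_cancel₀ hs.ne', Real.rpow_one,
            mul_inv_cancel₀ hB.ne']
  obtain ⟨Y0, hY0, hY⟩ : ∃ Y0 : ℝ, 0 < Y0 ∧ C0 * Y0 ^ s ≤ τ := by
    refine ⟨(τ / C0) ^ (s⁻¹), by positivity, ?_⟩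
    rw [← Real.rpow_mul (by positivity), inv_mul_cancel₀ hs.ne', Real.rpow_one,
      mul_div_cancel₀ _ hC0.ne']
  refine ⟨Y0, τ, hY0, hτ0, hτ1, fun y hy hy0 hst j => ?_⟩
  induction j with
  | zero => simpa using hy0
  | succ j ih =>
    have h1 : (y j) ^ s ≤ Y0 ^ s * (τ ^ s) ^ j := by
      calc (y j) ^ s ≤ (Y0 * τ ^ j) ^ s := Real.rpow_le_rpow (hy j) ih hs.le
        _ = Y0 ^ s * (τ ^ s) ^ j := by
          rw [Real.mul_rpow hY0.le (by positivity), ← Real.rpow_natCast, ← Real.rpow_mul hτ0.le,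
            mul_comm (j:ℝ) s, Real.rpow_mul hτ0.le, Real.rpow_natCast]
    calc y (j+1) ≤ C0 * B ^ j * (y j) ^ s * y j := hst j
      _ ≤ C0 * B ^ j * (Y0 ^ s * (τ ^ s) ^ j) * (Y0 * τ ^ j) := by
          have := hy j
          gcongr
      _ = (C0 * Y0 ^ s) * (B * τ ^ s) ^ j * (Y0 * τ ^ j) := by rw [mul_pow]; ring
      _ ≤ τ * 1 * (Y0 * τ ^ j) := by
          gcongr
          exact pow_le_one₀ (by positivity) hτB
      _ = _ := by ring

lemma dg_iter (hN : 1 ≤ N) {c1 A1 A2 c : ℝ} (hc1 : 0 < c1) (hA1 : 0 ≤ A1) (hA2 : 0 ≤ A2)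
    (hc : 0 < c) (hc4 : c ≤ 4) :
    ∃ Y0 : ℝ, 0 < Y0 ∧ ∀ d : EE N → ℝ, ContDiff ℝ 1 d →
    (∀ k, c / 4 ≤ k → ∀ η : EE N → ℝ, ContDiff ℝ 1 η → HasCompactSupport η →
      tsupport η ⊆ ball 0 2 → (∀ x, 0 ≤ η x) →
      c1 * ∫ x, η x ^ 2 * max (d x - k) 0 * ‖gradient d x‖ ^ 2 ≤
      ∫ x, (A1 * (max (d x - k) 0 ^ 3 * ‖gradient η x‖ ^ 2) +
        A2 * (η x ^ 2 * max (d x - k) 0) +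
        2 * (η x * max (d x - k) 0 ^ 2 * ‖gradient η x‖))) →
    ∫ x, (rcut 2 2 x) ^ 2 * max (d x - c / 4) 0 ^ 3 ≤ Y0 → d 0 ≤ c / 2 := by
  obtain ⟨C, hC, step⟩ := dg_step hN hc1 hA1 hA2
  obtain ⟨A', hA'0, hA'⟩ := st_deriv_bound
  set A := max A' 1 with hA
  have hA1' : 1 ≤ A := le_max_right _ _
  have hst : ∀ t, |deriv Real.smoothTransition t| ≤ A := fun t => (hA' t).trans (le_max_left _ _)
  have hs : (0:ℝ) < 2 / N := by positivity
  -- constants : δ_j = (c/8) 2^{-j},   G_j = 16 A 2^j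
  set s : ℝ := 2 / N with hsdef
  obtain ⟨Y0, τ, hY0, hτ0, hτ1, hit⟩ := iter_num
    (C0 := C * (((c / 8) ^ 3)⁻¹) ^ s * ((16 * A) ^ 2 / (c / 8) ^ 2) * 4) (B := (8 : ℝ) ^ s * 16) (s := s)
    (by positivity) (by positivity) hs
  refine ⟨Y0, hY0, fun d hd hcac hy0 => ?_⟩
  set ρ : ℕ → ℝ := fun j => 1 + (1 / 2) ^ j with hρ
  set η : ℕ → EE N → ℝ := fun j => rcut (2 ^ (j+1)) (ρ j) with hη
  set k : ℕ → ℝ := fun j => c / 4 + c / 4 * (1 - (1 / 2) ^ j) with hk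
  set y : ℕ → ℝ := fun j => ∫ x, η j x ^ 2 * max (d x - k j) 0 ^ 3 with hy
  have hhalf : ∀ j, ((1:ℝ)/2) ^ j ≤ 1 := fun j => pow_le_one₀ (by norm_num) (by norm_num)
  have hhalf0 : ∀ j, 0 < ((1:ℝ)/2) ^ j := fun j => by positivity
  have hprod : ∀ j, (2:ℝ) ^ j * (1 / 2) ^ j = 1 := fun j => by rw [← mul_pow]; norm_num
  have hη1 : ∀ j x, ‖x‖ ^ 2 ≤ ρ (j+1) → η j x = 1 := by
    intro j x hx
    apply rcut_one
    have : ρ j - ρ (j+1) = (1/2)^(j+1) := by simp only [hρ, pow_succ]; ring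
    calc (1:ℝ) = 2 ^ (j+1) * (1/2)^(j+1) := (hprod _).symm
      _ = 2 ^ (j+1) * (ρ j - ρ (j+1)) := by rw [this]
      _ ≤ _ := by gcongr
  have hη2 : ∀ j x, x ∈ tsupport (η j) → ‖x‖ ^ 2 ≤ ρ j := fun j x hx =>
    rcut_tsupport (by positivity) hx
  have hηC : ∀ j, ContDiff ℝ 1 (η j) := fun j => rcut_contDiff (n := 1)
  have hηc : ∀ j, HasCompactSupport (η j) := fun j => rcut_hcs (by positivity)
  have hηG : ∀ j x, ‖gradient (η j) x‖ ≤ 16 * A * 2 ^ j := by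
    intro j x
    by_cases hx : x ∈ tsupport (η j)
    · refine (rcut_grad hst (by positivity) x).trans ?_
      have h1 : ‖x‖ ≤ 2 := by
        have := hη2 j x hx
        have h2 : ρ j ≤ 2 := by simp only [hρ]; linarith [hhalf j]
        nlinarith [norm_nonneg x]
      calc A * (2 * 2 ^ (j+1) * ‖x‖) ≤ A * (2 * 2 ^ (j+1) * 2) := by gcongr
        _ ≤ _ := by rw [pow_succ]; have : 0 < A * 2 ^ j := by positivity
                    nlinarith
    · rw [grad_tsupport _ hx]; simp; positivity
  have hy0' : y 0 ≤ Y0 := by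
    have : y 0 = ∫ x, (rcut 2 2 x) ^ 2 * max (d x - c / 4) 0 ^ 3 := by
      simp only [hy, hη, hk, hρ]; norm_num
    rw [this]; exact hy0
  have hynn : ∀ j, 0 ≤ y j := fun j => integral_nonneg fun x => by positivity
  have hball : ∀ j, tsupport (η j) ⊆ ball 0 2 := fun j =>
    rcut_tsupport_ball (by positivity) (by norm_num) (by simp only [hρ]; linarith [hhalf j])
  have key := hit y hynn hy0' (by
    intro j
    have hkk : k (j+1) = k j + c / 8 * (1/2)^j := by simp only [hk, pow_succ]; ring
    have := step d hd (k j) (c / 8 * (1/2)^j) (16 * A * 2 ^ (j+1)) (by positivity)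
      (by have := hhalf j; have := hhalf0 j; nlinarith)
      (by have : (1:ℝ) ≤ 2 ^ (j+1) := one_le_pow₀ (by norm_num)
          nlinarith) (η (j+1)) (η j) (hηC _) (hηc _)
      (fun x => ⟨rcut_nonneg _, rcut_le_one _⟩) (hηG _) (hηC _) (hηc _)
      (fun x hx => hη1 j x (hη2 (j+1) x hx))
      (by
        rw [← hkk]
        refine hcac _ ?_ _ (hηC _) (hηc _) (hball _) fun x => rcut_nonneg _
        simp only [hk]
        have := hhalf (j+1)
        have : 0 ≤ c / 4 * (1 - (1/2)^(j+1)) := by apply mul_nonneg <;> linarith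
        linarith)
    rw [← hkk] at this
    refine this.trans (le_of_eq ?_)
    show C * (y j / (c / 8 * (1/2)^j) ^ 3) ^ s * ((16 * A * 2 ^ (j+1)) ^ 2 / (c / 8 * (1/2)^j) ^ 2) * y j = _
    have e1 : y j / (c / 8 * (1/2)^j) ^ 3 = ((c / 8) ^ 3)⁻¹ * 8 ^ j * y j := by
      have : ((1:ℝ)/2)^j = (2 ^ j)⁻¹ := by rw [one_div, inv_pow]
      rw [this, show (8:ℝ) = 2 ^ 3 by norm_num, ← pow_mul, mul_comm 3 j, pow_mul]
      field_simp
    have e2 : (16 * A * 2 ^ (j+1)) ^ 2 / (c / 8 * (1/2)^j) ^ 2 =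
        ((16 * A) ^ 2 / (c / 8) ^ 2) * (4 * 16 ^ j) := by
      have : ((1:ℝ)/2)^j = (2 ^ j)⁻¹ := by rw [one_div, inv_pow]
      rw [this, show (16:ℝ) ^ j = (2 ^ j) ^ 4 by rw [← pow_mul, mul_comm j 4, pow_mul]; norm_num, pow_succ]
      field_simp
      try ring
    rw [e1, e2, Real.mul_rpow (by positivity) (hynn j), Real.mul_rpow (by positivity) (by positivity),
      mul_pow]
    have e3 : ((8:ℝ) ^ j) ^ s = (8 ^ s) ^ j := by
      rw [← Real.rpow_natCast, ← Real.rpow_mul (by norm_num), mul_comm (j:ℝ) s,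
        Real.rpow_mul (by norm_num), Real.rpow_natCast]
    rw [e3]
    ring)
  by_contra! hd0
  have hdc := hd.continuous
  have hrc : Continuous (rcut 1 1 : EE N → ℝ) := (rcut_contDiff (n := 1)).continuous
  set G : EE N → ℝ := fun x => rcut 1 1 x ^ 2 * max (d x - c / 2) 0 ^ 3 with hG
  have hGc : Continuous G := by fun_prop
  have hGs : HasCompactSupport G := HasCompactSupport.intro (rcut_hcs (s := 1) (ρ := 1) one_pos)
    fun x hx => by simp [hG, image_eq_zero_of_notMem_tsupport hx]
  have hGpos : 0 < ∫ x, G x := by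
    apply hGc.integral_pos_of_hasCompactSupport_nonneg_nonzero hGs (x := 0)
    · intro x; simp only [hG, Pi.zero_apply]; positivity
    · have h1 : rcut 1 1 (0 : EE N) = 1 := rcut_one (by simp)
      have h2 : 0 < max (d 0 - c / 2) 0 := lt_max_of_lt_left (by linarith)
      simp only [hG, h1]; positivity
  have hle : ∀ j, ∫ x, G x ≤ Y0 * τ ^ j := by
    intro j
    refine le_trans ?_ (key j)
    have hηct := (hηC j).continuous
    refine integral_mono (hGc.integrable_of_hasCompactSupport hGs)
      (int_cc (by fun_prop) _ (hηc j).isCompact fun x hx => by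
        simp [image_eq_zero_of_notMem_tsupport hx]) fun x => ?_
    simp only [hG]
    have h3 : 0 ≤ max (d x - c / 2) 0 := le_max_right _ _
    have h4 : max (d x - c / 2) 0 ≤ max (d x - k j) 0 := by
      apply max_le_max_right
      have := hhalf0 j
      simp only [hk]
      nlinarith
    by_cases hx : x ∈ tsupport (rcut 1 1 : EE N → ℝ)
    · have h5 : η j x = 1 := hη1 j x (by
        have := rcut_tsupport one_pos hx
        simp only [Set.mem_setOf_eq] at this
        simp only [hρ]
        linarith [hhalf0 (j+1)])
      have h6 : rcut 1 1 x ^ 2 ≤ 1 := pow_le_one₀ (rcut_nonneg _) (rcut_le_one _)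
      rw [h5]
      gcongr
      · exact rcut_nonneg _
      · exact rcut_le_one _
    · rw [image_eq_zero_of_notMem_tsupport hx]
      have : 0 ≤ max (d x - k j) 0 := le_max_right _ _
      have : 0 ≤ η j x ^ 2 * max (d x - k j) 0 ^ 3 := by positivity
      simpa using this
  have hlim : Filter.Tendsto (fun j : ℕ => Y0 * τ ^ j) Filter.atTop (nhds (Y0 * 0)) :=
    (tendsto_pow_atTop_nhds_zero_of_lt_one hτ0.le hτ1).const_mul _
  have := ge_of_tendsto' hlim hle
  linarith

end degiorgi2


section smallgrad
variable {N : ℕ}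

lemma dq_mvt {u : EE N → ℝ} (hu : ContDiff ℝ 1 u) {h : ℝ} (hh : 0 < h) (e x : EE N) :
    ∃ t ∈ Set.Ioo (0:ℝ) 1, dq u (h • e) h x = ⟪gradient u (x + (t * h) • e), e⟫ := by
  have hd := hu.differentiable (by norm_num)
  have hder : ∀ t : ℝ, HasDerivAt (fun t : ℝ => u (x + (t * h) • e))
      (fderiv ℝ u (x + (t * h) • e) (h • e)) t := by
    intro t
    have h1 : HasDerivAt (fun t : ℝ => x + (t * h) • e) (h • e) t := by
      have := (((hasDerivAt_id t).mul_const h).smul_const e).const_add x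
      simpa using this
    exact (hd _).hasFDerivAt.comp_hasDerivAt t h1
  obtain ⟨t, ht, heq⟩ := exists_hasDerivAt_eq_slope (fun t : ℝ => u (x + (t * h) • e)) _
    zero_lt_one (fun t _ => (hder t).continuousAt.continuousWithinAt) (fun t _ => hder t)
  refine ⟨t, ht, ?_⟩
  rw [grad_apply]
  simp only [map_smul, smul_eq_mul, one_mul, zero_mul, zero_smul, add_zero, sub_zero, div_one] at heq
  unfold dq
  rw [← heq, ← mul_assoc, inv_mul_cancel₀ hh.ne', one_mul]

lemma energy_small {p lam M : ℝ} (hp : 1 < p) (hl : 0 ≤ lam) :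
    ∃ C : ℝ, 0 < C ∧ ∀ ε, 0 < ε → ε ≤ 1 → ∀ u : EE N → ℝ, ContDiff ℝ 1 u → (∀ x, 0 ≤ u x) →
      IsSol p lam 4 u → (∀ x ∈ ball (0 : EE N) 4, ‖gradient u x‖ ≤ M ∧ u x ≤ ε) →
      ∫ x, rcut 1 3 x * ‖gradient u x‖ ^ p ≤ C * ε := by
  set θ : EE N → ℝ := rcut 1 3 with hθ
  have hθC : ContDiff ℝ 1 θ := rcut_contDiff (n := 1)
  have hθc : HasCompactSupport θ := rcut_hcs one_pos
  have hθs : tsupport θ ⊆ ball 0 4 := rcut_tsupport_ball one_pos (by norm_num) (by norm_num)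
  have hθct := hθC.continuous
  have gθct := grad_cont hθC
  have i1 : Integrable θ := hθct.integrable_of_hasCompactSupport hθc
  have i2 : Integrable fun x => ‖gradient θ x‖ :=
    int_cc gθct.norm _ hθc.isCompact fun x hx => by simp [grad_tsupport θ hx]
  have n1 : 0 ≤ ∫ x, θ x := integral_nonneg fun x => rcut_nonneg _
  have n2 : 0 ≤ ∫ x, ‖gradient θ x‖ := integral_nonneg fun x => norm_nonneg _
  refine ⟨(∫ x, θ x) + |M| ^ (p - 1) * (∫ x, ‖gradient θ x‖) + 1, by positivity, ?_⟩
  intro ε hε hε1 u hu hu0 hsol hb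
  have hud := hu.differentiable (by norm_num)
  have hφs : tsupport (fun x => u x * θ x) ⊆ tsupport θ := tsupport_mul_subset_right
  have hφc : HasCompactSupport (fun x => u x * θ x) := hθc.mul_left
  have heq := hsol (fun x => u x * θ x) (hu.mul hθC) hφc (hφs.trans hθs)
  have gφ : ∀ x, ⟪Phi p (gradient u x), gradient (fun x => u x * θ x) x⟫ =
      θ x * ‖gradient u x‖ ^ p + u x * ⟪Phi p (gradient u x), gradient θ x⟫ := by
    intro x
    rw [grad_mul (hud x) (hθC.differentiable (by norm_num) x), inner_add_right,
      real_inner_smul_right, real_inner_smul_right, inner_Phi_self hp]; ring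
  simp_rw [gφ] at heq
  have huc := hu.continuous
  have guc := grad_cont hu
  have hPc := Phi_cont (N := N) hp
  have gup : Continuous fun x => ‖gradient u x‖ ^ p :=
    guc.norm.rpow_const fun x => Or.inr (by linarith)
  have j1 : Integrable fun x => θ x * ‖gradient u x‖ ^ p :=
    int_cc (hθct.mul gup) _ hθc.isCompact fun x hx => by simp [image_eq_zero_of_notMem_tsupport hx]
  have hin : Continuous fun x => ⟪Phi p (gradient u x), gradient θ x⟫ := (hPc.comp guc).inner gθct
  have j2 : Integrable fun x => u x * ⟪Phi p (gradient u x), gradient θ x⟫ :=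
    int_cc (huc.mul hin) _ hθc.isCompact fun x hx => by simp [grad_tsupport θ hx]
  have hul : Continuous fun x => u x ^ lam := huc.rpow_const fun x => Or.inr hl
  have j3 : Integrable fun x => u x ^ lam * (u x * θ x) :=
    int_cc (by fun_prop) _ hθc.isCompact fun x hx => by simp [image_eq_zero_of_notMem_tsupport hx]
  rw [integral_add j1 j2] at heq
  have k3 : ∫ x, u x ^ lam * (u x * θ x) ≤ ε * ∫ x, θ x := by
    rw [← integral_const_mul]
    refine integral_mono j3 (i1.const_mul _) fun x => ?_
    simp only
    by_cases hx : x ∈ tsupport θ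
    · have hb' := (hb x (hθs hx)).2
      have h1 : u x ^ lam ≤ 1 := Real.rpow_le_one (hu0 x) (hb'.trans hε1) hl
      have h2 := rcut_nonneg (s := 1) (ρ := 3) x
      have h3 := hu0 x
      calc u x ^ lam * (u x * θ x) ≤ 1 * (ε * θ x) := by gcongr
        _ = _ := one_mul _
    · simp [image_eq_zero_of_notMem_tsupport hx]
  have k2 : -(∫ x, u x * ⟪Phi p (gradient u x), gradient θ x⟫) ≤
      ε * (|M| ^ (p-1) * ∫ x, ‖gradient θ x‖) := by
    rw [← integral_neg, ← integral_const_mul, ← integral_const_mul]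
    refine integral_mono j2.neg ((i2.const_mul _).const_mul _) fun x => ?_
    simp only
    by_cases hx : x ∈ tsupport θ
    · obtain ⟨b1, b2⟩ := hb x (hθs hx)
      have h1 := neg_le_of_abs_le (abs_real_inner_le_norm (Phi p (gradient u x)) (gradient θ x))
      rw [norm_Phi hp] at h1
      have h2 : ‖gradient u x‖ ^ (p-1) ≤ |M| ^ (p-1) := by
        apply Real.rpow_le_rpow (norm_nonneg _) (b1.trans (le_abs_self _)) (by linarith)
      have h3 := hu0 x
      calc -(u x * ⟪Phi p (gradient u x), gradient θ x⟫)
          = u x * -⟪Phi p (gradient u x), gradient θ x⟫ := by ring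
        _ ≤ u x * (‖gradient u x‖ ^ (p-1) * ‖gradient θ x‖) := by gcongr; linarith
        _ ≤ _ := by gcongr
    · simp [grad_tsupport θ hx]
  nlinarith

lemma small_grad (hN : 1 ≤ N) {p lam M c : ℝ} (hp : 1 < p) (hl : 0 ≤ lam) (hc : 0 < c) :
    ∃ ε : ℝ, 0 < ε ∧ ∀ u : EE N → ℝ, ContDiff ℝ 1 u → (∀ x, 0 ≤ u x) →
      IsSol p lam 4 u → (∀ x ∈ ball (0 : EE N) 4, ‖gradient u x‖ ≤ M ∧ u x ≤ ε) →
      ‖gradient u 0‖ < c := by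
  wlog hc4 : c ≤ 4 generalizing c
  · obtain ⟨ε, h1, h2⟩ := this (c := 4) (by norm_num) le_rfl
    exact ⟨ε, h1, fun u a b d e => (h2 u a b d e).trans (by linarith)⟩
  obtain ⟨c1, C1, hc1, hC1, htp⟩ := Phi_two_point (N := N) (M := M) hp (m := c / 8) (by positivity)
  obtain ⟨Y0, hY0, dg⟩ := dg_iter hN hc1 (A1 := 2 * C1 ^ 2 / c1) (A2 := 2 / c1) (by positivity)
    (by positivity) hc hc4
  obtain ⟨C, hC, hen⟩ := energy_small (N := N) (M := M) hp hl
  set B : ℝ := |M| ^ 3 / (c / 8) ^ p with hB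
  have hB0 : 0 ≤ B := by positivity
  refine ⟨min 1 (Y0 / (C * (B + 1))), by positivity, ?_⟩
  set ε := min 1 (Y0 / (C * (B + 1))) with hε
  have hε0 : 0 < ε := by positivity
  have hε1 : ε ≤ 1 := min_le_left _ _
  intro u hu hu0 hsol hb
  by_contra! hcon
  have henergy := hen ε hε0 hε1 u hu hu0 hsol hb
  set g0 := gradient u 0 with hg0
  have hg0n : 0 < ‖g0‖ := by linarith
  set e : EE N := ‖g0‖⁻¹ • g0 with he
  have hen1 : ‖e‖ = 1 := by rw [he, norm_smul, norm_inv, norm_norm, inv_mul_cancel₀ hg0n.ne']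
  have guc := grad_cont hu
  have hunif := (isCompact_closedBall (0 : EE N) 3).uniformContinuousOn_of_continuous guc.continuousOn
  rw [Metric.uniformContinuousOn_iff] at hunif
  obtain ⟨h0, hh0, hmod⟩ := hunif (c / 8) (by positivity)
  set h := min (1/2) (h0 / 2) with hh
  have hpos : 0 < h := by positivity
  have hh1 : h ≤ 1/2 := min_le_left _ _
  have hhh : h < h0 := lt_of_le_of_lt (min_le_right _ _) (by linarith)
  have hshift : ∀ t, 0 ≤ t → t ≤ 1 → ‖(t * h) • e‖ ≤ h := by
    intro t h1 h2
    rw [norm_smul, hen1, mul_one, Real.norm_of_nonneg (by positivity)]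
    nlinarith
  have hnear : ∀ x ∈ ball (0 : EE N) 2, ∀ s t, 0 ≤ s → s ≤ 1 → 0 ≤ t → t ≤ 1 →
      ‖gradient u (x + (s * h) • e) - gradient u (x + (t * h) • e)‖ ≤ c / 8 := by
    intro x hx s t hs0 hs1 ht0 ht1
    rw [mem_ball_zero_iff] at hx
    have m1 : ∀ t, 0 ≤ t → t ≤ 1 → x + (t * h) • e ∈ closedBall (0 : EE N) 3 := by
      intro t h1 h2
      rw [mem_closedBall_zero_iff]
      have := norm_add_le x ((t * h) • e)
      have := hshift t h1 h2
      linarith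
    rw [← dist_eq_norm]
    refine (hmod _ (m1 s hs0 hs1) _ (m1 t ht0 ht1) ?_).le
    rw [dist_eq_norm, add_sub_add_left_eq_sub, ← sub_smul, ← sub_mul, norm_smul, hen1, mul_one,
      Real.norm_eq_abs, abs_mul, abs_of_pos hpos]
    have : |s - t| ≤ 1 := by rw [abs_le]; constructor <;> linarith
    nlinarith
  have hM : ∀ x ∈ ball (0 : EE N) 2, ∀ t, 0 ≤ t → t ≤ 1 → ‖gradient u (x + (t * h) • e)‖ ≤ M := by
    intro x hx t h1 h2
    refine (hb _ ?_).1
    rw [mem_ball_zero_iff] at hx ⊢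
    have := norm_add_le x ((t * h) • e)
    have := hshift t h1 h2
    linarith
  have hlow : ∀ x ∈ ball (0 : EE N) 2, c / 4 < dq u (h • e) h x → ∀ s, 0 ≤ s → s ≤ 1 →
      c / 8 ≤ ‖gradient u (x + (s * h) • e)‖ := by
    intro x hx hd s hs0 hs1
    obtain ⟨t, ht, heq⟩ := dq_mvt hu hpos e x
    have h1 := hnear x hx t s ht.1.le ht.2.le hs0 hs1
    have h2 := real_inner_le_norm (gradient u (x + (t * h) • e)) e
    rw [hen1, mul_one, ← heq] at h2
    have h3 := norm_sub_norm_le (gradient u (x + (t * h) • e)) (gradient u (x + (s * h) • e))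
    linarith
  have hdM : ∀ x ∈ ball (0 : EE N) 2, dq u (h • e) h x ≤ M := by
    intro x hx
    obtain ⟨t, ht, heq⟩ := dq_mvt hu hpos e x
    have h2 := real_inner_le_norm (gradient u (x + (t * h) • e)) e
    rw [hen1, mul_one, ← heq] at h2
    exact h2.trans (hM x hx t ht.1.le ht.2.le)
  have hfin := dg (dq u (h • e) h) (dq_contDiff hu _ _) (by
    intro k hk η hη hηc hηs hη0
    refine caccio hp hl hc1 hu hu0 hsol ?_ hpos hen1 hη hηc (hηs.trans (ball_subset_ball (by linarith)))
      hη0 ?_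
    · intro x hx
      exact Real.rpow_le_one (hu0 x) ((hb x hx).2.trans hε1) hl
    · intro x hx hkx
      have hx2 := hηs hx
      have hd' : c / 4 < dq u (h • e) h x := by linarith
      have l0 := hlow x hx2 hd' 0 le_rfl zero_le_one
      have l1 := hlow x hx2 hd' 1 zero_le_one le_rfl
      have m0 := hM x hx2 0 le_rfl zero_le_one
      have m1 := hM x hx2 1 zero_le_one le_rfl
      simp only [zero_mul, zero_smul, add_zero, one_mul] at l0 l1 m0 m1
      exact htp _ _ l1 m1 l0 m0) (by
    have hdC := (dq_contDiff hu (h • e) h).continuous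
    have hrc : Continuous (rcut 2 2 : EE N → ℝ) := (rcut_contDiff (n := 1)).continuous
    have hrc3 : Continuous (rcut 1 3 : EE N → ℝ) := (rcut_contDiff (n := 1)).continuous
    have gup : Continuous fun x => ‖gradient u x‖ ^ p :=
      guc.norm.rpow_const fun x => Or.inr (by linarith)
    calc ∫ x, (rcut 2 2 x) ^ 2 * max (dq u (h • e) h x - c / 4) 0 ^ 3
        ≤ ∫ x, B * (rcut 1 3 x * ‖gradient u x‖ ^ p) := by
          refine integral_mono (int_cc (by fun_prop) _ (rcut_hcs (s := 2) (ρ := 2) two_pos).isCompact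
            fun x hx => by simp [image_eq_zero_of_notMem_tsupport hx])
            ((int_cc (hrc3.mul gup) _ (rcut_hcs (s := 1) (ρ := 3) one_pos).isCompact
            fun x hx => by simp [image_eq_zero_of_notMem_tsupport hx]).const_mul _) fun x => ?_
          simp only
          have hn : 0 ≤ B * (rcut 1 3 x * ‖gradient u x‖ ^ p) := by
            have := rcut_nonneg (s := 1) (ρ := 3) x
            positivity
          by_cases hx : x ∈ tsupport (rcut 2 2 : EE N → ℝ)
          · by_cases hd' : c / 4 < dq u (h • e) h x
            · have hx2 : x ∈ ball (0 : EE N) 2 :=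
                rcut_tsupport_ball two_pos two_pos (by norm_num) hx
              have l0 := hlow x hx2 hd' 0 le_rfl zero_le_one
              simp only [zero_mul, zero_smul, add_zero] at l0
              have hnx := rcut_tsupport two_pos hx
              simp only [Set.mem_setOf_eq] at hnx
              have h1 : rcut 1 3 x = 1 := rcut_one (by linarith)
              rw [h1, one_mul, hB, div_mul_eq_mul_div, le_div_iff₀ (by positivity)]
              have h2 : max (dq u (h • e) h x - c / 4) 0 ≤ |M| := by
                apply max_le _ (abs_nonneg _)
                have := hdM x hx2
                have := le_abs_self M
                linarith
              have h3 : rcut 2 2 x ^ 2 ≤ 1 := pow_le_one₀ (rcut_nonneg _) (rcut_le_one _)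
              have h4 : (c / 8) ^ p ≤ ‖gradient u x‖ ^ p :=
                Real.rpow_le_rpow (by positivity) l0 (by linarith)
              calc rcut 2 2 x ^ 2 * max (dq u (h • e) h x - c / 4) 0 ^ 3 * (c / 8) ^ p
                  ≤ 1 * |M| ^ 3 * ‖gradient u x‖ ^ p := by gcongr
                _ = _ := by ring
            · have : max (dq u (h • e) h x - c / 4) 0 = 0 := max_eq_right (by linarith)
              rw [this]; simpa using hn
          · rw [image_eq_zero_of_notMem_tsupport hx]; simpa using hn
      _ = B * ∫ x, (rcut 1 3 x * ‖gradient u x‖ ^ p) := integral_const_mul _ _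
      _ ≤ B * (C * ε) := by gcongr
      _ ≤ (C * (B + 1)) * ε := by nlinarith [mul_pos hC hε0]
      _ ≤ Y0 := by
          have : ε ≤ Y0 / (C * (B + 1)) := min_le_right _ _
          rw [le_div_iff₀ (by positivity)] at this
          linarith)
  obtain ⟨t, ht, heq⟩ := dq_mvt hu hpos e 0
  have h1 := hnear 0 (by simp) 0 t le_rfl zero_le_one ht.1.le ht.2.le
  simp only [zero_mul, zero_smul, add_zero] at h1
  have h2 := real_inner_le_norm (gradient u 0 - gradient u (0 + (t * h) • e)) e
  rw [hen1, mul_one, inner_sub_left, ← heq] at h2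
  have h3 : ⟪gradient u 0, e⟫ = ‖g0‖ := by
    rw [he, real_inner_smul_right, ← hg0, real_inner_self_eq_norm_sq]
    field_simp
  linarith

end smallgrad


section barrier
variable {N : ℕ}

lemma Phi_strict {p : ℝ} (hp : 1 < p) {ξ ζ : EE N} (h : ⟪Phi p ξ - Phi p ζ, ξ - ζ⟫ ≤ 0) :
    ξ = ζ := by
  have h0 := h
  rw [inner_sub_left, inner_sub_right, inner_sub_right, inner_Phi_self hp, inner_Phi_self hp] at h
  have h1 : ⟪Phi p ξ, ζ⟫ ≤ ‖ξ‖ ^ (p - 1) * ‖ζ‖ := by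
    rw [← norm_Phi hp]; exact real_inner_le_norm _ _
  have h2 : ⟪Phi p ζ, ξ⟫ ≤ ‖ζ‖ ^ (p - 1) * ‖ξ‖ := by
    rw [← norm_Phi hp]; exact real_inner_le_norm _ _
  have e1 : ∀ a : ℝ, 0 ≤ a → a ^ p = a ^ (p - 1) * a := by
    intro a ha
    rcases ha.eq_or_lt with h | h
    · rw [← h, Real.zero_rpow (by linarith), mul_zero]
    · rw [← Real.rpow_add_one h.ne']; ring_nf
  rw [e1 _ (norm_nonneg ξ), e1 _ (norm_nonneg ζ)] at h
  have h3 : (‖ξ‖ ^ (p-1) - ‖ζ‖ ^ (p-1)) * (‖ξ‖ - ‖ζ‖) ≤ 0 := by nlinarith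
  have hn : ‖ξ‖ = ‖ζ‖ := by
    by_contra hne
    rcases lt_or_gt_of_ne hne with hl | hl
    · have := Real.rpow_lt_rpow (norm_nonneg _) hl (show 0 < p - 1 by linarith)
      nlinarith
    · have := Real.rpow_lt_rpow (norm_nonneg _) hl (show 0 < p - 1 by linarith)
      nlinarith
  by_cases hz : ‖ξ‖ = 0
  · have : ‖ζ‖ = 0 := by rw [← hn]; exact hz
    rw [norm_eq_zero] at hz this
    rw [hz, this]
  · have hpos : 0 < ‖ξ‖ := lt_of_le_of_ne (norm_nonneg _) (Ne.symm hz)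
    unfold Phi at h0
    rw [← hn, ← smul_sub, real_inner_smul_left, real_inner_self_eq_norm_sq] at h0
    have h4 : 0 < ‖ξ‖ ^ (p-2) := by positivity
    have h5 : ‖ξ - ζ‖ ^ 2 ≤ 0 := by
      by_contra! hh
      have := mul_pos h4 hh
      linarith
    have : ‖ξ - ζ‖ = 0 := by nlinarith [norm_nonneg (ξ - ζ)]
    rw [norm_eq_zero] at this
    exact sub_eq_zero.1 this

/-- Euler identity -/
lemma euler_id {F : EE N → ℝ} (hF : ContDiff ℝ 1 F) (hc : HasCompactSupport F) :
    ∫ x, (⟪x, gradient F x⟫ + N * F x) = 0 := by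
  have hd := hF.differentiable (by norm_num)
  let b : Fin N → EE N := fun i => EuclideanSpace.single i (1:ℝ)
  have hcoord : ∀ i, ContDiff ℝ 1 fun x : EE N => x i := fun i => by fun_prop
  have hsupp : ∀ i, HasCompactSupport fun x : EE N => x i * F x := fun i => hc.mul_left
  have hz : ∀ i, ∫ x, fderiv ℝ (fun x : EE N => x i * F x) x (b i) = 0 := fun i =>
    integral_fderiv_zero (v := b i) ((hcoord i).mul hF) (hsupp i)
  have hpt : ∀ x : EE N, ⟪x, gradient F x⟫ + N * F x =
      ∑ i, fderiv ℝ (fun x : EE N => x i * F x) x (b i) := by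
    intro x
    have e1 : ∀ i, fderiv ℝ (fun x : EE N => x i * F x) x (b i) = x i * fderiv ℝ F x (b i) + F x := by
      intro i
      have hc1 : HasFDerivAt (fun x : EE N => x i) (EuclideanSpace.proj i : EE N →L[ℝ] ℝ) x :=
        (EuclideanSpace.proj i : EE N →L[ℝ] ℝ).hasFDerivAt
      rw [(hc1.fun_mul (hd x).hasFDerivAt).fderiv]
      simp [b]
    simp_rw [e1]
    rw [Finset.sum_add_distrib, Finset.sum_const, Finset.card_univ, Fintype.card_fin, nsmul_eq_mul]
    congr 1
    rw [real_inner_comm, PiLp.inner_apply]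
    apply Finset.sum_congr rfl
    intro i _
    rw [← grad_apply]
    simp only [b]
    rw [EuclideanSpace.inner_single_right]
    simp [mul_comm]
  simp_rw [hpt]
  rw [integral_finsetSum]
  · simp [hz]
  · intro i _
    have h1 : ContDiff ℝ 1 fun x : EE N => x i * F x := (hcoord i).mul hF
    have h2 : Continuous fun x => fderiv ℝ (fun x : EE N => x i * F x) x (b i) :=
      (h1.continuous_fderiv (by norm_num)).clm_apply continuous_const
    refine int_cc h2 _ (hsupp i).isCompact fun x hx => ?_
    have : fderiv ℝ (fun x : EE N => x i * F x) x = 0 := by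
      by_contra h
      exact hx (support_fderiv_subset ℝ h)
    rw [this]; simp

/-- weight `M(t) = (t+τ)^{-k} t^{q}` -/
lemma weight_deriv {τ k q t : ℝ} (hτ : 0 < τ) (ht : 0 < t) :
    HasDerivAt (fun t : ℝ => (t + τ) ^ (-k) * t ^ q)
      ((t + τ) ^ (-k) * t ^ q * (q / t - k / (t + τ))) t := by
  have h1 : HasDerivAt (fun t : ℝ => (t + τ) ^ (-k)) (1 * (-k) * (t + τ) ^ (-k - 1)) t :=
    ((hasDerivAt_id t).add_const τ).rpow_const (Or.inl (by simp only [id]; positivity))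
  have h2 : HasDerivAt (fun t : ℝ => t ^ q) (1 * q * t ^ (q - 1)) t :=
    (hasDerivAt_id t).rpow_const (Or.inl ht.ne')
  have h3 := h1.mul h2
  refine h3.congr_deriv ?_
  rw [Real.rpow_sub_one (by positivity), Real.rpow_sub_one ht.ne']
  field_simp
  ring

lemma barrier_div {p k τ ρ : ℝ} (hτ : 0 < τ) (hρ : 0 < ρ)
    (hk : ∀ t, ρ ^ 2 ≤ t → (N + p - 2) * (t + τ) ≤ 2 * k * t)
    {φ : EE N → ℝ} (hφ : ContDiff ℝ 1 φ) (hc : HasCompactSupport φ) (hφ0 : ∀ x, 0 ≤ φ x)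
    (hz : ∀ x ∈ ball (0 : EE N) ρ, φ x = 0) :
    0 ≤ ∫ x, ((‖x‖ ^ 2 + τ) ^ (-k) * (‖x‖ ^ 2) ^ ((p - 2) / 2)) * ⟪x, gradient φ x⟫ := by
  set m : EE N → ℝ := fun x => (‖x‖ ^ 2 + τ) ^ (-k) * (‖x‖ ^ 2) ^ ((p - 2) / 2) with hm
  have hd := hφ.differentiable (by norm_num)
  have hev : ∀ x ∈ ball (0 : EE N) ρ, φ =ᶠ[nhds x] fun _ => 0 := fun x hx => by
    filter_upwards [isOpen_ball.mem_nhds hx] with y hy using hz y hy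
  have hev2 : ∀ x ∈ ball (0 : EE N) ρ, (fun x => φ x * m x) =ᶠ[nhds x] fun _ => 0 := fun x hx => by
    filter_upwards [hev x hx] with y hy; simp [hy]
  have hne : ∀ x, x ∉ ball (0 : EE N) ρ → ρ ^ 2 ≤ ‖x‖ ^ 2 := by
    intro x hx
    rw [mem_ball_zero_iff, not_lt] at hx
    gcongr
  have hmC : ∀ x, x ∉ ball (0 : EE N) ρ → ContDiffAt ℝ 1 m x := by
    intro x hx
    have h1 := hne x hx
    have h2 : 0 < ‖x‖ ^ 2 := lt_of_lt_of_le (by positivity) h1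
    have hn : ContDiffAt ℝ 1 (fun x : EE N => ‖x‖ ^ 2) x := (contDiff_norm_sq ℝ).contDiffAt
    exact ((hn.add contDiffAt_const).rpow_const_of_ne (by positivity)).mul
      (hn.rpow_const_of_ne h2.ne')
  have hF : ContDiff ℝ 1 fun x => φ x * m x := by
    rw [contDiff_iff_contDiffAt]
    intro x
    by_cases hx : x ∈ ball (0 : EE N) ρ
    · exact contDiffAt_const.congr_of_eventuallyEq (hev2 x hx)
    · exact hφ.contDiffAt.mul (hmC x hx)
  have hFc : HasCompactSupport fun x => φ x * m x := hc.mul_right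
  have heul := euler_id hF hFc
  have gz : ∀ x ∈ ball (0 : EE N) ρ, gradient φ x = 0 ∧ gradient (fun x => φ x * m x) x = 0 := by
    intro x hx
    unfold gradient
    rw [(hev x hx).fderiv_eq, (hev2 x hx).fderiv_eq]
    simp
  have gF : ∀ x, x ∉ ball (0 : EE N) ρ → ⟪x, gradient (fun x => φ x * m x) x⟫ =
      m x * ⟪x, gradient φ x⟫ + φ x * (m x * (p - 2 - 2 * k * ‖x‖ ^ 2 / (‖x‖ ^ 2 + τ))) := by
    intro x hx
    have h2 : 0 < ‖x‖ ^ 2 := lt_of_lt_of_le (by positivity) (hne x hx)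
    have hn : HasFDerivAt (fun x : EE N => ‖x‖ ^ 2) ((2:ℕ) • (innerSL ℝ x : EE N →L[ℝ] ℝ)) x :=
      (hasStrictFDerivAt_norm_sq x).hasFDerivAt
    have hmd := (weight_deriv (k := k) (q := (p-2)/2) hτ h2).comp_hasFDerivAt x hn
    have hgm : ⟪x, gradient m x⟫ = m x * (p - 2 - 2 * k * ‖x‖ ^ 2 / (‖x‖ ^ 2 + τ)) := by
      rw [real_inner_comm, grad_apply, show fderiv ℝ m x = _ from hmd.fderiv]
      have h2' : ‖x‖ ≠ 0 := by intro h; rw [h] at h2; norm_num at h2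
      simp only [ContinuousLinearMap.smul_apply, innerSL_apply_apply, real_inner_self_eq_norm_sq,
        smul_eq_mul, nsmul_eq_mul, hm]
      field_simp
      push_cast
      ring
    rw [grad_mul (hd x) ((hmC x hx).differentiableAt (by norm_num)), inner_add_right,
      real_inner_smul_right, real_inner_smul_right, hgm]
    ring
  have gFc := grad_cont hF
  have hcont : Continuous fun x => m x * ⟪x, gradient φ x⟫ := by
    have e : (fun x => m x * ⟪x, gradient φ x⟫) = fun x => ((‖x‖ ^ 2 + τ) ^ (-k) * (max (‖x‖ ^ 2) (ρ ^ 2)) ^ ((p - 2) / 2)) * ⟪x, gradient φ x⟫ := by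
      ext x
      by_cases hx : x ∈ ball (0 : EE N) ρ
      · simp [(gz x hx).1]
      · rw [max_eq_left (hne x hx)]
    rw [e]
    have h1 : Continuous fun x : EE N => (‖x‖ ^ 2 + τ) ^ (-k) :=
      Continuous.rpow_const (by fun_prop) fun x => Or.inl (by positivity)
    have h2 : Continuous fun x : EE N => (max (‖x‖ ^ 2) (ρ ^ 2)) ^ ((p - 2) / 2) :=
      Continuous.rpow_const (by fun_prop) fun x => Or.inl (by positivity)
    exact (h1.mul h2).mul (continuous_id.inner (grad_cont hφ))
  rw [← heul]
  apply integral_mono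
  · refine int_cc ((continuous_id.inner gFc).add (continuous_const.mul hF.continuous)) _
      hFc.isCompact fun x hx => ?_
    rw [grad_tsupport _ hx, image_eq_zero_of_notMem_tsupport hx]; simp
  · refine int_cc hcont _ hc.isCompact fun x hx => ?_
    rw [grad_tsupport _ hx]; simp
  · intro x
    simp only
    by_cases hx : x ∈ ball (0 : EE N) ρ
    · rw [(gz x hx).1, (gz x hx).2, hz x hx]; simp
    · rw [gF x hx]
      have h1 := hk _ (hne x hx)
      have h2 : 0 < ‖x‖ ^ 2 := lt_of_lt_of_le (by positivity) (hne x hx)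
      have h3 : (N + p - 2 : ℝ) ≤ 2 * k * ‖x‖ ^ 2 / (‖x‖ ^ 2 + τ) := by
        rw [le_div_iff₀ (by positivity)]; exact h1
      have hm0 : 0 ≤ m x := by simp only [hm]; positivity
      have h4 : 0 ≤ φ x * m x := mul_nonneg (hφ0 x) hm0
      nlinarith

/-- comparison with the radial barrier -/
lemma barrier {p lam σ c0 ρ : ℝ} (hp : 1 < p) (hσ : 0 < σ)
    (hσN : (N : ℝ) - p < σ * (p - 1)) (hc0 : 0 < c0) (hρ : 0 < ρ) :
    ∃ c : ℝ, 0 < c ∧ ∀ R r : ℝ, 1 ≤ R → 2 * R < r → ∀ u : EE N → ℝ, ContDiff ℝ 1 u →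
      (∀ x, 0 ≤ u x) → IsSol p lam r u → (∀ x ∈ ball (0 : EE N) ρ, c0 ≤ u x) →
      ∀ x ∈ closedBall (0 : EE N) R, c * R ^ (-σ) ≤ u x := by
  set k : ℝ := (σ / 2 + 1) * (p - 1) with hk
  set D : ℝ := 2 * k - (N + p - 2) with hD
  have hD0 : 0 < D := by rw [hD, hk]; nlinarith
  set τ : ℝ := min 1 (D * ρ ^ 2 / (|(N:ℝ) + p - 2| + 1)) with hτ
  have hτ0 : 0 < τ := by positivity
  have hτ1 : τ ≤ 1 := min_le_left _ _
  have hτ2 : (N + p - 2) * τ ≤ D * ρ ^ 2 := by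
    have h1 : τ ≤ D * ρ ^ 2 / (|(N:ℝ) + p - 2| + 1) := min_le_right _ _
    rw [le_div_iff₀ (by positivity)] at h1
    have h2 := le_abs_self ((N:ℝ) + p - 2)
    nlinarith
  have hkt : ∀ t, ρ ^ 2 ≤ t → (N + p - 2) * (t + τ) ≤ 2 * k * t := by
    intro t ht
    nlinarith
  set A : ℝ := c0 * τ ^ (σ / 2) with hA
  have hA0 : 0 < A := by positivity
  have hdiff : (0:ℝ) < 2 ^ (-(σ/2)) - 4 ^ (-(σ/2)) := by
    rw [sub_pos]
    exact Real.rpow_lt_rpow_of_neg (by norm_num) (by norm_num) (by linarith)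
  refine ⟨A * (2 ^ (-(σ/2)) - 4 ^ (-(σ/2))), by positivity, ?_⟩
  intro R r hR hRr u hu hu0 hsol huρ
  set w : EE N → ℝ := fun x => A * (‖x‖ ^ 2 + τ) ^ (-(σ/2)) - A * (4 * R ^ 2 + τ) ^ (-(σ/2)) with hw
  have hwC : ContDiff ℝ 1 w := by
    have hn : ContDiff ℝ 1 (fun x : EE N => ‖x‖ ^ 2) := contDiff_norm_sq ℝ
    exact (contDiff_const.mul ((hn.add contDiff_const).rpow_const_of_ne
      (fun x => by positivity))).sub contDiff_const
  have gw : ∀ x, gradient w x = (-(A * σ * (‖x‖ ^ 2 + τ) ^ (-(σ/2) - 1))) • x := by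
    intro x
    have hn : HasFDerivAt (fun x : EE N => ‖x‖ ^ 2) ((2:ℕ) • (innerSL ℝ x : EE N →L[ℝ] ℝ)) x :=
      (hasStrictFDerivAt_norm_sq x).hasFDerivAt
    have h1 := (((hn.add_const τ).rpow_const (p := -(σ/2)) (Or.inl (by positivity))).const_mul
      A).sub_const (A * (4 * R ^ 2 + τ) ^ (-(σ/2)))
    apply ext_inner_right ℝ
    intro y
    rw [grad_apply, show fderiv ℝ w x = _ from h1.fderiv]
    rw [real_inner_smul_left]
    simp only [ContinuousLinearMap.smul_apply, innerSL_apply_apply, smul_eq_mul, nsmul_eq_mul]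
    push_cast
    ring
  have hwc0 : ∀ x, w x ≤ c0 := by
    intro x
    have h1 : (‖x‖ ^ 2 + τ) ^ (-(σ/2)) ≤ τ ^ (-(σ/2)) :=
      Real.rpow_le_rpow_of_nonpos hτ0 (by nlinarith [norm_nonneg x]) (by linarith)
    have h2 : A * τ ^ (-(σ/2)) = c0 := by
      rw [hA, mul_assoc, ← Real.rpow_add hτ0]; simp
    have h3 : 0 ≤ A * (4 * R ^ 2 + τ) ^ (-(σ/2)) := by positivity
    calc w x ≤ A * (‖x‖ ^ 2 + τ) ^ (-(σ/2)) := by simp only [hw]; linarith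
      _ ≤ A * τ ^ (-(σ/2)) := by gcongr
      _ = c0 := h2
  have hwneg : ∀ x : EE N, 2 * R ≤ ‖x‖ → w x ≤ 0 := by
    intro x hx
    have h1 : (‖x‖ ^ 2 + τ) ^ (-(σ/2)) ≤ (4 * R ^ 2 + τ) ^ (-(σ/2)) :=
      Real.rpow_le_rpow_of_nonpos (by positivity) (by nlinarith) (by linarith)
    have := mul_le_mul_of_nonneg_left h1 hA0.le
    simp only [hw]; linarith
  set P : EE N → ℝ := fun x => max (w x - u x) 0 with hP
  have hP0 : ∀ x, 0 ≤ P x := fun x => le_max_right _ _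
  set φ : EE N → ℝ := fun x => P x ^ (2:ℝ) with hφ
  have hφC : ContDiff ℝ 1 φ := (posrpow_contDiff (r := 2) (by norm_num)).comp (hwC.sub hu)
  have hwd := hwC.differentiable (by norm_num)
  have hud := hu.differentiable (by norm_num)
  have gφ : ∀ x, gradient φ x = (2 * P x) • (gradient w x - gradient u x) := by
    intro x
    have hwu : DifferentiableAt ℝ (fun y => w y - u y) x := (hwd x).sub (hud x)
    have h1 := posrpow_hasDerivAt (r := 2) (by norm_num) (w x - u x)
    have h2 := grad_comp (f := fun y => w y - u y) h1 hwu
    rw [grad_sub (hwd x) (hud x)] at h2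
    rw [show (2:ℝ) - 1 = 1 by norm_num, Real.rpow_one] at h2
    exact h2
  have hφ0 : ∀ x, 0 ≤ φ x := fun x => Real.rpow_nonneg (hP0 x) _
  have hPz : ∀ x, w x ≤ u x → P x = 0 := fun x hx => max_eq_right (by linarith)
  have hφz : ∀ x, w x ≤ u x → φ x = 0 := fun x hx => by simp [hφ, hPz x hx]
  have hφs : tsupport φ ⊆ closedBall 0 (2 * R) := by
    apply closure_minimal _ isClosed_closedBall
    intro x hx
    by_contra h
    rw [mem_closedBall_zero_iff, not_le] at h
    exact hx (hφz x ((hwneg x h.le).trans (hu0 x)))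
  have hφc : HasCompactSupport φ :=
    (isCompact_closedBall _ _).of_isClosed_subset (isClosed_tsupport _) hφs
  have heq := hsol φ hφC hφc (hφs.trans (closedBall_subset_ball hRr))
  have hrhs : 0 ≤ ∫ x, u x ^ lam * φ x :=
    integral_nonneg fun x => mul_nonneg (Real.rpow_nonneg (hu0 x) _) (hφ0 x)
  have hφρ : ∀ x ∈ ball (0 : EE N) ρ, φ x = 0 := fun x hx =>
    hφz x ((hwc0 x).trans (huρ x hx))
  have hdiv := barrier_div hτ0 hρ hkt hφC hφc hφ0 hφρ
  have hPhi : ∀ x, ⟪Phi p (gradient w x), gradient φ x⟫ = -(A * σ) ^ (p-1) *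
      (((‖x‖ ^ 2 + τ) ^ (-k) * (‖x‖ ^ 2) ^ ((p - 2) / 2)) * ⟪x, gradient φ x⟫) := by
    intro x
    by_cases hx : x = 0
    · have : gradient w 0 = 0 := by rw [gw]; simp
      rw [hx, this, Phi_zero]; simp
    · have hx0 : 0 < ‖x‖ := norm_pos_iff.2 hx
      set B := A * σ * (‖x‖ ^ 2 + τ) ^ (-(σ/2) - 1) with hB
      have hB0 : 0 < B := by positivity
      rw [gw, Phi, norm_smul, norm_neg, Real.norm_of_nonneg hB0.le, smul_smul, real_inner_smul_left]
      have e1 : (B * ‖x‖) ^ (p-2) * B = B ^ (p-1) * ‖x‖ ^ (p-2) := by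
        rw [Real.mul_rpow hB0.le hx0.le, show p - 1 = (p - 2) + 1 by ring, Real.rpow_add_one hB0.ne']
        ring
      have e2 : B ^ (p-1) = (A * σ) ^ (p-1) * (‖x‖ ^ 2 + τ) ^ (-k) := by
        rw [hB, Real.mul_rpow (by positivity) (by positivity), ← Real.rpow_mul (by positivity), hk]
        congr 2; ring
      have e3 : (‖x‖ ^ 2) ^ ((p - 2) / 2) = ‖x‖ ^ (p-2) := by
        rw [← Real.rpow_natCast, ← Real.rpow_mul hx0.le]; congr 1; push_cast; ring
      rw [mul_neg, e1, e2, e3]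
      ring
  have hsub : ∫ x, ⟪Phi p (gradient w x), gradient φ x⟫ ≤ 0 := by
    simp_rw [hPhi]
    rw [integral_const_mul]
    have : 0 ≤ (A * σ) ^ (p-1) := by positivity
    nlinarith
  have hPc := Phi_cont (N := N) hp
  have gwc := grad_cont hwC
  have guc := grad_cont hu
  have gφc := grad_cont hφC
  have i1 : Integrable fun x => ⟪Phi p (gradient w x), gradient φ x⟫ :=
    int_cc ((hPc.comp gwc).inner gφc) _ hφc.isCompact fun x hx => by simp [grad_tsupport φ hx]
  have i2 : Integrable fun x => ⟪Phi p (gradient u x), gradient φ x⟫ :=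
    int_cc ((hPc.comp guc).inner gφc) _ hφc.isCompact fun x hx => by simp [grad_tsupport φ hx]
  set G : EE N → ℝ := fun x => ⟪Phi p (gradient w x) - Phi p (gradient u x), gradient φ x⟫ with hG
  have hGc : Continuous G := ((hPc.comp gwc).sub (hPc.comp guc)).inner gφc
  have hGs : HasCompactSupport G := HasCompactSupport.intro hφc.isCompact
    fun x hx => by simp only [hG]; rw [grad_tsupport φ hx, inner_zero_right]
  have hGeq : ∀ x, G x = 2 * P x * ⟪Phi p (gradient w x) - Phi p (gradient u x),
      gradient w x - gradient u x⟫ := fun x => by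
    simp only [hG]; rw [gφ, real_inner_smul_right]
  have hG0 : ∀ x, 0 ≤ G x := fun x => by
    rw [hGeq]
    exact mul_nonneg (mul_nonneg two_pos.le (hP0 x)) (Phi_mono hp _ _)
  have hGint : ∫ x, G x ≤ 0 := by
    simp only [hG, inner_sub_left]
    rw [integral_sub i1 i2]
    linarith
  have hGz : ∀ x, G x = 0 := by
    intro x
    by_contra hne
    have := hGc.integral_pos_of_hasCompactSupport_nonneg_nonzero (μ := volume) hGs hG0 hne
    linarith
  have gφz : ∀ x, gradient φ x = 0 := by
    intro x
    rw [gφ]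
    rcases (hP0 x).eq_or_lt with h | h
    · rw [← h]; simp
    · have h1 := hGz x
      rw [hGeq] at h1
      have h2 : ⟪Phi p (gradient w x) - Phi p (gradient u x), gradient w x - gradient u x⟫ = 0 := by
        rcases mul_eq_zero.1 h1 with h3 | h3
        · linarith
        · exact h3
      rw [Phi_strict hp h2.le, sub_self, smul_zero]
  have hφd := hφC.differentiable (by norm_num)
  have hconst : ∀ x, φ x = φ 0 := fun x => by
    apply is_const_of_fderiv_eq_zero hφd
    intro y
    have := norm_grad φ y
    rw [gφz, norm_zero] at this
    exact norm_eq_zero.1 this.symm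
  have hφ00 : φ 0 = 0 := hφρ 0 (by simpa using hρ)
  intro x hx
  have hwu : w x ≤ u x := by
    have h1 : φ x = 0 := by rw [hconst, hφ00]
    by_contra! h2
    have h3 : 0 < P x := lt_max_of_lt_left (by linarith)
    have : 0 < φ x := Real.rpow_pos_of_pos h3 _
    linarith
  refine le_trans ?_ hwu
  rw [mem_closedBall_zero_iff] at hx
  have hRpos : 0 < R := by linarith
  have e1 : ∀ a : ℝ, 0 < a → (a * R ^ 2) ^ (-(σ/2)) = a ^ (-(σ/2)) * R ^ (-σ) := by
    intro a ha
    rw [Real.mul_rpow ha.le (by positivity), ← Real.rpow_natCast, ← Real.rpow_mul hRpos.le]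
    congr 2; push_cast; ring
  have h1 : (2 * R ^ 2) ^ (-(σ/2)) ≤ (‖x‖ ^ 2 + τ) ^ (-(σ/2)) :=
    Real.rpow_le_rpow_of_nonpos (by positivity) (by nlinarith [norm_nonneg x]) (by linarith)
  have h2 : (4 * R ^ 2 + τ) ^ (-(σ/2)) ≤ (4 * R ^ 2) ^ (-(σ/2)) :=
    Real.rpow_le_rpow_of_nonpos (by positivity) (by linarith) (by linarith)
  rw [e1 2 two_pos] at h1
  rw [e1 4 (by norm_num)] at h2
  have h3 := mul_le_mul_of_nonneg_left h1 hA0.le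
  have h4 := mul_le_mul_of_nonneg_left h2 hA0.le
  simp only [hw]
  linarith

end barrier


section ptw

lemma ptw_cs {N : ℕ} (h : Fin N → Fin N → ℝ) (hs : ∀ i j, h i j = h j i) (ξ : Fin N → ℝ)
    {t : ℝ} (ht : t = ∑ i, ξ i ^ 2) (ht0 : 0 < t) (w : Fin N → ℝ)
    (hw : ∀ i, w i = ∑ j, h i j * ξ j) (c : ℝ) :
    0 ≤ (∑ i, ∑ j, h i j ^ 2) - 2 * (∑ i, w i ^ 2) / t + (∑ i, w i * ξ i) ^ 2 / t ^ 2
      - 2 * c * ((∑ i, h i i) - (∑ i, w i * ξ i) / t) + c ^ 2 * (N - 1) := by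
  set b := ∑ i, w i * ξ i with hb
  set a := ∑ i, w i ^ 2 with ha
  set μ : ℝ := b / (2 * t ^ 2) + c / (2 * t) with hμ
  set x : Fin N → ℝ := fun i => w i / t - μ * ξ i with hx
  have xξ : ∑ i, x i * ξ i = b / t - μ * t := by
    simp only [hx, sub_mul, Finset.sum_sub_distrib]
    rw [hb, ht, Finset.sum_div, Finset.mul_sum]
    congr 1 <;> exact Finset.sum_congr rfl fun i _ => by ring
  have xw : ∑ i, x i * w i = a / t - μ * b := by
    simp only [hx, sub_mul, Finset.sum_sub_distrib]
    rw [hb, ha, Finset.sum_div, Finset.mul_sum]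
    congr 1 <;> exact Finset.sum_congr rfl fun i _ => by ring
  have xx : ∑ i, x i ^ 2 = a / t ^ 2 - 2 * μ * b / t + μ ^ 2 * t := by
    rw [hb, ha, Finset.sum_div, Finset.mul_sum, Finset.sum_div, ht, Finset.mul_sum,
      ← Finset.sum_sub_distrib, ← Finset.sum_add_distrib, ← ht]
    exact Finset.sum_congr rfl fun i _ => by simp only [hx]; field_simp; ring
  have key : 0 ≤ ∑ i, ∑ j, (h i j - x i * ξ j - ξ i * x j - c * (if i = j then 1 else 0)) ^ 2 :=
    Finset.sum_nonneg fun i _ => Finset.sum_nonneg fun j _ => sq_nonneg _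
  have exp : ∑ i, ∑ j, (h i j - x i * ξ j - ξ i * x j - c * (if i = j then 1 else 0)) ^ 2 =
      (∑ i, ∑ j, h i j ^ 2) - 4 * (∑ i, x i * w i) + 2 * (∑ i, x i ^ 2) * t
      + 2 * (∑ i, x i * ξ i) ^ 2 - 2 * c * (∑ i, h i i) + 4 * c * (∑ i, x i * ξ i) + c ^ 2 * N := by
    have e1 : ∀ i j, (h i j - x i * ξ j - ξ i * x j - c * (if i = j then 1 else 0)) ^ 2 =
        h i j ^ 2 - 2 * (x i * (h i j * ξ j)) - 2 * (x j * (h j i * ξ i)) + x i ^ 2 * ξ j ^ 2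
        + x j ^ 2 * ξ i ^ 2 + 2 * ((x i * ξ i) * (x j * ξ j))
        + (if i = j then -2 * c * h i j + 4 * c * (x i * ξ j) + c ^ 2 else 0) := by
      intro i j
      rw [hs j i]
      split_ifs with hij
      · subst hij; ring
      · ring
    simp_rw [e1]
    simp only [Finset.sum_add_distrib, Finset.sum_sub_distrib, Finset.sum_ite_eq, Finset.mem_univ,
      if_true, Finset.sum_const, Finset.card_univ, Fintype.card_fin, nsmul_eq_mul]
    have s1 : ∑ i, ∑ j, 2 * (x i * (h i j * ξ j)) = 2 * ∑ i, x i * w i := by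
      rw [Finset.mul_sum]
      refine Finset.sum_congr rfl fun i _ => ?_
      rw [hw, Finset.mul_sum, Finset.mul_sum]
    have s2 : ∑ i, ∑ j, 2 * (x j * (h j i * ξ i)) = 2 * ∑ i, x i * w i := by
      rw [Finset.sum_comm, s1]
    have s3 : ∑ i, ∑ j, x i ^ 2 * ξ j ^ 2 = (∑ i, x i ^ 2) * t := by
      rw [ht, Finset.sum_mul_sum]
    have s4 : ∑ i, ∑ j, x j ^ 2 * ξ i ^ 2 = (∑ i, x i ^ 2) * t := by
      rw [Finset.sum_comm, s3]
    have s5 : ∑ i, ∑ j, 2 * ((x i * ξ i) * (x j * ξ j)) = 2 * (∑ i, x i * ξ i) ^ 2 := by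
      rw [sq, Finset.sum_mul_sum, Finset.mul_sum]
      simp_rw [Finset.mul_sum]
    rw [s1, s2, s3, s4, s5, ← Finset.mul_sum, ← Finset.mul_sum]
    ring
  rw [exp, xξ, xw, xx] at key
  refine key.trans (le_of_eq ?_)
  rw [hμ]
  field_simp
  ring

lemma young_ptw {χ ζ x y c : ℝ} (hχ : 0 ≤ χ) (hc : 0 < c) :
    -(χ * (c * ζ ^ 2 * x ^ 2 + y ^ 2 / c)) ≤ 2 * χ * (ζ * x * y) := by
  have h : 0 ≤ χ * c * (ζ * x + y / c) ^ 2 := by positivity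
  have e : χ * c * (ζ * x + y / c) ^ 2 =
      χ * (c * ζ ^ 2 * x ^ 2 + y ^ 2 / c) + 2 * χ * (ζ * x * y) := by field_simp; ring
  linarith

set_option maxHeartbeats 1000000 in
lemma ptw_main {N : ℕ} (hN : 1 ≤ N) {p α κ β q θ n : ℝ} (hp : 1 < p) (hθ : 0 < θ)
    (hβ : β = 2 * κ - α) (hn : n = 1 / N) :
    ∃ C : ℝ, 0 < C ∧ ∀ χ χ' ζ t v h2 a b L kw kξ K : ℝ, 0 ≤ χ → 0 ≤ χ' → 0 < t → 0 < v →
      (∀ c : ℝ, 0 ≤ h2 - 2 * a / t + b ^ 2 / t ^ 2 - 2 * c * (L - b / t) + c ^ 2 * (N - 1)) →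
      (kw - b / t * kξ) ^ 2 ≤ K ^ 2 * (a - b ^ 2 / t) → kξ ^ 2 ≤ K ^ 2 * t → 
      0 ≤ a - b ^ 2 / t → ∀ G z : ℝ, G = -(L + (p - 2) * b / t) → z = t / v →
      0 ≤ χ * ζ ^ 2 * (h2 + 2 * (p - 2) * a / t + (p - 2) ^ 2 * b ^ 2 / t ^ 2
            + 2 * κ * (p - 1) * b / v - G ^ 2 + (α - β * q) * G * z + β * q * (α - 1) * z ^ 2)
        + 2 * χ' * ζ ^ 2 * (a + (p - 2) * b ^ 2 / t + G * b + β * q * z * b)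
        + 2 * χ * ζ * (kw + ((p - 2) * b / t + G + β * q * z) * kξ)
        + χ * ζ ^ 2 * ((1 - n + θ) * G ^ 2 + (2 * κ * n - α + β * q) * G * z
            + (κ ^ 2 * (1 - n) - β * q * (α - 1) + θ) * z ^ 2)
        + C * (χ * (t * K ^ 2)) + C * (χ' * ζ ^ 2 * (t * (G ^ 2 + z ^ 2))) := by
  -- the constants
  set D : ℝ := (1 + (β * q) ^ 2) / (p - 1) with hD
  have hp1 : 0 < p - 1 := by linarith
  have hD0 : 0 < D := by positivity
  have hn0 : 0 < n := by rw [hn]; positivity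
  have hNn : (N : ℝ) * n = 1 := by rw [hn]; field_simp
  refine ⟨1 / (2 * (p - 1)) + 1 + (1 - n) ^ 2 / θ + (β * q - κ * (1 - n)) ^ 2 / θ + D, by positivity, ?_⟩
  intro χ χ' ζ t v h2 a b L kw kξ K hχ hχ' ht hv hcs hkw hkξ hτ G z hG hz
  -- normalised variables
  obtain ⟨B, rfl⟩ : ∃ B, b = t * B := ⟨b / t, by field_simp⟩
  obtain ⟨T2, rfl⟩ : ∃ T2, a = t * (T2 + B ^ 2) := ⟨a / t - B ^ 2, by field_simp; ring⟩
  obtain ⟨y, hy⟩ : ∃ y, y = (p - 1) * B := ⟨_, rfl⟩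
  have hT2 : 0 ≤ T2 := by
    have : t * (T2 + B ^ 2) - (t * B) ^ 2 / t = t * T2 := by field_simp; ring
    rw [this] at hτ
    exact nonneg_of_mul_nonneg_right hτ ht
  have e1 : t * (T2 + B ^ 2) - (t * B) ^ 2 / t = t * T2 := by field_simp; ring
  have e2 : t * B / t = B := by field_simp
  rw [e1] at hkw
  rw [e2] at hkw
  obtain ⟨ko, hko⟩ : ∃ ko, ko = kw - B * kξ := ⟨_, rfl⟩
  rw [← hko] at hkw
  have hkw' : kw = ko + B * kξ := by linarith
  have hG' : G = -(L + (p - 2) * B) := by rw [hG]; congr 2; field_simp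
  -- first bracket
  have f1 : h2 + 2 * (p - 2) * (t * (T2 + B ^ 2)) / t + (p - 2) ^ 2 * (t * B) ^ 2 / t ^ 2
            + 2 * κ * (p - 1) * (t * B) / v =
      h2 + 2 * (p - 2) * (T2 + B ^ 2) + (p - 2) ^ 2 * B ^ 2 + 2 * κ * y * z := by
    rw [hz, hy]; field_simp
  have hcs' : ∀ c : ℝ, 0 ≤ h2 - 2 * (T2 + B ^ 2) + B ^ 2 - 2 * c * (L - B) + c ^ 2 * (N - 1) := by
    intro c
    refine (hcs c).trans (le_of_eq ?_)
    field_simp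
  set Y := y + κ * z with hY
  set E := G - κ * z with hE
  have hl : L - B = -(E + Y) := by rw [hE, hY, hG', hy]; ring
  have hQ : 2 * (p - 1) * T2 + (Y + n * E) ^ 2 + n * E ^ 2 ≤
      h2 + 2 * (p - 2) * (T2 + B ^ 2) + (p - 2) ^ 2 * B ^ 2 + 2 * κ * y * z + κ ^ 2 * z ^ 2 := by
    have := hcs' (-(n * E))
    rw [hl] at this
    have e3 : (-(n * E)) ^ 2 * ((N : ℝ) - 1) = n * E ^ 2 * (N * n) - n ^ 2 * E ^ 2 := by ring
    rw [e3, hNn] at this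
    have e4 : Y ^ 2 = (p - 1) ^ 2 * B ^ 2 + 2 * κ * y * z + κ ^ 2 * z ^ 2 := by rw [hY, hy]; ring
    have e5 : (Y + n * E) ^ 2 = Y ^ 2 + 2 * n * E * Y + n ^ 2 * E ^ 2 := by ring
    have e6 : h2 + 2 * (p - 2) * (T2 + B ^ 2) + (p - 2) ^ 2 * B ^ 2 =
      h2 - 2 * (T2 + B ^ 2) + B ^ 2 + 2 * (p - 1) * T2 + (p - 1) ^ 2 * B ^ 2 := by ring
    have e7 : 2 * -(n * E) * -(E + Y) = 2 * n * E ^ 2 + 2 * n * E * Y := by ring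
    rw [e7] at this
    rw [e5, e6]
    linarith
  set U := Y + n * E with hU
  -- second bracket
  have f2 : t * (T2 + B ^ 2) + (p - 2) * (t * B) ^ 2 / t + G * (t * B) + β * q * z * (t * B) =
      t * (T2 + (p - 1) * B ^ 2 + (G + β * q * z) * B) := by field_simp; ring
  have g2 : -(D * (G ^ 2 + z ^ 2)) ≤ 2 * (T2 + (p - 1) * B ^ 2 + (G + β * q * z) * B) := by
    have s1 : 0 ≤ (2 / (p - 1)) * ((p - 1) * B + (G + β * q * z) / 2) ^ 2 := by positivity
    have s2 : (2 / (p - 1)) * ((p - 1) * B + (G + β * q * z) / 2) ^ 2 =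
      2 * (p - 1) * B ^ 2 + 2 * (G + β * q * z) * B + (G + β * q * z) ^ 2 / (2 * (p - 1)) := by
      field_simp; ring
    have s3 : (G + β * q * z) ^ 2 ≤ 2 * (1 + (β * q) ^ 2) * (G ^ 2 + z ^ 2) := by
      nlinarith [sq_nonneg (G - β * q * z), sq_nonneg z, sq_nonneg (β * q * G)]
    have s4 : (G + β * q * z) ^ 2 / (2 * (p - 1)) ≤ D * (G ^ 2 + z ^ 2) := by
      rw [hD, div_mul_eq_mul_div, div_le_div_iff₀ (by positivity) hp1]
      nlinarith
    linarith
  have g2' : -(D * (χ' * ζ ^ 2 * (t * (G ^ 2 + z ^ 2)))) ≤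
      2 * χ' * ζ ^ 2 * (t * (T2 + (p - 1) * B ^ 2 + (G + β * q * z) * B)) := by
    have := mul_le_mul_of_nonneg_left g2 (show 0 ≤ χ' * ζ ^ 2 * t by positivity)
    linarith
  -- third bracket
  have f3 : kw + ((p - 2) * (t * B) / t + G + β * q * z) * kξ =
      ko + (U + (1 - n) * G + (β * q - κ * (1 - n)) * z) * kξ := by
    rw [hkw', hU, hY, hE, hy]; field_simp; ring
  have y1 : -(χ * (ζ ^ 2 * (2 * (p - 1) * T2) + t * K ^ 2 / (2 * (p - 1)))) ≤ 2 * χ * (ζ * ko) := by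
    have hab : |ko| ≤ Real.sqrt (T2) * (Real.sqrt t * |K|) := by
      rw [← Real.sqrt_sq_eq_abs, ← Real.sqrt_sq_eq_abs, ← Real.sqrt_mul ht.le,
        ← Real.sqrt_mul hT2]
      apply Real.sqrt_le_sqrt
      linarith
    have h1 := young_ptw (χ := χ) (ζ := -|ζ|) (x := Real.sqrt T2) (y := Real.sqrt t * |K|)
      (c := 2 * (p - 1)) hχ (by positivity)
    have h2' : (Real.sqrt T2) ^ 2 = T2 := Real.sq_sqrt hT2
    have h3' : (Real.sqrt t * |K|) ^ 2 = t * K ^ 2 := by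
      rw [mul_pow, Real.sq_sqrt ht.le, sq_abs]
    rw [h2', h3', neg_sq, sq_abs] at h1
    have h4 : -(|ζ| * (Real.sqrt T2 * (Real.sqrt t * |K|))) ≤ ζ * ko := by
      have : -(|ζ| * |ko|) ≤ ζ * ko := by rw [← abs_mul]; exact neg_abs_le _
      have := mul_le_mul_of_nonneg_left hab (abs_nonneg ζ)
      linarith
    have h5 := mul_le_mul_of_nonneg_left h4 (show 0 ≤ 2 * χ by positivity)
    refine le_trans ?_ (h1.trans (le_trans (le_of_eq ?_) h5))
    · apply le_of_eq; ring
    · ring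
  have hkξ' : χ * kξ ^ 2 ≤ χ * (t * K ^ 2) := by
    apply mul_le_mul_of_nonneg_left _ hχ; linarith
  have y2 : -(χ * (ζ ^ 2 * U ^ 2) + χ * (t * K ^ 2)) ≤ 2 * χ * (ζ * U * kξ) := by
    have := young_ptw (χ := χ) (ζ := ζ) (x := U) (y := kξ) (c := 1) hχ one_pos
    linarith
  have y3 : -(χ * ζ ^ 2 * (θ * G ^ 2) + (1 - n) ^ 2 / θ * (χ * (t * K ^ 2))) ≤
      2 * χ * (ζ * G * ((1 - n) * kξ)) := by
    have := young_ptw (χ := χ) (ζ := ζ) (x := G) (y := (1 - n) * kξ) (c := θ) hχ hθ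
    have h6 := mul_le_mul_of_nonneg_left hkξ' (show 0 ≤ (1 - n) ^ 2 / θ by positivity)
    refine le_trans ?_ this
    have : χ * (θ * ζ ^ 2 * G ^ 2 + ((1 - n) * kξ) ^ 2 / θ) =
      χ * ζ ^ 2 * (θ * G ^ 2) + (1 - n) ^ 2 / θ * (χ * kξ ^ 2) := by ring
    linarith
  have y4 : -(χ * ζ ^ 2 * (θ * z ^ 2) + (β * q - κ * (1 - n)) ^ 2 / θ * (χ * (t * K ^ 2))) ≤
      2 * χ * (ζ * z * ((β * q - κ * (1 - n)) * kξ)) := by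
    have := young_ptw (χ := χ) (ζ := ζ) (x := z) (y := (β * q - κ * (1 - n)) * kξ) (c := θ) hχ hθ
    have h6 := mul_le_mul_of_nonneg_left hkξ' (show 0 ≤ (β * q - κ * (1 - n)) ^ 2 / θ by positivity)
    refine le_trans ?_ this
    have : χ * (θ * ζ ^ 2 * z ^ 2 + ((β * q - κ * (1 - n)) * kξ) ^ 2 / θ) =
      χ * ζ ^ 2 * (θ * z ^ 2) + (β * q - κ * (1 - n)) ^ 2 / θ * (χ * kξ ^ 2) := by ring
    linarith
  rw [f1, f2, f3]
  have hQ' := mul_le_mul_of_nonneg_left hQ (show 0 ≤ χ * ζ ^ 2 by positivity)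
  -- nonneg leftovers
  have r1 : 0 ≤ D * (χ * (t * K ^ 2)) := by positivity
  have r2 : 0 ≤ (1 / (2 * (p - 1)) + 1 + (1 - n) ^ 2 / θ + (β * q - κ * (1 - n)) ^ 2 / θ) *
    (χ' * ζ ^ 2 * (t * (G ^ 2 + z ^ 2))) := by positivity
  have hEE : n * E ^ 2 = n * G ^ 2 - 2 * κ * n * G * z + n * κ ^ 2 * z ^ 2 := by rw [hE]; ring
  rw [hEE] at hQ'
  have y1' : -(χ * ζ ^ 2 * (2 * (p - 1) * T2) + 1 / (2 * (p - 1)) * (χ * (t * K ^ 2))) ≤ 2 * χ * (ζ * ko) := by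
    refine le_trans (le_of_eq ?_) y1
    ring
  have final : 0 ≤ (χ * ζ ^ 2 * (h2 + 2 * (p - 2) * (T2 + B ^ 2) + (p - 2) ^ 2 * B ^ 2 + 2 * κ * y * z + κ ^ 2 * z ^ 2)
      - χ * ζ ^ 2 * (2 * (p - 1) * T2 + U ^ 2 + (n * G ^ 2 - 2 * κ * n * G * z + n * κ ^ 2 * z ^ 2)))
      + (2 * χ' * ζ ^ 2 * (t * (T2 + (p - 1) * B ^ 2 + (G + β * q * z) * B)) + D * (χ' * ζ ^ 2 * (t * (G ^ 2 + z ^ 2))))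
      + (2 * χ * (ζ * ko) + (χ * ζ ^ 2 * (2 * (p - 1) * T2) + 1 / (2 * (p - 1)) * (χ * (t * K ^ 2))))
      + (2 * χ * (ζ * U * kξ) + (χ * (ζ ^ 2 * U ^ 2) + χ * (t * K ^ 2)))
      + (2 * χ * (ζ * G * ((1 - n) * kξ)) + (χ * ζ ^ 2 * (θ * G ^ 2) + (1 - n) ^ 2 / θ * (χ * (t * K ^ 2))))
      + (2 * χ * (ζ * z * ((β * q - κ * (1 - n)) * kξ)) + (χ * ζ ^ 2 * (θ * z ^ 2) + (β * q - κ * (1 - n)) ^ 2 / θ * (χ * (t * K ^ 2))))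
      + D * (χ * (t * K ^ 2)) + (1 / (2 * (p - 1)) + 1 + (1 - n) ^ 2 / θ + (β * q - κ * (1 - n)) ^ 2 / θ) *
    (χ' * ζ ^ 2 * (t * (G ^ 2 + z ^ 2))) := by linarith
  refine final.trans (le_of_eq ?_)
  ring

end ptw


section pd
variable {N : ℕ}

noncomputable def pd (i : Fin N) (f : EE N → ℝ) (x : EE N) : ℝ :=
  fderiv ℝ f x (EuclideanSpace.single i 1)

lemma pd_grad (i : Fin N) (f : EE N → ℝ) (x : EE N) : gradient f x i = pd i f x := by
  rw [pd, ← grad_apply, real_inner_comm, EuclideanSpace.inner_single_left]; simp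

lemma inner_coord (a b : EE N) : ⟪a, b⟫ = ∑ i, a i * b i := by
  rw [PiLp.inner_apply]
  exact Finset.sum_congr rfl fun i _ => by simp [mul_comm]

lemma normsq_sum (a : EE N) : ‖a‖ ^ 2 = ∑ i, a i ^ 2 := by
  rw [EuclideanSpace.norm_sq_eq]; simp

lemma pd_mul (i : Fin N) {f g : EE N → ℝ} {x : EE N} (hf : DifferentiableAt ℝ f x)
    (hg : DifferentiableAt ℝ g x) :
    pd i (fun y => f y * g y) x = pd i f x * g x + f x * pd i g x := by
  unfold pd
  rw [fderiv_fun_mul hf hg]; simp; ring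

lemma pd_sub (i : Fin N) {f g : EE N → ℝ} {x : EE N} (hf : DifferentiableAt ℝ f x)
    (hg : DifferentiableAt ℝ g x) :
    pd i (fun y => f y - g y) x = pd i f x - pd i g x := by
  unfold pd
  rw [fderiv_fun_sub hf hg]; simp

lemma pd_add (i : Fin N) {f g : EE N → ℝ} {x : EE N} (hf : DifferentiableAt ℝ f x)
    (hg : DifferentiableAt ℝ g x) :
    pd i (fun y => f y + g y) x = pd i f x + pd i g x := by
  unfold pd
  rw [fderiv_fun_add hf hg]; simp

lemma pd_sum (i : Fin N) {ι : Type*} (s : Finset ι) {f : ι → EE N → ℝ} {x : EE N}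
    (hf : ∀ j ∈ s, DifferentiableAt ℝ (f j) x) :
    pd i (fun y => ∑ j ∈ s, f j y) x = ∑ j ∈ s, pd i (f j) x := by
  unfold pd
  rw [fderiv_fun_sum hf]; simp

lemma pd_comp (i : Fin N) {h : ℝ → ℝ} {h' : ℝ} {f : EE N → ℝ} {x : EE N}
    (hh : HasDerivAt h h' (f x)) (hf : DifferentiableAt ℝ f x) :
    pd i (fun y => h (f y)) x = h' * pd i f x := by
  have := (hh.comp_hasFDerivAt x hf.hasFDerivAt).fderiv
  unfold Function.comp at this
  rw [pd, this]; simp [pd]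

lemma pd_contDiff (i : Fin N) {f : EE N → ℝ} {m n : ℕ∞} (hf : ContDiff ℝ n f) (hmn : m + 1 ≤ n) :
    ContDiff ℝ m (pd i f) := by
  have : ContDiff ℝ m (fderiv ℝ f) := hf.fderiv_right (by exact_mod_cast hmn)
  exact this.clm_apply contDiff_const

lemma pd_comm (i j : Fin N) {f : EE N → ℝ} (hf : ContDiff ℝ 2 f) (x : EE N) :
    pd i (pd j f) x = pd j (pd i f) x := by
  have hd : DifferentiableAt ℝ (fderiv ℝ f) x :=
    ((hf.fderiv_right (m := 1) (by norm_num)).differentiable (by norm_num)) x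
  have key : ∀ k l : Fin N, pd k (pd l f) x =
      fderiv ℝ (fderiv ℝ f) x (EuclideanSpace.single k 1) (EuclideanSpace.single l 1) := by
    intro k l
    have : HasFDerivAt (pd l f) ((fderiv ℝ (fderiv ℝ f) x).flip (EuclideanSpace.single l 1)) x := by
      have := hd.hasFDerivAt.clm_apply (hasFDerivAt_const (EuclideanSpace.single l (1:ℝ)) x)
      refine (this.congr_fderiv ?_)
      ext; simp
    unfold pd at this ⊢
    rw [this.fderiv]; simp
  rw [key, key]
  exact (hf.contDiffAt.isSymmSndFDerivAt (by simp)) _ _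

lemma pd_tsupport (i : Fin N) {f : EE N → ℝ} (hf : HasCompactSupport f) :
    HasCompactSupport (pd i f) := by
  refine HasCompactSupport.intro hf (fun x hx => ?_)
  rw [← pd_grad, grad_tsupport f hx]; rfl

/-- pointwise divergence identity -/
lemma div_ptw {W : Fin N → EE N → ℝ} (hW : ∀ i, ContDiff ℝ 2 (W i)) {Ψ : EE N → ℝ}
    (hΨ : ContDiff ℝ 1 Ψ) (x : EE N) :
    ∑ i, pd i (fun y => Ψ y * ∑ j, (pd j (W i) y * W j y - pd j (W j) y * W i y)) x =
    Ψ x * (∑ i, ∑ j, pd j (W i) x * pd i (W j) x - (∑ i, pd i (W i) x) ^ 2)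
     + ∑ i, pd i Ψ x * (∑ j, pd j (W i) x * W j x - (∑ j, pd j (W j) x) * W i x) := by
  have d1 : ∀ i j, DifferentiableAt ℝ (pd j (W i)) x := fun i j =>
    ((pd_contDiff (n := 2) (m := 1) j (hW i) (by norm_num)).differentiable (by norm_num)) x
  have d0 : ∀ i, DifferentiableAt ℝ (W i) x := fun i => (hW i).differentiable (by norm_num) x
  have dΨ : DifferentiableAt ℝ Ψ x := hΨ.differentiable (by norm_num) x
  have dd : ∀ i j, DifferentiableAt ℝ (fun y => pd j (W i) y * W j y - pd j (W j) y * W i y) x :=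
    fun i j => ((d1 i j).mul (d0 j)).sub ((d1 j j).mul (d0 i))
  have e1 : ∀ i, pd i (fun y => Ψ y * ∑ j, (pd j (W i) y * W j y - pd j (W j) y * W i y)) x =
      pd i Ψ x * (∑ j, pd j (W i) x * W j x - (∑ j, pd j (W j) x) * W i x) +
      Ψ x * ∑ j, ((pd i (pd j (W i)) x * W j x - pd i (pd j (W j)) x * W i x) +
        (pd j (W i) x * pd i (W j) x - pd j (W j) x * pd i (W i) x)) := by
    intro i
    rw [pd_mul i dΨ (by
      have := DifferentiableAt.fun_sum (u := Finset.univ) (fun j _ => dd i j)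
      exact this), pd_sum i _ (fun j _ => dd i j)]
    congr 1
    · rw [Finset.sum_sub_distrib, Finset.sum_mul]
    · congr 1
      refine Finset.sum_congr rfl fun j _ => ?_
      rw [pd_sub i ((d1 i j).fun_mul (d0 j)) ((d1 j j).fun_mul (d0 i)), pd_mul i (d1 i j) (d0 j),
        pd_mul i (d1 j j) (d0 i)]
      ring
  simp_rw [e1]
  rw [Finset.sum_add_distrib, ← Finset.mul_sum, add_comm]
  congr 2
  simp_rw [Finset.sum_add_distrib, Finset.sum_sub_distrib]
  have c1 : ∑ i, ∑ j, pd i (pd j (W i)) x * W j x = ∑ i, ∑ j, pd i (pd j (W j)) x * W i x := by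
    rw [Finset.sum_comm]
    refine Finset.sum_congr rfl fun i _ => Finset.sum_congr rfl fun j _ => ?_
    rw [pd_comm j i (hW j)]
  rw [c1, sub_self, zero_add, sq, Finset.sum_mul_sum, Finset.sum_comm (f := fun i j => pd i (W i) x * pd j (W j) x)]

/-- the integrated identity -/
lemma div_int {W : Fin N → EE N → ℝ} (hW : ∀ i, ContDiff ℝ 2 (W i)) {Ψ Q : EE N → ℝ}
    (hΨ : ContDiff ℝ 1 Ψ) (hc : HasCompactSupport Ψ) (hQ : ContDiff ℝ 1 Q)
    (hQc : HasCompactSupport Q) (k : ℝ) :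
    Integrable (fun x => Ψ x * (∑ i, ∑ j, pd j (W i) x * pd i (W j) x - (∑ i, pd i (W i) x) ^ 2)
     + ∑ i, pd i Ψ x * (∑ j, pd j (W i) x * W j x - (∑ j, pd j (W j) x) * W i x)
     + k * (∑ i, pd i Q x * W i x + Q x * ∑ i, pd i (W i) x)) ∧ 
    ∫ x, (Ψ x * (∑ i, ∑ j, pd j (W i) x * pd i (W j) x - (∑ i, pd i (W i) x) ^ 2)
     + ∑ i, pd i Ψ x * (∑ j, pd j (W i) x * W j x - (∑ j, pd j (W j) x) * W i x)
     + k * (∑ i, pd i Q x * W i x + Q x * ∑ i, pd i (W i) x)) = 0 := by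
  have c1 : ∀ i j, ContDiff ℝ 1 (pd j (W i)) := fun i j =>
    (pd_contDiff (n := 2) (m := 1) j (hW i) (by norm_num))
  have c0 : ∀ i, ContDiff ℝ 1 (W i) := fun i => (hW i).of_le (by norm_num)
  set F : Fin N → EE N → ℝ := fun i y =>
    Ψ y * ∑ j, (pd j (W i) y * W j y - pd j (W j) y * W i y) + k * (Q y * W i y) with hF
  have cF1 : ∀ i, ContDiff ℝ 1 (fun y => Ψ y * ∑ j, (pd j (W i) y * W j y - pd j (W j) y * W i y)) :=
    fun i => hΨ.mul (ContDiff.sum fun j _ => ((c1 i j).mul (c0 j)).sub ((c1 j j).mul (c0 i)))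
  have cF2 : ∀ i, ContDiff ℝ 1 (fun y => k * (Q y * W i y)) := fun i =>
    contDiff_const.mul (hQ.mul (c0 i))
  have cF : ∀ i, ContDiff ℝ 1 (F i) := fun i => (cF1 i).add (cF2 i)
  have hFc : ∀ i, HasCompactSupport (F i) := fun i =>
    (hc.mul_right).add ((hQc.mul_right).mul_left)
  have e : ∀ x, Ψ x * (∑ i, ∑ j, pd j (W i) x * pd i (W j) x - (∑ i, pd i (W i) x) ^ 2)
     + ∑ i, pd i Ψ x * (∑ j, pd j (W i) x * W j x - (∑ j, pd j (W j) x) * W i x)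
     + k * (∑ i, pd i Q x * W i x + Q x * ∑ i, pd i (W i) x) = ∑ i, pd i (F i) x := by
    intro x
    rw [← div_ptw hW hΨ]
    rw [Finset.mul_sum, ← Finset.sum_add_distrib, Finset.mul_sum, ← Finset.sum_add_distrib]
    refine Finset.sum_congr rfl fun i _ => ?_
    have : pd i (F i) x = pd i (fun y => Ψ y * ∑ j, (pd j (W i) y * W j y - pd j (W j) y * W i y)) x
        + pd i (fun y => k * (Q y * W i y)) x := by
      exact pd_add i ((cF1 i).differentiable (by norm_num) x) ((cF2 i).differentiable (by norm_num) x)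
    rw [this, pd_mul i (by fun_prop) ((hQ.mul (c0 i)).differentiable (by norm_num) x),
      pd_mul i (hQ.differentiable (by norm_num) x) ((c0 i).differentiable (by norm_num) x)]
    have : pd i (fun _ : EE N => k) x = 0 := by simp [pd]
    rw [this]; ring
  simp_rw [e]
  have hi : ∀ i ∈ Finset.univ, Integrable (fun x => pd i (F i) x) := by
    intro i _
    exact int_cc ((pd_contDiff (m := 0) (n := 1) i (cF i) (by norm_num)).continuous) _ (hFc i) (fun x hx => by rw [← pd_grad, grad_tsupport _ hx]; rfl)
  refine ⟨integrable_finset_sum _ hi, ?_⟩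
  rw [integral_finset_sum _ hi]
  refine Finset.sum_eq_zero fun i _ => ?_
  exact integral_fderiv_zero (cF i) (hFc i)

end pd


section boch
variable {N : ℕ}

lemma sum_lin (w V k : Fin N → ℝ) (c1 c2 c3 e1 e2 : ℝ) :
    ∑ i, (c1 * w i + c2 * V i + c3 * k i) * (e1 * w i + e2 * V i) =
    c1 * e1 * ∑ i, w i ^ 2 + (c1 * e2 + c2 * e1) * ∑ i, w i * V i + c2 * e2 * ∑ i, V i ^ 2
    + c3 * e1 * ∑ i, k i * w i + c3 * e2 * ∑ i, k i * V i := by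
  simp only [Finset.mul_sum, ← Finset.sum_add_distrib]
  exact Finset.sum_congr rfl fun i _ => by ring

lemma cs_fin (w V : Fin N → ℝ) : (∑ i, w i * V i) ^ 2 ≤ (∑ i, w i ^ 2) * ∑ i, V i ^ 2 :=
  Finset.sum_mul_sq_le_sq_mul_sq _ _ _

/-- finite dimensional algebra behind the Bochner identity -/
lemma boch_alg (h : Fin N → Fin N → ℝ) (hs : ∀ i j, h i j = h j i) (V w k : Fin N → ℝ)
    (hw : ∀ i, w i = ∑ j, h i j * V j) {p α κ β q v t ω χ χ' ζ va S : ℝ}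
    (ht : t = ∑ i, V i ^ 2) (ht0 : 0 < t) (hv : 0 < v) (hβ : β = 2 * κ - α)
    (hq : q * p = p - 1)
    (A : Fin N → Fin N → ℝ) (hA : ∀ i j, A i j = ω * (h i j + (p - 2) / t * (w j * V i)))
    (dΨ dQ : Fin N → ℝ) (hS : S = ω * t)
    (hdΨ : ∀ i, dΨ i = (2 * χ' * va * ζ ^ 2) * w i + (χ * (α * va / v) * ζ ^ 2) * V i
      + (2 * χ * va * ζ) * k i)
    (hdQ : ∀ i, dQ i = dΨ i * (S / v) + (χ * va * ζ ^ 2) * (p * ω * w i / v)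
       - (χ * va * ζ ^ 2) * (S * V i / v ^ 2))
    (G : ℝ) (hG : G = -((∑ i, h i i) + (p - 2) * (∑ i, w i * V i) / t)) :
    (χ * va * ζ ^ 2) * (∑ i, ∑ j, A i j * A j i - (∑ i, A i i) ^ 2)
     + ∑ i, dΨ i * (∑ j, A i j * (ω * V j) - (∑ j, A j j) * (ω * V i))
     + β * q * (∑ i, dQ i * (ω * V i) + (χ * va * ζ ^ 2 * S / v) * ∑ i, A i i) =
    ω ^ 2 * va * (χ * ζ ^ 2 * ((∑ i, ∑ j, h i j ^ 2) + 2 * (p - 2) * (∑ i, w i ^ 2) / t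
         + (p - 2) ^ 2 * (∑ i, w i * V i) ^ 2 / t ^ 2
            + 2 * κ * (p - 1) * (∑ i, w i * V i) / v - G ^ 2 + (α - β * q) * G * (t / v)
            + β * q * (α - 1) * (t / v) ^ 2)
        + 2 * χ' * ζ ^ 2 * ((∑ i, w i ^ 2) + (p - 2) * (∑ i, w i * V i) ^ 2 / t
          + G * (∑ i, w i * V i) + β * q * (t / v) * (∑ i, w i * V i))
        + 2 * χ * ζ * ((∑ i, k i * w i) + ((p - 2) * (∑ i, w i * V i) / t + G + β * q * (t / v))
           * (∑ i, k i * V i))) := by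
  set b := ∑ i, w i * V i with hb
  set a := ∑ i, w i ^ 2 with ha
  set L := ∑ i, h i i with hL
  set h2 := ∑ i, ∑ j, h i j ^ 2 with hh2
  obtain ⟨m, hm⟩ : ∃ m, m = (p - 2) / t := ⟨_, rfl⟩
  rw [← hm] at hA
  have s1 : ∑ i, ∑ j, A i j * A j i = ω ^ 2 * (h2 + 2 * m * a + m ^ 2 * b ^ 2) := by
    have e : ∀ i j, A i j * A j i = ω ^ 2 * h i j ^ 2 + ω ^ 2 * m * (w i * (h i j * V j)) +
        ω ^ 2 * m * (w j * (h j i * V i)) + ω ^ 2 * m ^ 2 * ((w i * V i) * (w j * V j)) := by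
      intro i j
      rw [hA, hA, hs j i]; ring
    simp_rw [e, Finset.sum_add_distrib, ← Finset.mul_sum]
    have e1 : ∑ i, w i * ∑ j, h i j * V j = a := by
      rw [ha]; exact Finset.sum_congr rfl fun i _ => by rw [← hw]; ring
    have e2 : ∑ i, ∑ j, w j * (h j i * V i) = a := by
      rw [Finset.sum_comm, ← e1]
      exact Finset.sum_congr rfl fun i _ => by rw [Finset.mul_sum]
    rw [e1, e2, ← Finset.sum_mul, ← hb]
    ring
  have s3 : ∑ i, A i i = -(ω * G) := by
    simp_rw [hA, ← Finset.mul_sum, Finset.sum_add_distrib, ← Finset.mul_sum]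
    rw [hG, hm, ← hb, ← hL]; ring
  have s2 : ∀ i, ∑ j, A i j * (ω * V j) = ω ^ 2 * (w i + m * b * V i) := by
    intro i
    have : ∀ j, A i j * (ω * V j) = ω ^ 2 * (h i j * V j) + (ω ^ 2 * m * V i) * (w j * V j) := by
      intro j; rw [hA]; ring
    simp_rw [this, Finset.sum_add_distrib, ← Finset.mul_sum]
    rw [← hw, ← hb]; ring
  have s4 : ∑ i, dΨ i * (∑ j, A i j * (ω * V j) - (∑ j, A j j) * (ω * V i)) = 
     ω ^ 2 * ∑ i, ((2 * χ' * va * ζ ^ 2) * w i + (χ * (α * va / v) * ζ ^ 2) * V i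
      + (2 * χ * va * ζ) * k i) * (1 * w i + (m * b + G) * V i) := by
    rw [Finset.mul_sum]
    refine Finset.sum_congr rfl fun i _ => ?_
    rw [s2, s3, hdΨ]; ring
  have s5 : ∑ i, dQ i * (ω * V i) = 
    ω * ∑ i, ((2 * χ' * va * ζ ^ 2 * (S / v) + χ * va * ζ ^ 2 * (p * ω / v)) * w i
      + (χ * (α * va / v) * ζ ^ 2 * (S / v) - χ * va * ζ ^ 2 * (S / v ^ 2)) * V i
      + (2 * χ * va * ζ * (S / v)) * k i) * (0 * w i + 1 * V i) := by
    rw [Finset.mul_sum]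
    refine Finset.sum_congr rfl fun i _ => ?_
    rw [hdQ, hdΨ]; ring
  rw [s1, s4, s5, s3, sum_lin, sum_lin, ← ha, ← hb, ← ht, hS]
  rw [hm]
  have hα : α = 2 * κ - β := by rw [hβ]; ring
  have hp1 : p = 1 + q * p := by linarith
  generalize (∑ i, k i * w i) = kw
  generalize (∑ i, k i * V i) = kξ
  clear_value a b L h2
  clear s1 s3 s2 s4 s5 hdΨ hdQ hA hw hs ht
  have key : χ * ζ ^ 2 * (α * (p - 1) + β * (q * p)) = χ * ζ ^ 2 * (2 * κ * (p - 1)) := by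
    rw [hq, hβ]; ring
  have key2 : ω ^ 2 * va * b / v * (χ * ζ ^ 2 * (α * (p - 1) + β * (q * p))) =
     ω ^ 2 * va * b / v * (χ * ζ ^ 2 * (2 * κ * (p - 1))) := by rw [key]
  rw [← sub_eq_zero] at key2 ⊢
  refine Eq.trans ?_ key2
  field_simp
  ring

end boch


section boch
variable {N : ℕ}

lemma nn_add {X Y : ℝ} (h : Y = 0) (h2 : 0 ≤ X + Y) : 0 ≤ X := by linarith

lemma T_eq (v : EE N → ℝ) : (fun y => ‖gradient v y‖ ^ 2) = fun y => ∑ j, pd j v y * pd j v y := by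
  funext y
  rw [normsq_sum]
  exact Finset.sum_congr rfl fun j _ => by rw [pd_grad, sq]

lemma T_contDiff {v : EE N → ℝ} (hv : ContDiff ℝ 3 v) : ContDiff ℝ 2 (fun y => ‖gradient v y‖ ^ 2) := by
  rw [T_eq]
  have : ∀ i, ContDiff ℝ 2 (pd i v) := fun i => pd_contDiff (m := 2) (n := 3) i hv (by norm_num)
  exact ContDiff.sum fun j _ => (this j).mul (this j)

/-- `-div (ω(|∇v|²) ∇v)` -/
noncomputable def gg (ω : ℝ → ℝ) (v : EE N → ℝ) (x : EE N) : ℝ :=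
  -∑ i, pd i (fun y => ω (‖gradient v y‖ ^ 2) * pd i v y) x

lemma W_contDiff {ω : ℝ → ℝ} (hω : ContDiff ℝ 2 ω) {v : EE N → ℝ} (hv : ContDiff ℝ 3 v) (i : Fin N) :
    ContDiff ℝ 2 (fun y => ω (‖gradient v y‖ ^ 2) * pd i v y) :=
  (hω.comp (T_contDiff hv)).mul (pd_contDiff (m := 2) (n := 3) i hv (by norm_num))

lemma gg_cont {ω : ℝ → ℝ} (hω : ContDiff ℝ 2 ω) {v : EE N → ℝ} (hv : ContDiff ℝ 3 v) :
    Continuous (gg ω v) := by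
  unfold gg
  exact (continuous_finset_sum _ fun i _ =>
    (pd_contDiff (m := 1) (n := 2) i (W_contDiff hω hv i) (by norm_num)).continuous).neg

set_option maxHeartbeats 1000000 in
lemma bochner (hN : 1 ≤ N) {p α κ β q θ n : ℝ} (hp : 1 < p) (hθ : 0 < θ)
    (hβ : β = 2 * κ - α) (hq : q * p = p - 1) (hn : n = 1 / N) :
    ∃ C : ℝ, 0 < C ∧ ∀ ω χ : ℝ → ℝ, ContDiff ℝ 2 ω → ContDiff ℝ 1 χ → (∀ t, 0 ≤ χ t) →
      (∀ t, 0 ≤ deriv χ t) →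
      (∀ t, (χ t = 0 ∧ deriv χ t = 0) ∨ (0 < t ∧ t * deriv ω t = (p - 2) / 2 * ω t)) →
      ∀ v ζ : EE N → ℝ, ContDiff ℝ 3 v → (∀ x, 0 < v x) → ContDiff ℝ 1 ζ → HasCompactSupport ζ →
      0 ≤ ∫ x, (χ (‖gradient v x‖ ^ 2) * ζ x ^ 2 * v x ^ α * ((1 - n + θ) * gg ω v x ^ 2 
            + (2 * κ * n - α + β * q) * gg ω v x * (ω (‖gradient v x‖ ^ 2) * ‖gradient v x‖ ^ 2 / v x)
            + (κ ^ 2 * (1 - n) - β * q * (α - 1) + θ)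
               * (ω (‖gradient v x‖ ^ 2) * ‖gradient v x‖ ^ 2 / v x) ^ 2)
        + C * (χ (‖gradient v x‖ ^ 2) * v x ^ α * ω (‖gradient v x‖ ^ 2) ^ 2 * ‖gradient v x‖ ^ 2 
            * ‖gradient ζ x‖ ^ 2)
        + C * (deriv χ (‖gradient v x‖ ^ 2) * ζ x ^ 2 * v x ^ α * ‖gradient v x‖ ^ 2 *
           (gg ω v x ^ 2 + (ω (‖gradient v x‖ ^ 2) * ‖gradient v x‖ ^ 2 / v x) ^ 2))) := by
  obtain ⟨C, hC, H⟩ := ptw_main (q := q) hN hp hθ hβ hn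
  refine ⟨C, hC, ?_⟩
  intro ω χ hω hχ hχ0 hχ'0 hcase v ζ hv hvpos hζ hζc
  set T : EE N → ℝ := fun y => ‖gradient v y‖ ^ 2 with hT
  have cT : ContDiff ℝ 2 T := T_contDiff hv
  have cP : ∀ i, ContDiff ℝ 2 (pd i v) := fun i => pd_contDiff (m := 2) (n := 3) i hv (by norm_num)
  set W : Fin N → EE N → ℝ := fun i y => ω (T y) * pd i v y with hW
  have cW : ∀ i, ContDiff ℝ 2 (W i) := fun i => W_contDiff hω hv i
  have cω : ContDiff ℝ 1 (fun y => ω (T y)) := (hω.comp cT).of_le (by norm_num)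
  have cva : ContDiff ℝ 1 (fun y => v y ^ α) :=
    (hv.of_le (by norm_num)).rpow_const_of_ne (fun x => (hvpos x).ne')
  have cχ : ContDiff ℝ 1 (fun y => χ (T y)) := hχ.comp (cT.of_le (by norm_num))
  set Ψ : EE N → ℝ := fun y => χ (T y) * v y ^ α * (ζ y * ζ y) with hΨ
  have cΨ : ContDiff ℝ 1 Ψ := (cχ.mul cva).mul (hζ.mul hζ)
  have hΨc : HasCompactSupport Ψ := (hζc.mul_left (f := ζ)).mul_left
  set R : EE N → ℝ := fun y => ω (T y) * T y * (v y)⁻¹ with hR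
  have cvi : ContDiff ℝ 1 (fun y => (v y)⁻¹) := (hv.of_le (by norm_num)).inv (fun x => (hvpos x).ne')
  have cT1 : ContDiff ℝ 1 T := cT.of_le (by norm_num)
  have cR : ContDiff ℝ 1 R := (cω.mul cT1).mul cvi
  set Q : EE N → ℝ := fun y => Ψ y * R y with hQ
  have cQ : ContDiff ℝ 1 Q := cΨ.mul cR
  have hQc : HasCompactSupport Q := hΨc.mul_right
  obtain ⟨hI, hI0⟩ := div_int cW cΨ hΨc cQ hQc (β * q)
  have hgc : Continuous (gg ω v) := gg_cont hω hv
  have cg : Continuous (gradient v) := grad_cont (hv.of_le (by norm_num))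
  have cgz : Continuous (gradient ζ) := grad_cont hζ
  have cω0 := cω.continuous
  have cχ0 := cχ.continuous
  have cva0 := cva.continuous
  have cv0 := hv.continuous
  have cT0 := cT.continuous
  have cζ0 := hζ.continuous
  have cdχ : Continuous (fun y => deriv χ (T y)) := (hχ.continuous_deriv (by norm_num)).comp cT0
  have cRR : Continuous R := cR.continuous
  refine nn_add hI0 ?_
  rw [← integral_add]
  rotate_left
  · have hre : ∀ x, ω (T x) * T x / v x = R x := fun x => by rw [hR]; simp only [div_eq_mul_inv]
    have : ∀ x, ω (‖gradient v x‖ ^ 2) * ‖gradient v x‖ ^ 2 / v x = R x := hre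
    simp_rw [this]
    refine int_cc ?_ _ hζc ?_
    · fun_prop
    · intro x hx
      rw [grad_tsupport ζ hx, image_eq_zero_of_notMem_tsupport hx]; simp
  · exact hI
  apply integral_nonneg
  intro x
  simp only [Pi.zero_apply]
  -- pointwise quantities
  have dP : ∀ i, DifferentiableAt ℝ (pd i v) x := fun i => (cP i).differentiable (by norm_num) x
  have dT : DifferentiableAt ℝ T x := cT.differentiable (by norm_num) x
  have dv : DifferentiableAt ℝ v x := hv.differentiable (by norm_num) x
  have dζ : DifferentiableAt ℝ ζ x := hζ.differentiable (by norm_num) x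
  have dω : DifferentiableAt ℝ (fun y => ω (T y)) x := cω.differentiable (by norm_num) x
  have dχ : DifferentiableAt ℝ (fun y => χ (T y)) x := cχ.differentiable (by norm_num) x
  have dva : DifferentiableAt ℝ (fun y => v y ^ α) x := cva.differentiable (by norm_num) x
  have dvi : DifferentiableAt ℝ (fun y => (v y)⁻¹) x := cvi.differentiable (by norm_num) x
  have hvx := hvpos x
  set h : Fin N → Fin N → ℝ := fun i j => pd j (pd i v) x with hh
  have hs : ∀ i j, h i j = h j i := fun i j => pd_comm j i (hv.of_le (by norm_num)) x
  set V : Fin N → ℝ := fun i => pd i v x with hV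
  set w : Fin N → ℝ := fun i => ∑ j, h i j * V j with hw
  have pT : ∀ i, pd i T x = 2 * w i := by
    intro i
    rw [hT, T_eq, pd_sum i _ (fun j _ => (dP j).fun_mul (dP j)), hw, Finset.mul_sum]
    refine Finset.sum_congr rfl fun j _ => ?_
    rw [pd_mul i (dP j) (dP j), hs i j]
    simp only [hh, hV]; ring
  have pχ : ∀ i, pd i (fun y => χ (T y)) x = deriv χ (T x) * (2 * w i) := fun i => by
    rw [pd_comp i (hχ.differentiable (by norm_num) _).hasDerivAt dT, pT]
  have pω : ∀ i, pd i (fun y => ω (T y)) x = deriv ω (T x) * (2 * w i) := fun i => by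
    rw [pd_comp i (hω.differentiable (by norm_num) _).hasDerivAt dT, pT]
  have pva : ∀ i, pd i (fun y => v y ^ α) x = α * v x ^ α / v x * V i := fun i => by
    rw [pd_comp i (h := fun s => s ^ α) (Real.hasDerivAt_rpow_const (Or.inl hvx.ne')) dv,
      Real.rpow_sub_one hvx.ne']
    ring
  have pvi : ∀ i, pd i (fun y => (v y)⁻¹) x = -(v x ^ 2)⁻¹ * V i := fun i => by
    rw [pd_comp i (h := fun s => s⁻¹) (hasDerivAt_inv hvx.ne') dv]
  have pΨ : ∀ i, pd i Ψ x = (2 * deriv χ (T x) * v x ^ α * ζ x ^ 2) * w i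
      + (χ (T x) * (α * v x ^ α / v x) * ζ x ^ 2) * V i
      + (2 * χ (T x) * v x ^ α * ζ x) * pd i ζ x := by
    intro i
    rw [hΨ, pd_mul i (dχ.fun_mul dva) (dζ.fun_mul dζ), pd_mul i dχ dva, pd_mul i dζ dζ, pχ, pva]
    ring
  have pR : ∀ i, pd i R x = (deriv ω (T x) * T x + ω (T x)) * (2 * w i) / v x
      - ω (T x) * T x * V i / v x ^ 2 := by
    intro i
    rw [hR, pd_mul i (dω.fun_mul dT) dvi, pd_mul i dω dT, pω, pT, pvi]
    field_simp
    ring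
  have pQ : ∀ i, pd i Q x = pd i Ψ x * R x + Ψ x * pd i R x := fun i =>
    pd_mul i (cΨ.differentiable (by norm_num) x) (cR.differentiable (by norm_num) x)
  have pW : ∀ i j, pd j (W i) x = deriv ω (T x) * (2 * w j) * V i + ω (T x) * h i j := by
    intro i j
    rw [hW, pd_mul j dω (dP i), pω]
  have hΨx : Ψ x = χ (T x) * v x ^ α * ζ x ^ 2 := by simp only [hΨ]; ring
  have hgg : gg ω v x = -∑ i, pd i (W i) x := rfl
  have hTx : ‖gradient v x‖ ^ 2 = T x := rfl
  rw [hTx]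
  rcases hcase (T x) with ⟨hz1, hz2⟩ | ⟨ht0, htω⟩
  · have z1 : ∀ i, pd i Ψ x = 0 := fun i => by rw [pΨ, hz1, hz2]; ring
    have z2 : Ψ x = 0 := by rw [hΨx, hz1]; ring
    have z3 : ∀ i, pd i Q x = 0 := fun i => by rw [pQ, z1, z2]; ring
    have z4 : Q x = 0 := by simp only [hQ, z2, zero_mul]
    simp [z1, z2, z3, z4, hz1, hz2]
  · obtain ⟨G, hG⟩ : ∃ G, G = -((∑ i, h i i) + (p - 2) * (∑ i, w i * V i) / T x) := ⟨_, rfl⟩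
    have hTV : T x = ∑ i, V i ^ 2 := by
      simp only [hT]; rw [normsq_sum]; simp_rw [pd_grad, hV]
    have hdω : deriv ω (T x) = (p - 2) / 2 * ω (T x) / T x := by
      rw [← htω]; field_simp
    have hA : ∀ i j, pd j (W i) x = ω (T x) * (h i j + (p - 2) / T x * (w j * V i)) := by
      intro i j
      rw [pW, hdω]; field_simp; ring
    have hRx : R x = ω (T x) * T x / v x := by simp only [hR, div_eq_mul_inv]
    have alg := boch_alg h hs V w (fun i => pd i ζ x) (fun i => rfl) (p := p) (α := α) (κ := κ) (β := β)
      (q := q) (v := v x) (t := T x) (ω := ω (T x)) (χ := χ (T x)) (χ' := deriv χ (T x)) (ζ := ζ x)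
      (va := v x ^ α) (S := ω (T x) * T x) hTV ht0 hvx hβ hq (fun i j => pd j (W i) x) hA
      (fun i => pd i Ψ x) (fun i => pd i Q x) rfl pΨ (by
        intro i
        rw [pQ, pR, hΨx, hRx, hdω]; field_simp; ring) G hG
    have hQx : Q x = χ (T x) * v x ^ α * ζ x ^ 2 * (ω (T x) * T x) / v x := by
      simp only [hQ]; rw [hΨx, hRx]; ring
    have hggx : gg ω v x = ω (T x) * G := by
      rw [hgg]
      simp_rw [hA, ← Finset.mul_sum, Finset.sum_add_distrib, ← Finset.mul_sum]
      rw [hG]; ring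
    have hWx : ∀ i, W i x = ω (T x) * V i := fun i => rfl
    rw [hΨx, hQx]
    simp_rw [hWx]
    rw [alg, hggx]
    have Hx := H (χ (T x)) (deriv χ (T x)) (ζ x) (T x) (v x) (∑ i, ∑ j, h i j ^ 2) (∑ i, w i ^ 2)
      (∑ i, w i * V i) (∑ i, h i i) (∑ i, pd i ζ x * w i) (∑ i, pd i ζ x * V i) ‖gradient ζ x‖
      (hχ0 _) (hχ'0 _) ht0 hvx (ptw_cs h hs V hTV ht0 w (fun i => rfl)) ?_ ?_ ?_ G (T x / v x) hG rfl
    · have m0 : 0 ≤ ω (T x) ^ 2 * v x ^ α := by positivity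
      have := mul_nonneg m0 Hx
      refine this.trans (le_of_eq ?_)
      ring
    · have e1 : (∑ i, pd i ζ x * w i) - (∑ i, w i * V i) / T x * (∑ i, pd i ζ x * V i) =
        ∑ i, pd i ζ x * (w i - (∑ i, w i * V i) / T x * V i) := by
        rw [Finset.mul_sum, ← Finset.sum_sub_distrib]
        exact Finset.sum_congr rfl fun i _ => by ring
      have e2 : (∑ i, w i ^ 2) - (∑ i, w i * V i) ^ 2 / T x =
          ∑ i, (w i - (∑ i, w i * V i) / T x * V i) ^ 2 := by
        have := sum_lin w V V 1 (-((∑ i, w i * V i) / T x)) 0 1 (-((∑ i, w i * V i) / T x))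
        rw [← hTV] at this
        rw [show ∑ i, (w i - (∑ i, w i * V i) / T x * V i) ^ 2 = _ from
          (Finset.sum_congr rfl fun i _ => by ring : _ = ∑ i, (1 * w i + (-((∑ i, w i * V i) / T x)) * V i + 0 * V i) *
            (1 * w i + (-((∑ i, w i * V i) / T x)) * V i)), this]
        field_simp
        ring
      have e3 : ‖gradient ζ x‖ ^ 2 = ∑ i, pd i ζ x ^ 2 := by
        rw [normsq_sum]; simp_rw [pd_grad]
      rw [e1, e2, e3]
      exact cs_fin _ _
    · have e3 : ‖gradient ζ x‖ ^ 2 = ∑ i, pd i ζ x ^ 2 := by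
        rw [normsq_sum]; simp_rw [pd_grad]
      rw [e3, hTV]
      exact cs_fin _ _
    · have := cs_fin w V
      rw [← hTV] at this
      rw [sub_nonneg, div_le_iff₀ ht0]
      exact this

end boch


section reg
variable {N : ℕ}

lemma lip_cpt {F : EE N → ℝ} (hF : ContDiff ℝ 1 F) {K : Set (EE N)} (hK : IsCompact K) :
    ∃ L : ℝ, 0 ≤ L ∧ ∀ x ∈ K, ∀ a : EE N, ‖a‖ ≤ 1 → |F (x + a) - F x| ≤ L * ‖a‖ := by
  have hK2 := hK.cthickening (r := 1)
  obtain ⟨C, hC⟩ := hK2.exists_bound_of_continuousOn (hF.continuous_fderiv (by norm_num)).continuousOn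
  refine ⟨max C 0, le_max_right _ _, ?_⟩
  intro x hx a ha
  have hsub : closedBall x 1 ⊆ cthickening 1 K := closedBall_subset_cthickening hx 1
  have := Convex.norm_image_sub_le_of_norm_fderiv_le (𝕜 := ℝ) (f := F) (C := max C 0)
    (s := closedBall x 1) (x := x) (y := x + a)
    (fun y _ => hF.differentiable (by norm_num) y)
    (fun y hy => (hC y (hsub hy)).trans (le_max_left _ _)) (convex_closedBall x 1)
    (mem_closedBall_self zero_le_one) (by simpa using ha)
  simpa using this

lemma osc_cpt {F : Type*} [NormedAddCommGroup F] {f : EE N → F} (hf : Continuous f)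
    {K : Set (EE N)} (hK : IsCompact K) {δ : ℝ} (hδ : 0 < δ) :
    ∃ a0 : ℝ, 0 < a0 ∧ a0 ≤ 1 ∧ ∀ x ∈ K, ∀ a : EE N, ‖a‖ ≤ a0 → ‖f (x + a) - f x‖ ≤ δ := by
  have hK2 := hK.cthickening (r := 1)
  have := hK2.uniformContinuousOn_of_continuous hf.continuousOn
  rw [Metric.uniformContinuousOn_iff] at this
  obtain ⟨d, hd, H⟩ := this δ hδ
  refine ⟨min 1 (d / 2), by positivity, min_le_left _ _, ?_⟩
  intro x hx a ha
  have h1 : ‖a‖ ≤ 1 := ha.trans (min_le_left _ _)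
  have h2 : ‖a‖ ≤ d / 2 := ha.trans (min_le_right _ _)
  rw [← dist_eq_norm]
  refine (H (x + a) (closedBall_subset_cthickening hx 1 (by simpa using h1)) x
    (self_subset_cthickening _ hx) ?_).le
  simp; linarith

set_option maxHeartbeats 800000 in
lemma dq_L2 {p lam r m : ℝ} (hp : 1 < p) (hl : 0 ≤ lam) (hm : 0 < m) {u : EE N → ℝ}
    (hu : ContDiff ℝ 1 u) (hpos : ∀ x, 0 < u x) (hsol : IsSol p lam r u) {ϑ : EE N → ℝ}
    (hϑ : ContDiff ℝ 1 ϑ) (hc : HasCompactSupport ϑ) (hsupp : tsupport ϑ ⊆ ball 0 r)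
    (hlow : ∀ x ∈ tsupport ϑ, m ≤ ‖gradient u x‖) :
    ∃ C a0 : ℝ, 0 ≤ C ∧ 0 < a0 ∧ ∀ a : EE N, ‖a‖ ≤ a0 →
      ∫ x, ϑ x ^ 2 * ‖gradient u (x + a) - gradient u x‖ ^ 2 ≤ C * ‖a‖ ^ 2 := by
  have hK : IsCompact (tsupport ϑ) := hc
  have hg := grad_cont hu
  obtain ⟨r', hr', hKr⟩ := exists_lt_subset_ball (isClosed_tsupport ϑ) hsupp
  obtain ⟨M, hM⟩ := (hK.cthickening (r := 1)).exists_bound_of_continuousOn hg.continuousOn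
  obtain ⟨a2, ha2, ha21, hosc⟩ := osc_cpt hg hK (δ := m / 2) (by positivity)
  obtain ⟨L, hL0, hL⟩ := lip_cpt hu hK
  have cf : ContDiff ℝ 1 (fun x => u x ^ lam) := hu.rpow_const_of_ne (fun x => (hpos x).ne')
  obtain ⟨L', hL'0, hL'⟩ := lip_cpt cf hK
  obtain ⟨c, C1, hc0, hC1, htp⟩ := Phi_two_point (N := N) (M := M) hp (show 0 < m / 2 by positivity)
  have cgϑ := grad_cont hϑ
  refine ⟨2 / c * (L' * L * (∫ x, ϑ x ^ 2) + 2 * C1 ^ 2 / c * L ^ 2 * ∫ x, ‖gradient ϑ x‖ ^ 2),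
    min a2 (r - r'), ?_, lt_min ha2 (by linarith), ?_⟩
  · have i1 : 0 ≤ ∫ x, ϑ x ^ 2 := integral_nonneg fun x => sq_nonneg _
    have i2 : 0 ≤ ∫ x, ‖gradient ϑ x‖ ^ 2 := integral_nonneg fun x => sq_nonneg _
    positivity
  intro a ha
  have ha1 : ‖a‖ ≤ a2 := ha.trans (min_le_left _ _)
  have ha3 : ‖a‖ ≤ r - r' := ha.trans (min_le_right _ _)
  set d : EE N → ℝ := fun x => u (x + a) - u x with hd
  have cua : ContDiff ℝ 1 (fun x => u (x + a)) := hu.comp (by fun_prop)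
  have cd : ContDiff ℝ 1 d := cua.sub hu
  set D : EE N → EE N := fun x => gradient u (x + a) - gradient u x with hD
  have cD : Continuous D := (hg.comp (by fun_prop)).sub hg
  set φ : EE N → ℝ := fun x => (ϑ x * ϑ x) * d x with hφ
  have cφ : ContDiff ℝ 1 φ := (hϑ.mul hϑ).mul cd
  have hφc : HasCompactSupport φ := (hc.mul_left (f := ϑ)).mul_right
  have gφ : ∀ x, gradient φ x = (ϑ x ^ 2) • D x + (2 * ϑ x * d x) • gradient ϑ x := by
    intro x
    have dϑ := hϑ.differentiable (by norm_num) x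
    rw [hφ, grad_mul (dϑ.fun_mul dϑ) (cd.differentiable (by norm_num) x), grad_mul dϑ dϑ]
    have : gradient d x = D x := by
      rw [hd, grad_sub (cua.differentiable (by norm_num) x) (hu.differentiable (by norm_num) x),
        grad_translate]
    rw [this]
    module
  have tφ : tsupport φ ⊆ tsupport ϑ := by
    apply closure_minimal _ (isClosed_tsupport ϑ)
    intro x hx
    apply subset_tsupport
    intro h0
    apply hx
    simp [hφ, h0]
  have eq := hsol.diff hp hl hu a cφ hφc (tφ.trans (hKr.trans (ball_subset_ball (by linarith))))
  set DV : EE N → EE N := fun x => Phi p (gradient u (x + a)) - Phi p (gradient u x) with hDV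
  have cDV : Continuous DV := ((Phi_cont hp).comp (hg.comp (by fun_prop))).sub ((Phi_cont hp).comp hg)
  have ptw : ∀ x, c / 2 * (ϑ x ^ 2 * ‖D x‖ ^ 2) ≤ ⟪DV x, gradient φ x⟫
      + 2 * C1 ^ 2 / c * (L ^ 2 * ‖a‖ ^ 2) * ‖gradient ϑ x‖ ^ 2 := by
    intro x
    by_cases hx : x ∈ tsupport ϑ
    swap
    · rw [gφ, image_eq_zero_of_notMem_tsupport hx, grad_tsupport ϑ hx]; simp
    have h1 := hosc x hx a ha1
    have h2 := hlow x hx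
    have h3 : m / 2 ≤ ‖gradient u (x + a)‖ := by
      have := norm_sub_norm_le (gradient u x) (gradient u (x + a))
      rw [norm_sub_rev] at this; linarith
    have hxa : x + a ∈ cthickening 1 (tsupport ϑ) :=
      closedBall_subset_cthickening hx 1 (by simpa using ha1.trans ha21)
    obtain ⟨t1, t2⟩ := htp (gradient u (x + a)) (gradient u x) h3 (hM _ hxa) (by linarith)
      (hM _ (self_subset_cthickening _ hx))
    change c * ‖D x‖ ^ 2 ≤ ⟪DV x, D x⟫ at t1
    change ‖DV x‖ ≤ C1 * ‖D x‖ at t2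
    have hdx : |d x| ≤ L * ‖a‖ := hL x hx a (ha1.trans ha21)
    rw [gφ, inner_add_right, inner_smul_right, inner_smul_right]
    have k1 : |⟪DV x, gradient ϑ x⟫| ≤ C1 * ‖D x‖ * ‖gradient ϑ x‖ :=
      (abs_real_inner_le_norm _ _).trans (by gcongr)
    have k2 : -(2 * (|ϑ x| * ‖D x‖) * (C1 * (L * ‖a‖) * ‖gradient ϑ x‖)) ≤
        2 * ϑ x * d x * ⟪DV x, gradient ϑ x⟫ := by
      have : |2 * ϑ x * d x * ⟪DV x, gradient ϑ x⟫| ≤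
          2 * |ϑ x| * (L * ‖a‖) * (C1 * ‖D x‖ * ‖gradient ϑ x‖) := by
        rw [abs_mul, abs_mul, abs_mul, abs_two]
        gcongr
      have := neg_abs_le (2 * ϑ x * d x * ⟪DV x, gradient ϑ x⟫)
      linarith
    have k3 : 2 * (|ϑ x| * ‖D x‖) * (C1 * (L * ‖a‖) * ‖gradient ϑ x‖) ≤
        c / 2 * (ϑ x ^ 2 * ‖D x‖ ^ 2) + 2 * C1 ^ 2 / c * (L ^ 2 * ‖a‖ ^ 2) * ‖gradient ϑ x‖ ^ 2 := by
      have s : 0 ≤ c / 2 * (|ϑ x| * ‖D x‖ - 2 / c * (C1 * (L * ‖a‖) * ‖gradient ϑ x‖)) ^ 2 := by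
        positivity
      have e : c / 2 * (|ϑ x| * ‖D x‖ - 2 / c * (C1 * (L * ‖a‖) * ‖gradient ϑ x‖)) ^ 2 =
        c / 2 * (|ϑ x| ^ 2 * ‖D x‖ ^ 2) + 2 * C1 ^ 2 / c * (L ^ 2 * ‖a‖ ^ 2) * ‖gradient ϑ x‖ ^ 2 
          - 2 * (|ϑ x| * ‖D x‖) * (C1 * (L * ‖a‖) * ‖gradient ϑ x‖) := by field_simp; ring
      rw [sq_abs] at e
      linarith
    have k4 := mul_le_mul_of_nonneg_left t1 (sq_nonneg (ϑ x))
    linarith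
  have i0 : Integrable fun x => ϑ x ^ 2 * ‖D x‖ ^ 2 := by
    refine int_cc ?_ _ hK ?_
    · have := hϑ.continuous; fun_prop
    · intro x hx; rw [image_eq_zero_of_notMem_tsupport hx]; simp
  have i1 : Integrable fun x => ⟪DV x, gradient φ x⟫ := by
    have := grad_cont cφ
    refine int_cc (by fun_prop) _ hφc ?_
    intro x hx; rw [grad_tsupport φ hx]; simp
  have i2 : Integrable fun x => ‖gradient ϑ x‖ ^ 2 := by
    refine int_cc (by fun_prop) _ hK ?_
    intro x hx; rw [grad_tsupport ϑ hx]; simp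
  have i3 : Integrable fun x => ϑ x ^ 2 := by
    have := hϑ.continuous
    refine int_cc (by fun_prop) _ hK ?_
    intro x hx; rw [image_eq_zero_of_notMem_tsupport hx]; simp
  have I1 := integral_mono (i0.const_mul (c / 2)) (i1.add (i2.const_mul (2 * C1 ^ 2 / c * (L ^ 2 * ‖a‖ ^ 2)))) ptw
  simp only [Pi.add_apply] at I1
  rw [integral_add i1 (i2.const_mul _), integral_const_mul, integral_const_mul, eq] at I1
  have I2 : ∫ x, (u (x + a) ^ lam - u x ^ lam) * φ x ≤ ∫ x, (L' * L * ‖a‖ ^ 2) * ϑ x ^ 2 := by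
    refine integral_mono ?_ (i3.const_mul _) ?_
    · have h1 := cf.continuous
      have h2 : Continuous fun x => u (x + a) ^ lam := h1.comp (by fun_prop : Continuous fun x : EE N => x + a)
      have h3 := cφ.continuous
      refine int_cc ((h2.sub h1).mul h3) _ hφc ?_
      intro x hx; rw [image_eq_zero_of_notMem_tsupport hx]; simp
    · intro x
      simp only
      by_cases hx : x ∈ tsupport ϑ
      swap
      · simp [hφ, image_eq_zero_of_notMem_tsupport hx]
      have h1 := hL' x hx a (ha1.trans ha21)
      have h2 : |d x| ≤ L * ‖a‖ := hL x hx a (ha1.trans ha21)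
      have h3 : (u (x + a) ^ lam - u x ^ lam) * d x ≤ (L' * ‖a‖) * (L * ‖a‖) := by
        refine (le_abs_self _).trans ?_
        rw [abs_mul]; gcongr
      have := mul_le_mul_of_nonneg_left h3 (sq_nonneg (ϑ x))
      simp only [hφ]
      linarith
  rw [integral_const_mul] at I2
  have hfin : c / 2 * (∫ x, ϑ x ^ 2 * ‖D x‖ ^ 2) ≤ (L' * L * (∫ x, ϑ x ^ 2) +
     2 * C1 ^ 2 / c * L ^ 2 * ∫ x, ‖gradient ϑ x‖ ^ 2) * ‖a‖ ^ 2 := by linarith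
  have := mul_le_mul_of_nonneg_left hfin (show 0 ≤ 2 / c by positivity)
  have e : 2 / c * (c / 2 * (∫ x, ϑ x ^ 2 * ‖D x‖ ^ 2)) = ∫ x, ϑ x ^ 2 * ‖D x‖ ^ 2 := by field_simp
  rw [e] at this
  linarith

end reg


section reg
variable {N : ℕ}

lemma moll_scaled : ∃ A : ℝ, 0 ≤ A ∧ ∀ ε : ℝ, 0 < ε → ∃ ρ : EE N → ℝ, IsMoll ε ρ ∧
    ∫ y, ‖gradient ρ y‖ ≤ A / ε := by
  obtain ⟨ρ1, h1⟩ := IsMoll.exists (N := N) one_pos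
  refine ⟨∫ y, ‖gradient ρ1 y‖, integral_nonneg fun _ => norm_nonneg _, ?_⟩
  intro ε hε
  set c : ℝ := (ε ^ N)⁻¹ with hc
  have hc0 : 0 < c := by positivity
  set ρ : EE N → ℝ := fun x => c * ρ1 (ε⁻¹ • x) with hρ
  have hinteg0 : ∀ f : EE N → ℝ, ∫ x, f (ε⁻¹ • x) = c⁻¹ * ∫ x, f x := by
    intro f
    rw [Measure.integral_comp_smul, finrank_euclideanSpace_fin, smul_eq_mul, hc,
      abs_of_nonneg (by positivity)]
    congr 1
    rw [inv_pow]
  refine ⟨ρ, ⟨hε, ?_, ?_, ?_, ?_⟩, ?_⟩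
  · exact contDiff_const.mul (h1.smooth.comp (by fun_prop))
  · intro x; have := h1.nonneg (ε⁻¹ • x); positivity
  · intro x hx
    have : ρ1 (ε⁻¹ • x) ≠ 0 := fun h => hx (by simp [hρ, h])
    have := h1.supp this
    rw [mem_ball_zero_iff, norm_smul, norm_inv, Real.norm_of_nonneg hε.le] at this
    rw [mem_ball_zero_iff]
    rwa [inv_mul_lt_iff₀ hε, mul_one] at this
  · simp only [hρ]
    rw [integral_const_mul, hinteg0, h1.int]; field_simp
  · have hg : ∀ x, ‖gradient ρ x‖ = c * ε⁻¹ * ‖gradient ρ1 (ε⁻¹ • x)‖ := by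
      intro x
      have hd : DifferentiableAt ℝ ρ1 (ε⁻¹ • x) := h1.smooth.differentiable (by simp) _
      have e : HasFDerivAt ρ (c • (fderiv ℝ ρ1 (ε⁻¹ • x)).comp (ε⁻¹ • ContinuousLinearMap.id ℝ (EE N))) x := by
        have hs : HasFDerivAt (fun x : EE N => ε⁻¹ • x) (ε⁻¹ • ContinuousLinearMap.id ℝ (EE N)) x :=
          (ε⁻¹ • ContinuousLinearMap.id ℝ (EE N)).hasFDerivAt
        exact (hd.hasFDerivAt.comp x hs).const_mul c
      rw [norm_grad, norm_grad, e.fderiv]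
      have : (fderiv ℝ ρ1 (ε⁻¹ • x)).comp (ε⁻¹ • ContinuousLinearMap.id ℝ (EE N)) = ε⁻¹ • fderiv ℝ ρ1 (ε⁻¹ • x) := by
        ext; simp
      rw [this, norm_smul, norm_smul, Real.norm_of_nonneg hc0.le, Real.norm_of_nonneg (by positivity), mul_assoc]
    simp_rw [hg]
    rw [integral_const_mul, hinteg0 (fun x => ‖gradient ρ1 x‖)]
    apply le_of_eq
    field_simp

section
variable {F : Type*} [NormedAddCommGroup F] [NormedSpace ℝ F] [CompleteSpace F]
variable {ε : ℝ} {ρ : EE N → ℝ} {f : EE N → F}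

lemma mo_fderiv_left (h : IsMoll ε ρ) (hf : Continuous f) (x e : EE N) :
    fderiv ℝ (mo ρ f) x e = ∫ y, (fderiv ℝ ρ y e) • f (x - y) := by
  have h1 := h.hcs.hasFDerivAt_convolution_left (ContinuousLinearMap.lsmul ℝ ℝ) 
    (h.smooth.of_le (by exact_mod_cast le_top) : ContDiff ℝ 1 ρ) hf.locallyIntegrable x (μ := volume)
  rw [mo_eq, h1.fderiv]
  unfold convolution
  rw [ContinuousLinearMap.integral_apply]
  · rfl
  · apply Continuous.integrable_of_hasCompactSupport
    · have := (h.smooth.continuous_fderiv (by simp))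
      fun_prop
    · refine HasCompactSupport.intro h.hcs (fun y hy => ?_)
      have : fderiv ℝ ρ y = 0 := by
        by_contra h
        exact hy (support_fderiv_subset ℝ h)
      simp [this]

end

lemma moll_c1 {ε : ℝ} {ρ : EE N → ℝ} (h : IsMoll ε ρ) : ContDiff ℝ 1 ρ :=
  h.smooth.of_le (by exact_mod_cast le_top)

lemma int_grad_zero {ρ : EE N → ℝ} (h : ContDiff ℝ 1 ρ) (hc : HasCompactSupport ρ) (b : EE N) :
    ∫ y, ⟪gradient ρ y, b⟫ = 0 := by
  simp_rw [grad_apply]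
  exact integral_fderiv_zero h hc

/-- mollified equation -/
lemma mo_eqn {p lam r ε : ℝ} (hp : 1 < p) {u : EE N → ℝ}
    (hu : ContDiff ℝ 1 u) (hsol : IsSol p lam r u) {ρ : EE N → ℝ}
    (h : IsMoll ε ρ) {x : EE N} (hx : closedBall x ε ⊆ ball 0 r) :
    mo ρ (fun y => u y ^ lam) x =
      - ∫ y, ⟪gradient ρ y, Phi p (gradient u (x - y)) - Phi p (gradient u x)⟫ := by
  set φ : EE N → ℝ := fun y => ρ (x - y) with hφ
  have cφ : ContDiff ℝ 1 φ := (moll_c1 h).comp (by fun_prop)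
  have tφ : tsupport φ ⊆ closedBall x ε := by
    apply closure_minimal _ isClosed_closedBall
    intro y hy
    have := h.supp (show ρ (x - y) ≠ 0 from hy)
    rw [mem_ball_zero_iff] at this
    rw [mem_closedBall, dist_eq_norm, norm_sub_rev]; exact this.le
  have hc : HasCompactSupport φ := (isCompact_closedBall x ε).of_isClosed_subset (isClosed_tsupport _) tφ
  have eq := hsol φ cφ hc (tφ.trans hx)
  have gφ : ∀ y, gradient φ y = - gradient ρ (x - y) := by
    intro y
    unfold gradient
    have : fderiv ℝ φ y = - fderiv ℝ ρ (x - y) := by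
      have hd : DifferentiableAt ℝ ρ (x - y) := (moll_c1 h).differentiable (by norm_num) _
      have hs : HasFDerivAt (fun y : EE N => x - y) (-ContinuousLinearMap.id ℝ (EE N)) y :=
        (hasFDerivAt_id y).const_sub x
      have := (hd.hasFDerivAt.comp y hs).fderiv
      rw [show φ = ρ ∘ fun y => x - y from rfl, this]
      ext; simp
    rw [this]; simp
  simp_rw [gφ, inner_neg_right, integral_neg] at eq
  have e1 := integral_sub_left_eq_self (fun y => ⟪Phi p (gradient u (x - y)), gradient ρ y⟫) volume x
  have e2 := integral_sub_left_eq_self (fun y => u (x - y) ^ lam * ρ y) volume x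
  simp only [sub_sub_cancel] at e1 e2
  rw [e1] at eq
  change _ = ∫ y, u y ^ lam * ρ (x - y) at eq
  rw [e2] at eq
  have hg := grad_cont hu
  have cV : Continuous fun y => Phi p (gradient u (x - y)) := (Phi_cont hp).comp (hg.comp (by fun_prop))
  have cgρ := grad_cont (moll_c1 h)
  have i1 : Integrable fun y => ⟪gradient ρ y, Phi p (gradient u (x - y))⟫ := by
    refine int_cc (by fun_prop) _ h.hcs ?_
    intro y hy; rw [grad_tsupport ρ hy]; simp
  have i2 : Integrable fun y => ⟪gradient ρ y, Phi p (gradient u x)⟫ := by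
    refine int_cc (by fun_prop) _ h.hcs ?_
    intro y hy; rw [grad_tsupport ρ hy]; simp
  simp_rw [inner_sub_right]
  rw [integral_sub i1 i2, int_grad_zero (moll_c1 h) h.hcs, sub_zero]
  unfold mo
  simp only [smul_eq_mul]
  simp_rw [mul_comm (ρ _)]
  rw [← eq]
  simp_rw [real_inner_comm]

/-- `gg` of a mollification -/
lemma gg_mo {ω : ℝ → ℝ} (hω : ContDiff ℝ 2 ω) {u : EE N → ℝ} (hu : ContDiff ℝ 1 u) {ε : ℝ} {ρ : EE N → ℝ}
    (h : IsMoll ε ρ) (x : EE N) :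
    gg ω (mo ρ u) x = - ∫ y, ⟪gradient ρ y, fderiv ℝ (fun ξ : EE N => ω (‖ξ‖ ^ 2) • ξ)
        (gradient (mo ρ u) x) (gradient u (x - y) - gradient u x)⟫ := by
  set Wf : EE N → EE N := fun ξ => ω (‖ξ‖ ^ 2) • ξ with hWf
  have cW : ContDiff ℝ 2 Wf := (hω.comp (contDiff_norm_sq ℝ)).smul contDiff_id
  have hg := grad_cont hu
  have hgv : gradient (mo ρ u) = mo ρ (gradient u) := funext fun x => mo_gradient h hu x
  set Lx := fderiv ℝ Wf (gradient (mo ρ u) x) with hLx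
  have hdg : DifferentiableAt ℝ (gradient (mo ρ u)) x := by
    rw [hgv]; exact (mo_contDiff h hg).differentiable (by simp) x
  have cgρ := grad_cont (moll_c1 h)
  have iy : ∀ (b : EE N), Integrable fun y => (fderiv ℝ ρ y b) • (gradient u (x - y)) := by
    intro b
    have := (moll_c1 h).continuous_fderiv (by norm_num)
    refine int_cc (by fun_prop) _ h.hcs ?_
    intro y hy
    rw [← grad_apply, grad_tsupport ρ hy]; simp
  have iy2 : ∀ (b : EE N), Integrable fun y => (fderiv ℝ ρ y b) • (gradient u x) := by
    intro b
    have := (moll_c1 h).continuous_fderiv (by norm_num)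
    refine int_cc (by fun_prop) _ h.hcs ?_
    intro y hy
    rw [← grad_apply, grad_tsupport ρ hy]; simp
  have e1 : ∀ b : EE N, fderiv ℝ (gradient (mo ρ u)) x b =
      ∫ y, (fderiv ℝ ρ y b) • (gradient u (x - y) - gradient u x) := by
    intro b
    rw [hgv, mo_fderiv_left h hg]
    simp_rw [smul_sub]
    rw [integral_sub (iy b) (iy2 b), integral_smul_const, integral_fderiv_zero (moll_c1 h) h.hcs]
    simp
  have iy3 : ∀ (b : EE N), Integrable fun y => (fderiv ℝ ρ y b) • (gradient u (x - y) - gradient u x) := by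
    intro b
    simp_rw [smul_sub]
    exact (iy b).sub (iy2 b)
  have e2 : ∀ i, pd i (fun y => ω (‖gradient (mo ρ u) y‖ ^ 2) * pd i (mo ρ u) y) x =
      ∫ y, pd i ρ y * (Lx (gradient u (x - y) - gradient u x)) i := by
    intro i
    have h1 : HasFDerivAt (fun y => Wf (gradient (mo ρ u) y)) (Lx.comp (fderiv ℝ (gradient (mo ρ u)) x)) x :=
      (cW.differentiable (by norm_num) _).hasFDerivAt.comp x hdg.hasFDerivAt
    have h2 : (fun y => ω (‖gradient (mo ρ u) y‖ ^ 2) * pd i (mo ρ u) y) =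
        fun y => (EuclideanSpace.proj i : EE N →L[ℝ] ℝ) (Wf (gradient (mo ρ u) y)) := by
      funext y
      simp [hWf, pd_grad]
    have h3 := ((EuclideanSpace.proj i : EE N →L[ℝ] ℝ).hasFDerivAt (x := Wf (gradient (mo ρ u) x))).comp x h1
    have h4 : pd i (fun y => ω (‖gradient (mo ρ u) y‖ ^ 2) * pd i (mo ρ u) y) x =
        ((EuclideanSpace.proj i : EE N →L[ℝ] ℝ).comp Lx) (fderiv ℝ (gradient (mo ρ u)) x (EuclideanSpace.single i 1)) := by
      rw [h2]; unfold pd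
      rw [show fderiv ℝ (fun y => (EuclideanSpace.proj i : EE N →L[ℝ] ℝ) (Wf (gradient (mo ρ u) y))) x = _ from h3.fderiv]
      rfl
    rw [h4, e1, ← ContinuousLinearMap.integral_comp_comm _ (iy3 _)]
    simp [pd]
  unfold gg
  congr 1
  simp_rw [e2]
  rw [← integral_finset_sum]
  · refine integral_congr_ae (Filter.Eventually.of_forall fun y => ?_)
    simp only
    rw [inner_coord]
    simp_rw [pd_grad]
  · intro i _
    have : Continuous (pd i ρ) := by
      have := (moll_c1 h).continuous_fderiv (by norm_num)
      unfold pd; fun_prop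
    refine int_cc (by fun_prop) _ h.hcs ?_
    intro y hy
    rw [← pd_grad, grad_tsupport ρ hy]; simp

end reg


section reg
variable {N : ℕ}

lemma cs_weight {k h : EE N → ℝ} (hk : Integrable k) (hk0 : ∀ y, 0 ≤ k y)
    (h1 : Integrable fun y => k y * h y) (h2 : Integrable fun y => k y * h y ^ 2) :
    (∫ y, k y * h y) ^ 2 ≤ (∫ y, k y) * ∫ y, k y * h y ^ 2 := by
  set A := ∫ y, k y with hA
  set B := ∫ y, k y * h y with hB
  have hA0 : 0 ≤ A := integral_nonneg hk0
  have key : ∀ c : ℝ, 0 ≤ (∫ y, k y * h y ^ 2) - 2 * c * B + c ^ 2 * A := by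
    intro c
    have e : ∫ y, k y * (h y - c) ^ 2 = (∫ y, k y * h y ^ 2) - 2 * c * B + c ^ 2 * A := by
      have h3 : Integrable (fun y => k y * h y ^ 2 - 2 * c * (k y * h y)) := h2.sub (h1.const_mul _)
      rw [hA, hB, ← integral_const_mul, ← integral_const_mul, ← integral_sub h2 (h1.const_mul _),
        ← integral_add h3 (hk.const_mul _)]
      refine integral_congr_ae (Filter.Eventually.of_forall fun y => ?_)
      simp only; ring
    rw [← e]
    exact integral_nonneg fun y => mul_nonneg (hk0 y) (sq_nonneg _)
  rcases hA0.eq_or_lt with h0 | hpos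
  · rw [← h0, zero_mul]
    by_contra hcon
    have hB : B ≠ 0 := by rintro hB; rw [hB] at hcon; simp at hcon
    have := key (((∫ y, k y * h y ^ 2) + 1) / (2 * B))
    rw [← h0] at this
    have e : 2 * (((∫ y, k y * h y ^ 2) + 1) / (2 * B)) * B = (∫ y, k y * h y ^ 2) + 1 := by field_simp
    rw [e] at this; linarith
  · have := key (B / A)
    have e : (∫ y, k y * h y ^ 2) - 2 * (B / A) * B + (B / A) ^ 2 * A = (∫ y, k y * h y ^ 2) - B ^ 2 / A := by
      field_simp; ring
    rw [e, sub_nonneg, div_le_iff₀ hpos] at this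
    linarith

set_option maxHeartbeats 800000 in
lemma reg {p lam r m A : ℝ} (hp : 1 < p) (hl : 0 ≤ lam) (hm : 0 < m) (hA : 0 ≤ A) {u : EE N → ℝ}
    (hu : ContDiff ℝ 1 u) (hpos : ∀ x, 0 < u x) (hsol : IsSol p lam r u) {ϑ : EE N → ℝ}
    (hϑ : ContDiff ℝ 1 ϑ) (hc : HasCompactSupport ϑ) (hsupp : tsupport ϑ ⊆ ball 0 r)
    (hlow : ∀ x ∈ tsupport ϑ, m ≤ ‖gradient u x‖) {ω : ℝ → ℝ} (hω : ContDiff ℝ 2 ω)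
    (hωe : ∀ s, m / 2 ≤ s → ω (s ^ 2) = s ^ (p - 2)) {τ : ℝ} (hτ : 0 < τ) :
    ∃ ε0 : ℝ, 0 < ε0 ∧ ∀ ε ρ, IsMoll ε ρ → ε ≤ ε0 → ∫ y, ‖gradient ρ y‖ ≤ A / ε →
      ∫ x, ϑ x ^ 2 * (gg ω (mo ρ u) x - mo ρ (fun y => u y ^ lam) x) ^ 2 ≤ τ := by
  have hK : IsCompact (tsupport ϑ) := hc
  have hg := grad_cont hu
  obtain ⟨C, a0, hC, ha0, hdq⟩ := dq_L2 hp hl hm hu hpos hsol hϑ hc hsupp hlow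
  obtain ⟨r', hr', hKr⟩ := exists_lt_subset_ball (isClosed_tsupport ϑ) hsupp
  obtain ⟨M, hM⟩ := hK.exists_bound_of_continuousOn hg.continuousOn
  set Wf : EE N → EE N := fun ξ => ω (‖ξ‖ ^ 2) • ξ with hWf
  have cW : ContDiff ℝ 2 Wf := (hω.comp (contDiff_norm_sq ℝ)).smul contDiff_id
  have hWV : ∀ ξ : EE N, m / 2 ≤ ‖ξ‖ → Wf ξ = Phi p ξ := by
    intro ξ hξ; simp only [hWf, Phi, hωe _ hξ]
  obtain ⟨η, hη, hη2⟩ : ∃ η : ℝ, 0 < η ∧ η ^ 2 * (C * A ^ 2) ≤ τ := by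
    refine ⟨Real.sqrt (τ / (C * A ^ 2 + 1)), by positivity, ?_⟩
    rw [Real.sq_sqrt (by positivity), div_mul_eq_mul_div, div_le_iff₀ (by positivity)]
    nlinarith
  have hcW := cW.continuous_fderiv (by norm_num)
  have huc := (isCompact_closedBall (0 : EE N) (M + 1)).uniformContinuousOn_of_continuous hcW.continuousOn
  rw [Metric.uniformContinuousOn_iff] at huc
  obtain ⟨d, hd, hdW⟩ := huc η hη
  set δ := min (min 1 (m / 2)) (d / 3) with hδ
  have hδ0 : 0 < δ := by positivity
  have hδ1 : δ ≤ 1 := (min_le_left _ _).trans (min_le_left _ _)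
  have hδ2 : δ ≤ m / 2 := (min_le_left _ _).trans (min_le_right _ _)
  have hδ3 : δ ≤ d / 3 := min_le_right _ _
  obtain ⟨a2, ha2, ha21, hosc⟩ := osc_cpt hg hK hδ0
  refine ⟨min (min a0 a2) ((r - r') / 2), lt_min (lt_min ha0 ha2) (by linarith), ?_⟩
  intro ε ρ hρ hε hgr
  have hε0 : ε ≤ a0 := hε.trans ((min_le_left _ _).trans (min_le_left _ _))
  have hε1 : ε ≤ a2 := hε.trans ((min_le_left _ _).trans (min_le_right _ _))
  have hε2 : ε ≤ (r - r') / 2 := hε.trans (min_le_right _ _)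
  have cgρ := grad_cont (moll_c1 hρ)
  set k : EE N → ℝ := fun y => ‖gradient ρ y‖ with hk
  have ck : Continuous k := cgρ.norm
  have hk0 : ∀ y, y ∉ tsupport ρ → k y = 0 := fun y hy => by simp only [hk]; rw [grad_tsupport ρ hy]; simp
  have hkε : ∀ y, k y ≠ 0 → ‖y‖ ≤ ε := by
    intro y hy
    have : y ∈ tsupport ρ := by by_contra h; exact hy (hk0 y h)
    simpa using hρ.tsupp this
  set D : EE N → EE N → EE N := fun x y => gradient u (x - y) - gradient u x with hD
  have cD : Continuous (Function.uncurry D) := by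
    simp only [hD, Function.uncurry_def]; fun_prop
  have cDx : ∀ x, Continuous (D x) := fun x => by simp only [hD]; fun_prop
  have cDy : ∀ y, Continuous (fun x => D x y) := fun x => by simp only [hD]; fun_prop
  -- pointwise
  have ptw : ∀ x ∈ tsupport ϑ, |gg ω (mo ρ u) x - mo ρ (fun y => u y ^ lam) x| ≤ η * ∫ y, k y * ‖D x y‖ := by
    intro x hx
    have hxb : closedBall x ε ⊆ ball 0 r := by
      intro z hz
      have h1 := hKr hx
      rw [mem_ball_zero_iff] at h1 ⊢
      rw [mem_closedBall, dist_eq_norm] at hz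
      have := norm_add_le (z - x) x
      rw [sub_add_cancel] at this; linarith
    rw [gg_mo hω hu hρ, mo_eqn hp hu hsol hρ hxb]
    set Lx := fderiv ℝ Wf (gradient (mo ρ u) x) with hLx
    have cV : Continuous fun y => Phi p (gradient u (x - y)) := (Phi_cont hp).comp (hg.comp (by fun_prop))
    have i1 : Integrable fun y => ⟪gradient ρ y, Lx (gradient u (x - y) - gradient u x)⟫ := by
      refine int_cc (by fun_prop) _ hρ.hcs ?_
      intro y hy; rw [grad_tsupport ρ hy]; simp
    have i2 : Integrable fun y => ⟪gradient ρ y, Phi p (gradient u (x - y)) - Phi p (gradient u x)⟫ := by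
      refine int_cc (by fun_prop) _ hρ.hcs ?_
      intro y hy; rw [grad_tsupport ρ hy]; simp
    rw [sub_neg_eq_add, neg_add_eq_sub, ← integral_sub i2 i1, ← integral_const_mul, ← Real.norm_eq_abs]
    refine norm_integral_le_of_norm_le ?_ (Filter.Eventually.of_forall fun y => ?_)
    · refine int_cc (by have := cDx x; fun_prop) _ hρ.hcs ?_
      intro y hy; rw [hk0 y hy]; simp
    · rw [← inner_sub_right, Real.norm_eq_abs]
      by_cases hy : k y = 0
      · have : gradient ρ y = 0 := by simpa [hk] using hy
        rw [this]; simp [hy]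
      have hyε := hkε y hy
      refine (abs_real_inner_le_norm _ _).trans ?_
      have hb : ∀ z : EE N, ‖z‖ ≤ ε → ‖gradient u (x + z) - gradient u x‖ ≤ δ := fun z hz =>
        hosc x hx z (hz.trans hε1)
      have hDx : ‖gradient u (x - y) - gradient u x‖ ≤ δ := by
        rw [sub_eq_add_neg]; exact hb (-y) (by simpa using hyε)
      have hv : ‖gradient (mo ρ u) x - gradient u x‖ ≤ δ := by
        rw [mo_gradient hρ hu, ← dist_eq_norm]
        refine mo_close hρ hg hδ0.le ?_
        intro z hz
        rw [mem_ball, dist_eq_norm] at hz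
        have := hb (z - x) hz.le
        rwa [add_sub_cancel, ← dist_eq_norm] at this
      have hMx := hM x hx
      have hmx := hlow x hx
      have e1 : Wf (gradient u (x - y)) = Phi p (gradient u (x - y)) := by
        apply hWV
        have := norm_sub_norm_le (gradient u x) (gradient u (x - y))
        rw [norm_sub_rev] at this; linarith
      have e2 : Wf (gradient u x) = Phi p (gradient u x) := hWV _ (by linarith)
      rw [← e1, ← e2]
      have mvt := Convex.norm_image_sub_le_of_norm_fderiv_le' (𝕜 := ℝ) (f := Wf) (C := η) (φ := Lx)
        (s := closedBall (gradient u x) δ) (x := gradient u x) (y := gradient u (x - y))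
        (fun ξ _ => cW.differentiable (by norm_num) ξ) ?_ (convex_closedBall _ _)
        (mem_closedBall_self hδ0.le) (by rw [mem_closedBall, dist_eq_norm]; exact hDx)
      · calc _ ≤ k y * (η * ‖D x y‖) := by
              gcongr
          _ = η * (k y * ‖D x y‖) := by ring
      · intro ξ hξ
        rw [mem_closedBall, dist_eq_norm] at hξ
        rw [← dist_eq_norm]
        refine (hdW ξ ?_ (gradient (mo ρ u) x) ?_ ?_).le
        · rw [mem_closedBall_zero_iff]
          have := norm_add_le (ξ - gradient u x) (gradient u x)
          rw [sub_add_cancel] at this; linarith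
        · rw [mem_closedBall_zero_iff]
          have := norm_add_le (gradient (mo ρ u) x - gradient u x) (gradient u x)
          rw [sub_add_cancel] at this; linarith
        · rw [dist_eq_norm]
          have := norm_sub_le (ξ - gradient u x) (gradient (mo ρ u) x - gradient u x)
          rw [sub_sub_sub_cancel_right] at this
          linarith
  -- integrate
  have ik : Integrable k := int_cc ck _ hρ.hcs hk0
  have cϑ := hϑ.continuous
  have hϑ0 : ∀ x, x ∉ tsupport ϑ → ϑ x = 0 := fun x hx => image_eq_zero_of_notMem_tsupport hx
  set H : EE N → EE N → ℝ := fun x y => ϑ x ^ 2 * (k y * ‖D x y‖ ^ 2) with hH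
  have cH : Continuous (Function.uncurry H) := by
    have : Continuous fun z : EE N × EE N => D z.1 z.2 := cD
    simp only [hH, Function.uncurry_def]; fun_prop
  have iH : Integrable (Function.uncurry H) (volume.prod volume) := by
    apply cH.integrable_of_hasCompactSupport
    refine HasCompactSupport.intro (hK.prod hρ.hcs) ?_
    rintro ⟨x, y⟩ hxy
    simp only [Set.mem_prod, not_and_or] at hxy
    simp only [Function.uncurry, hH]
    rcases hxy with h | h
    · rw [hϑ0 x h]; simp
    · rw [hk0 y h]; simp
  have swap := integral_integral_swap iH
  have b1 : ∀ y, ∫ x, H x y ≤ (C * ε ^ 2) * k y := by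
    intro y
    by_cases hy : k y = 0
    · simp [hH, hy]
    have hyε := hkε y hy
    have := hdq (-y) (by simpa using hyε.trans hε0)
    have e : ∫ x, H x y = k y * ∫ x, ϑ x ^ 2 * ‖gradient u (x + -y) - gradient u x‖ ^ 2 := by
      rw [← integral_const_mul]
      refine integral_congr_ae (Filter.Eventually.of_forall fun x => ?_)
      simp only [hH, hD, sub_eq_add_neg]; ring
    rw [e]
    have h2 : C * ‖-y‖ ^ 2 ≤ C * ε ^ 2 := by rw [norm_neg]; gcongr
    have := mul_le_mul_of_nonneg_left (this.trans h2) (norm_nonneg (gradient ρ y))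
    calc _ ≤ k y * (C * ε ^ 2) := this
      _ = _ := by ring
  have b2 : ∫ y, ∫ x, H x y ≤ (C * ε ^ 2) * ∫ y, k y := by
    rw [← integral_const_mul]
    exact integral_mono iH.integral_prod_right (ik.const_mul _) b1
  have hkA : ∫ y, k y ≤ A / ε := hgr
  have hk00 : 0 ≤ ∫ y, k y := integral_nonneg fun y => norm_nonneg _
  have hεp := hρ.pos
  have cmf : Continuous fun y => u y ^ lam := hu.continuous.rpow_const fun x => Or.inr hl
  calc ∫ x, ϑ x ^ 2 * (gg ω (mo ρ u) x - mo ρ (fun y => u y ^ lam) x) ^ 2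
      ≤ ∫ x, (η ^ 2 * ∫ y, k y) * ∫ y, H x y := by
        refine integral_mono ?_ (iH.integral_prod_left.const_mul _) ?_
        · have h1 := gg_cont hω (contDiff_infty.mp (mo_contDiff hρ hu.continuous) 3 : ContDiff ℝ 3 (mo ρ u))
          have h2 := (mo_contDiff hρ cmf).continuous
          refine int_cc (by fun_prop) _ hK ?_
          intro x hx; rw [hϑ0 x hx]; simp
        · intro x
          simp only
          have e : ∫ y, H x y = ϑ x ^ 2 * ∫ y, k y * ‖D x y‖ ^ 2 := by
            rw [← integral_const_mul]
          rw [e]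
          by_cases hx : x ∈ tsupport ϑ
          swap
          · rw [hϑ0 x hx]; simp
          have h1 := ptw x hx
          have h2 := cs_weight (k := k) (h := fun y => ‖D x y‖) ik (fun y => norm_nonneg _)
            (int_cc (by have := cDx x; fun_prop) _ hρ.hcs (fun y hy => by rw [hk0 y hy]; simp))
            (int_cc (by have := cDx x; fun_prop) _ hρ.hcs (fun y hy => by rw [hk0 y hy]; simp))
          have h3 : (gg ω (mo ρ u) x - mo ρ (fun y => u y ^ lam) x) ^ 2 ≤ (η * ∫ y, k y * ‖D x y‖) ^ 2 := by
            rw [← sq_abs]; gcongr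
          have h4 := mul_le_mul_of_nonneg_left h2 (sq_nonneg η)
          have h5 : (gg ω (mo ρ u) x - mo ρ (fun y => u y ^ lam) x) ^ 2 ≤
            η ^ 2 * ((∫ y, k y) * ∫ y, k y * ‖D x y‖ ^ 2) := by rw [mul_pow] at h3; exact h3.trans h4
          have := mul_le_mul_of_nonneg_left h5 (sq_nonneg (ϑ x))
          linarith
    _ = (η ^ 2 * ∫ y, k y) * ∫ y, ∫ x, H x y := by rw [integral_const_mul, swap]
    _ ≤ (η ^ 2 * (A / ε)) * ((C * ε ^ 2) * (A / ε)) := by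
        have h0 : 0 ≤ ∫ y, ∫ x, H x y := integral_nonneg fun y => integral_nonneg fun x => by
          simp only [hH]; positivity
        have h1 : ∫ y, ∫ x, H x y ≤ (C * ε ^ 2) * (A / ε) := b2.trans (by gcongr)
        gcongr
    _ = η ^ 2 * (C * A ^ 2) := by field_simp
    _ ≤ τ := hη2

end reg


section cut

lemma st_deriv_zero {x : ℝ} (h : x ≤ 0 ∨ 1 ≤ x) : deriv Real.smoothTransition x = 0 := by
  rcases h with h | h
  · refine IsLocalMin.deriv_eq_zero (Filter.Eventually.of_forall fun y => ?_)
    rw [Real.smoothTransition.zero_of_nonpos h]; exact Real.smoothTransition.nonneg y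
  · refine IsLocalMax.deriv_eq_zero (Filter.Eventually.of_forall fun y => ?_)
    rw [Real.smoothTransition.one_of_one_le h]; exact Real.smoothTransition.le_one y

lemma st_c1 : ContDiff ℝ 1 Real.smoothTransition :=
  Real.smoothTransition.contDiff (n := 1)

lemma st_bound : ∃ B : ℝ, 0 ≤ B ∧ ∀ x, |deriv Real.smoothTransition x| ≤ B := by
  have hc : Continuous (deriv Real.smoothTransition) := st_c1.continuous_deriv (by norm_num)
  obtain ⟨B, hB⟩ := (isCompact_Icc (a := (0:ℝ)) (b := 1)).exists_bound_of_continuousOn hc.continuousOn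
  refine ⟨B, (norm_nonneg _).trans (hB 0 (by simp)), fun x => ?_⟩
  by_cases hx : x ∈ Set.Icc (0:ℝ) 1
  · exact hB x hx
  · rw [st_deriv_zero]
    · simpa using (norm_nonneg _).trans (hB 0 (by simp))
    · by_contra hcon
      push Not at hcon
      exact hx ⟨hcon.1.le, hcon.2.le⟩

noncomputable def chi (δ t : ℝ) : ℝ := Real.smoothTransition (t / δ ^ 2 - 1)

lemma chi_contDiff (δ : ℝ) : ContDiff ℝ 1 (chi δ) := by
  unfold chi
  exact st_c1.comp ((contDiff_id.div_const _).sub contDiff_const)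

lemma chi_nonneg (δ t : ℝ) : 0 ≤ chi δ t := Real.smoothTransition.nonneg _
lemma chi_le_one (δ t : ℝ) : chi δ t ≤ 1 := Real.smoothTransition.le_one _

lemma chi_deriv (δ t : ℝ) : deriv (chi δ) t = (δ ^ 2)⁻¹ * deriv Real.smoothTransition (t / δ ^ 2 - 1) := by
  have h1 : HasDerivAt (fun t : ℝ => t / δ ^ 2 - 1) ((δ ^ 2)⁻¹) t := by
    simpa using ((hasDerivAt_id t).div_const (δ ^ 2)).sub_const 1
  have h2 := (st_c1.differentiable (by norm_num) (t / δ ^ 2 - 1)).hasDerivAt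
  have := h2.comp t h1
  rw [mul_comm]
  exact this.deriv

lemma chi_deriv_nonneg (δ t : ℝ) : 0 ≤ deriv (chi δ) t := by
  rw [chi_deriv]
  exact mul_nonneg (by positivity) Real.smoothTransition.monotone.deriv_nonneg

lemma chi_zero {δ t : ℝ} (hδ : 0 < δ) (ht : t ≤ δ ^ 2) : chi δ t = 0 ∧ deriv (chi δ) t = 0 := by
  have : t / δ ^ 2 - 1 ≤ 0 := by
    rw [sub_nonpos, div_le_one (by positivity)]; exact ht
  exact ⟨Real.smoothTransition.zero_of_nonpos this, by rw [chi_deriv, st_deriv_zero (Or.inl this), mul_zero]⟩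

lemma chi_one {δ t : ℝ} (hδ : 0 < δ) (ht : 2 * δ ^ 2 ≤ t) : chi δ t = 1 ∧ deriv (chi δ) t = 0 := by
  have : 1 ≤ t / δ ^ 2 - 1 := by
    rw [le_sub_iff_add_le, le_div_iff₀ (by positivity)]; linarith
  exact ⟨Real.smoothTransition.one_of_one_le this, by rw [chi_deriv, st_deriv_zero (Or.inr this), mul_zero]⟩

lemma chi_tderiv : ∃ B : ℝ, 0 ≤ B ∧ ∀ δ t : ℝ, 0 < δ → |deriv (chi δ) t * t| ≤ B := by
  obtain ⟨B, hB0, hB⟩ := st_bound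
  refine ⟨2 * B, by positivity, fun δ t hδ => ?_⟩
  rcases le_total t (δ ^ 2) with h | h
  · rw [(chi_zero hδ h).2]; simpa using by positivity
  rcases le_total (2 * δ ^ 2) t with h2 | h2
  · rw [(chi_one hδ h2).2]; simpa using by positivity
  rw [chi_deriv, show (δ ^ 2)⁻¹ * deriv Real.smoothTransition (t / δ ^ 2 - 1) * t = (t / δ ^ 2) * deriv Real.smoothTransition (t / δ ^ 2 - 1) by ring, abs_mul]
  have ht : 0 ≤ t := le_trans (by positivity) h
  rw [abs_of_nonneg (by positivity)]
  refine mul_le_mul ?_ (hB _) (abs_nonneg _) (by norm_num)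
  rw [div_le_iff₀ (by positivity)]; exact h2

lemma om_exists (p : ℝ) {m : ℝ} (hm : 0 < m) : ∃ ω : ℝ → ℝ, ContDiff ℝ 2 ω ∧
    (∀ s, m / 2 ≤ s → ω (s ^ 2) = s ^ (p - 2)) ∧
    (∀ t, (m / 2) ^ 2 < t → t * deriv ω t = (p - 2) / 2 * ω t) := by
  set a := (m / 2) ^ 2 / 2 with ha
  have ha0 : 0 < a := by positivity
  set g : ℝ → ℝ := fun t => Real.smoothTransition (t / a - 1) * (t - a) + a with hg
  have hst : ContDiff ℝ 2 (fun t : ℝ => Real.smoothTransition (t / a - 1)) := by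
    exact (Real.smoothTransition.contDiff (n := 2)).comp ((contDiff_id.div_const _).sub contDiff_const)
  have hgc : ContDiff ℝ 2 g := (hst.mul (contDiff_id.sub contDiff_const)).add contDiff_const
  have hg0 : ∀ t, 0 < g t := by
    intro t
    rcases le_total t a with h | h
    · have : t / a - 1 ≤ 0 := by rw [sub_nonpos, div_le_one ha0]; exact h
      simp only [hg, Real.smoothTransition.zero_of_nonpos this]; linarith
    · have := Real.smoothTransition.nonneg (t / a - 1)
      have h2 : 0 ≤ t - a := by linarith
      simp only [hg]; positivity
  have hge : ∀ t, 2 * a ≤ t → g t = t := by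
    intro t h
    have : 1 ≤ t / a - 1 := by rw [le_sub_iff_add_le, le_div_iff₀ ha0]; linarith
    simp only [hg, Real.smoothTransition.one_of_one_le this]; ring
  refine ⟨fun t => g t ^ ((p - 2) / 2), hgc.rpow_const_of_ne fun t => (hg0 t).ne', ?_, ?_⟩
  · intro s hs
    have hs0 : 0 ≤ s := by linarith
    have : 2 * a ≤ s ^ 2 := by
      rw [ha]; have := pow_le_pow_left₀ (by positivity) hs 2; linarith
    simp only [hge _ this]
    rw [← Real.rpow_natCast, ← Real.rpow_mul hs0]; congr 1; push_cast; ring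
  · intro t ht
    have ht0 : 0 < t := lt_trans (by positivity) ht
    have h2 : 2 * a < t := by rw [ha]; linarith
    have hev : (fun t => g t ^ ((p - 2) / 2)) =ᶠ[nhds t] fun t => t ^ ((p - 2) / 2) := by
      filter_upwards [lt_mem_nhds h2] with y hy
      rw [hge y hy.le]
    rw [hev.deriv_eq, (Real.hasDerivAt_rpow_const (Or.inl ht0.ne')).deriv]
    simp only [hge t h2.le]
    rw [Real.rpow_sub_one ht0.ne']
    field_simp
end cut

section lim
variable {N : ℕ}

lemma mo_pos {ε : ℝ} {ρ u : EE N → ℝ} (h : IsMoll ε ρ) (hu : Continuous u) (hpos : ∀ x, 0 < u x) (x : EE N) :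
    0 < mo ρ u x := by
  have hK := isCompact_closedBall x ε
  obtain ⟨y, hy, hmin⟩ := hK.exists_isMinOn ⟨x, mem_closedBall_self h.pos.le⟩ hu.continuousOn
  obtain ⟨z, hz, hmax⟩ := hK.exists_isMaxOn ⟨x, mem_closedBall_self h.pos.le⟩ hu.continuousOn
  have hd : dist (mo ρ u x) (u z) ≤ u z - u y := by
    have hyz : u y ≤ u z := hmin hz
    refine mo_close h hu (by linarith) fun w hw => ?_
    have h1 : u y ≤ u w := hmin (ball_subset_closedBall hw)
    have h2 : u w ≤ u z := hmax (ball_subset_closedBall hw)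
    rw [Real.dist_eq, abs_le]; constructor <;> linarith
  rw [Real.dist_eq, abs_le] at hd
  linarith [hpos y]

variable {Z : Type*} [NormedAddCommGroup Z] [ProperSpace Z]

lemma lim_bdd {K : Set (EE N)} (hK : IsCompact K) {U : Set (EE N × Z)} (hU : IsOpen U)
    {H : EE N × Z → ℝ} (hH : ContinuousOn H U) {z : EE N → Z} (hz : Continuous z)
    (hzU : ∀ x ∈ K, (x, z x) ∈ U) {zk : ℕ → EE N → Z} (hk : TendstoUniformlyOn zk z Filter.atTop K) :
    ∃ M : ℝ, 0 ≤ M ∧ (∀ᶠ k in Filter.atTop, ∀ x ∈ K, |H (x, zk k x)| ≤ M) := by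
  have hG : IsCompact ((fun x => (x, z x)) '' K) := hK.image (by fun_prop)
  obtain ⟨δ, hδ, hsub⟩ := hG.exists_cthickening_subset_open hU (by rintro _ ⟨x, hx, rfl⟩; exact hzU x hx)
  obtain ⟨M, hM⟩ := (hG.cthickening (r := δ)).exists_bound_of_continuousOn (hH.mono hsub)
  refine ⟨max M 0, le_max_right _ _, ?_⟩
  rw [Metric.tendstoUniformlyOn_iff] at hk
  filter_upwards [hk δ hδ] with k h x hx
  refine (hM (x, zk k x) ?_).trans (le_max_left _ _)
  refine mem_cthickening_of_dist_le _ (x, z x) _ _ ⟨x, hx, rfl⟩ ?_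
  rw [Prod.dist_eq, dist_self, dist_comm]
  exact max_le hδ.le (h x hx).le

lemma lim_int {K : Set (EE N)} (hK : IsCompact K) {U : Set (EE N × Z)} (hU : IsOpen U)
    {H : EE N × Z → ℝ} (hH : ContinuousOn H U) {z : EE N → Z} (hz : Continuous z)
    (hzU : ∀ x ∈ K, (x, z x) ∈ U) {zk : ℕ → EE N → Z} (hk : TendstoUniformlyOn zk z Filter.atTop K)
    (hm : ∀ k, Continuous fun x => H (x, zk k x))
    (h0 : ∀ x, x ∉ K → ∀ w, H (x, w) = 0) :
    Filter.Tendsto (fun k => ∫ x, H (x, zk k x)) Filter.atTop (nhds (∫ x, H (x, z x))) := by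
  obtain ⟨M, hM0, hM⟩ := lim_bdd hK hU hH hz hzU hk
  refine tendsto_integral_filter_of_dominated_convergence (K.indicator fun _ => M) ?_ ?_ ?_ ?_
  · exact Filter.Eventually.of_forall fun k => (hm k).aestronglyMeasurable
  · filter_upwards [hM] with k h
    refine Filter.Eventually.of_forall fun x => ?_
    by_cases hx : x ∈ K
    · rw [Set.indicator_of_mem hx]; exact h x hx
    · rw [Set.indicator_of_notMem hx, h0 x hx]; simp
  · exact (integrable_indicator_iff hK.measurableSet).2 (integrableOn_const hK.measure_lt_top.ne)
  · refine Filter.Eventually.of_forall fun x => ?_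
    by_cases hx : x ∈ K
    · have h1 := (hH.continuousAt (hU.mem_nhds (hzU x hx)))
      exact Filter.Tendsto.comp h1 ((tendsto_const_nhds).prodMk_nhds (hk.tendsto_at hx))
    · simp only [h0 x hx]; exact tendsto_const_nhds
end lim


section blim
variable {N : ℕ}

/-- The Bochner integrand as a function of `ζ², |∇ζ|, v, s², g`. -/
noncomputable def BI (a1 c1 c2 C α : ℝ) (ω χ : ℝ → ℝ) (z w v t g : ℝ) : ℝ :=
  χ t * z ^ 2 * v ^ α * (a1 * g ^ 2 + c1 * g * (ω t * t / v) + c2 * (ω t * t / v) ^ 2)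
        + C * (χ t * v ^ α * ω t ^ 2 * t * w ^ 2)
        + C * (deriv χ t * z ^ 2 * v ^ α * t * (g ^ 2 + (ω t * t / v) ^ 2))

set_option maxHeartbeats 1000000 in
lemma blim_core {p lam r δ : ℝ} {a1 c1 c2 C α : ℝ} (hp : 1 < p) (hl : 0 ≤ lam) (hδ : 0 < δ)
    {ω : ℝ → ℝ} (hω : ContDiff ℝ 2 ω) (hωe : ∀ s, δ / 3 / 2 ≤ s → ω (s ^ 2) = s ^ (p - 2))
    {u ζ : EE N → ℝ} (hu : ContDiff ℝ 1 u) (hpos : ∀ x, 0 < u x) (hsol : IsSol p lam r u)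
    (hζ : ContDiff ℝ 1 ζ) (hζc : HasCompactSupport ζ) (hζs : tsupport ζ ⊆ ball 0 r)
    (H : ∀ v : EE N → ℝ, ContDiff ℝ 3 v → (∀ x, 0 < v x) →
      0 ≤ ∫ x, BI a1 c1 c2 C α ω (chi δ) (ζ x) ‖gradient ζ x‖ (v x) (‖gradient v x‖ ^ 2) (gg ω v x)) :
    0 ≤ ∫ x, BI a1 c1 c2 C α ω (chi δ) (ζ x) ‖gradient ζ x‖ (u x) (‖gradient u x‖ ^ 2) (u x ^ lam) := by
  set m := δ / 3 with hm
  have hm0 : 0 < m := by positivity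
  set K := tsupport ζ with hKdef
  have hK : IsCompact K := hζc
  have hgu := grad_cont hu
  have hgζ := grad_cont hζ
  have cf : Continuous fun y => u y ^ lam := hu.continuous.rpow_const fun x => Or.inr hl
  -- cutoff
  obtain ⟨ϑ, ϑs, ϑc, ϑsub, ϑ01, V, hV, hKV, hϑ1⟩ := exists_cutoff (N := N)
    (K := K ∩ {x | 2 * m ≤ ‖gradient u x‖}) (U := ball 0 r ∩ {x | m < ‖gradient u x‖})
    (hK.inter_right (isClosed_le continuous_const hgu.norm))
    (isOpen_ball.inter (isOpen_lt continuous_const hgu.norm))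
    (fun x hx => ⟨hζs hx.1, lt_of_lt_of_le (by linarith : m < 2 * m) hx.2⟩)
  have ϑ1 : ContDiff ℝ 1 ϑ := ϑs.of_le (by exact_mod_cast le_top)
  obtain ⟨A, hA, hmol⟩ := moll_scaled (N := N)
  choose ρ hρ hρA using fun k : ℕ => hmol (1 / ((k : ℝ) + 1)) (by positivity)
  have ek : Filter.Tendsto (fun k : ℕ => 1 / ((k : ℝ) + 1)) Filter.atTop (nhds 0) :=
    tendsto_one_div_add_atTop_nhds_zero_nat
  have unif : ∀ {F : Type} [NormedAddCommGroup F] [NormedSpace ℝ F] [CompleteSpace F]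
      {f : EE N → F}, Continuous f → TendstoUniformlyOn (fun k => mo (ρ k) f) f Filter.atTop K := by
    intro F _ _ _ f hf
    rw [Metric.tendstoUniformlyOn_iff]
    intro d hd
    obtain ⟨e0, he0, h⟩ := mo_unif hf hK (half_pos hd)
    filter_upwards [ek.eventually_lt_const he0] with k hk x hx
    rw [dist_comm]
    exact (h _ _ (hρ k) hk.le x hx).trans_lt (by linarith)
  set v : ℕ → EE N → ℝ := fun k => mo (ρ k) u with hv
  set f : EE N → ℝ := fun y => u y ^ lam with hf
  set fk : ℕ → EE N → ℝ := fun k => mo (ρ k) f with hfk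
  set gk : ℕ → EE N → ℝ := fun k => gg ω (v k) with hgk
  have v3 : ∀ k, ContDiff ℝ 3 (v k) := fun k => contDiff_infty.mp (mo_contDiff (hρ k) hu.continuous) 3
  have v1 : ∀ k, ContDiff ℝ 1 (v k) := fun k => (v3 k).of_le (by norm_num)
  have vpos : ∀ k x, 0 < v k x := fun k x => mo_pos (hρ k) hu.continuous hpos x
  have cfk : ∀ k, Continuous (fk k) := fun k => (mo_contDiff (hρ k) cf).continuous
  have cgk : ∀ k, Continuous (gk k) := fun k => gg_cont hω (v3 k)
  have cgv : ∀ k, Continuous (gradient (v k)) := fun k => grad_cont (v1 k)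
  have gv : ∀ k, gradient (v k) = mo (ρ k) (gradient u) := fun k => funext fun x => mo_gradient (hρ k) hu x
  set zk : ℕ → EE N → ℝ × EE N × ℝ := fun k x => (v k x, gradient (v k) x, fk k x) with hzk
  set z : EE N → ℝ × EE N × ℝ := fun x => (u x, gradient u x, f x) with hz
  have hunif : TendstoUniformlyOn zk z Filter.atTop K := by
    have h1 := unif hu.continuous
    have h2 := unif hgu
    have h3 := unif cf
    rw [Metric.tendstoUniformlyOn_iff] at h1 h2 h3 ⊢
    intro d hd
    filter_upwards [h1 d hd, h2 d hd, h3 d hd] with k a b c x hx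
    simp only [hzk, hz, Prod.dist_eq, gv]
    exact max_lt (a x hx) (max_lt (b x hx) (c x hx))
  have cz : Continuous z := hu.continuous.prodMk (hgu.prodMk cf)
  set U : Set (EE N × (ℝ × EE N × ℝ)) := {q | 0 < q.2.1} with hU
  have oU : IsOpen U := isOpen_lt continuous_const (by fun_prop)
  set χ := chi δ with hχ
  have cχ : Continuous χ := (chi_contDiff δ).continuous
  have cχ' : Continuous (deriv χ) := (chi_contDiff δ).continuous_deriv (by norm_num)
  have cω : Continuous ω := hω.continuous
  have czt := hζ.continuous
  have cpw : ContinuousOn (fun q : EE N × (ℝ × EE N × ℝ) => q.2.1 ^ α) U :=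
    ContinuousOn.rpow_const (by fun_prop) fun q hq => Or.inl (ne_of_gt hq)
  have cinv : ContinuousOn (fun q : EE N × (ℝ × EE N × ℝ) => (q.2.1)⁻¹) U :=
    ContinuousOn.inv₀ (by fun_prop) fun q hq => (ne_of_gt hq)
  have ct : Continuous (fun q : EE N × (ℝ × EE N × ℝ) => ‖q.2.2.1‖ ^ 2) := by fun_prop
  -- coefficient functions
  set Af : EE N × (ℝ × EE N × ℝ) → ℝ := fun q => 
    χ (‖q.2.2.1‖ ^ 2) * ζ q.1 ^ 2 * q.2.1 ^ α * a1 + C * (deriv χ (‖q.2.2.1‖ ^ 2) * ζ q.1 ^ 2 * q.2.1 ^ α * ‖q.2.2.1‖ ^ 2) with hAf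
  set Bf : EE N × (ℝ × EE N × ℝ) → ℝ := fun q => 2 * Af q * q.2.2.2 +
    χ (‖q.2.2.1‖ ^ 2) * ζ q.1 ^ 2 * q.2.1 ^ α * c1 * (ω (‖q.2.2.1‖ ^ 2) * ‖q.2.2.1‖ ^ 2 * (q.2.1)⁻¹) with hBf
  set Hf : EE N × (ℝ × EE N × ℝ) → ℝ := fun q => BI a1 c1 c2 C α ω χ (ζ q.1) ‖gradient ζ q.1‖ q.2.1 (‖q.2.2.1‖ ^ 2) q.2.2.2 with hHf
  have cAf : ContinuousOn Af U := by
    have h1 := cχ.comp ct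
    have h2 := cχ'.comp ct
    have h3 : Continuous (fun q : EE N × (ℝ × EE N × ℝ) => ζ q.1 ^ 2) := by fun_prop
    exact ((((h1.mul h3).continuousOn.mul cpw).mul continuousOn_const).add
      (continuousOn_const.mul (((h2.mul h3).continuousOn.mul cpw).mul ct.continuousOn)))
  have cBf : ContinuousOn Bf U := by
    have h1 := cχ.comp ct
    have h3 : Continuous (fun q : EE N × (ℝ × EE N × ℝ) => ζ q.1 ^ 2) := by fun_prop
    have h4 := cω.comp ct
    have h5 : Continuous (fun q : EE N × (ℝ × EE N × ℝ) => q.2.2.2) := by fun_prop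
    exact ((continuousOn_const.mul cAf).mul h5.continuousOn).add
      ((((h1.mul h3).continuousOn.mul cpw).mul continuousOn_const).mul 
        ((h4.mul ct).continuousOn.mul cinv))
  have cHf : ContinuousOn Hf U := by
    have h1 := cχ.comp ct
    have h2 := cχ'.comp ct
    have h3 : Continuous (fun q : EE N × (ℝ × EE N × ℝ) => ζ q.1 ^ 2) := by fun_prop
    have h4 := cω.comp ct
    have h5 : Continuous (fun q : EE N × (ℝ × EE N × ℝ) => q.2.2.2) := by fun_prop
    have h6 : Continuous (fun q : EE N × (ℝ × EE N × ℝ) => ‖gradient ζ q.1‖ ^ 2) := by fun_prop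
    have h7 := (h4.mul ct).continuousOn.mul cinv
    have h8 := (h1.mul h3).continuousOn.mul cpw
    refine ((h8.mul (((continuousOn_const.mul (h5.pow 2).continuousOn).add ((continuousOn_const.mul h5.continuousOn).mul h7)).add
      (continuousOn_const.mul (h7.pow 2)))).add (continuousOn_const.mul ((((h1.continuousOn.mul cpw).mul (h4.pow 2).continuousOn).mul ct.continuousOn).mul h6.continuousOn))).add
      (continuousOn_const.mul ((((h2.mul h3).continuousOn.mul cpw).mul ct.continuousOn).mul ((h5.pow 2).continuousOn.add (h7.pow 2))))
  have hzU : ∀ x ∈ K, (x, z x) ∈ U := fun x _ => hpos x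
  have hζ0 : ∀ x, x ∉ K → ζ x = 0 := fun x hx => image_eq_zero_of_notMem_tsupport hx
  have hgζ0 : ∀ x, x ∉ K → gradient ζ x = 0 := fun x hx => grad_tsupport ζ hx
  have hH0 : ∀ x, x ∉ K → ∀ w, Hf (x, w) = 0 := by
    intro x hx w; simp [hHf, BI, hζ0 x hx, hgζ0 x hx]
  have czk : ∀ k, Continuous (fun x => (x, zk k x)) := fun k =>
    continuous_id.prodMk ((v1 k).continuous.prodMk ((cgv k).prodMk (cfk k)))
  have hzkU : ∀ k x, (x, zk k x) ∈ U := fun k x => vpos k x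
  have cHk : ∀ k, Continuous fun x => Hf (x, zk k x) := fun k =>
    cHf.comp_continuous (czk k) (hzkU k)
  have lim := lim_int hK oU cHf cz hzU hunif cHk hH0
  obtain ⟨M1, hM10, hM1⟩ := lim_bdd hK oU cAf cz hzU hunif
  obtain ⟨M2, hM20, hM2⟩ := lim_bdd hK oU cBf cz hzU hunif
  have hclose : ∀ᶠ k in Filter.atTop, ∀ x ∈ K, dist (gradient (v k) x) (gradient u x) < m := by
    have h2 := unif hgu
    rw [Metric.tendstoUniformlyOn_iff] at h2
    filter_upwards [h2 m hm0] with k h x hx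
    rw [gv, dist_comm]; exact h x hx
  set E : ℕ → ℝ := fun k => ∫ x, ϑ x ^ 2 * (gk k x - fk k x) ^ 2 with hE
  have limE : Filter.Tendsto E Filter.atTop (nhds 0) := by
    rw [Metric.tendsto_nhds]
    intro τ hτ
    obtain ⟨e0, he0, h⟩ := reg hp hl hm0 hA hu hpos hsol ϑ1 ϑc (fun x hx => (ϑsub hx).1) 
      (fun x hx => (ϑsub hx).2.le) hω hωe (half_pos hτ)
    filter_upwards [ek.eventually_lt_const he0] with k hk
    have h1 := h _ _ (hρ k) hk.le (hρA k)
    have h2 : 0 ≤ E k := integral_nonneg fun x => by positivity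
    rw [Real.dist_eq, sub_zero, abs_of_nonneg h2]
    exact lt_of_le_of_lt h1 (by linarith)
  set T := ∫ x, ϑ x ^ 2 with hT
  have iT : Integrable fun x => ϑ x ^ 2 := by
    have := ϑ1.continuous
    refine int_cc (by fun_prop) _ ϑc fun x hx => by rw [image_eq_zero_of_notMem_tsupport hx]; ring
  have main : ∀ σ : ℝ, 0 < σ → 0 ≤ (∫ x, Hf (x, z x)) + M2 * σ * T := by
    intro σ hσ
    have hl2 : Filter.Tendsto (fun k => (∫ x, Hf (x, zk k x)) + ((M1 + M2 / σ) * E k + M2 * σ * T)) Filter.atTop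
        (nhds ((∫ x, Hf (x, z x)) + ((M1 + M2 / σ) * 0 + M2 * σ * T))) :=
      lim.add ((limE.const_mul _).add_const _)
    rw [mul_zero, zero_add] at hl2
    refine ge_of_tendsto hl2 ?_
    filter_upwards [hM1, hM2, hclose] with k k1 k2 k3
    refine (H (v k) (v3 k) (vpos k)).trans ?_
    have iE : Integrable fun x => ϑ x ^ 2 * (gk k x - fk k x) ^ 2 := by
      have := ϑ1.continuous
      have := cgk k
      have := cfk k
      refine int_cc (by fun_prop) _ ϑc fun x hx => by rw [image_eq_zero_of_notMem_tsupport hx]; ring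
    have iH : Integrable fun x => Hf (x, zk k x) := int_cc (cHk k) K hK fun x hx => hH0 x hx _
    have i3 : Integrable fun x => (Hf (x, zk k x) + ((M1 + M2 / σ) * (ϑ x ^ 2 * (gk k x - fk k x) ^ 2) + M2 * σ * ϑ x ^ 2)) :=
      iH.add ((iE.const_mul _).add (iT.const_mul _))
    have e : (∫ x, Hf (x, zk k x)) + ((M1 + M2 / σ) * E k + M2 * σ * T) =
        ∫ x, (Hf (x, zk k x) + ((M1 + M2 / σ) * (ϑ x ^ 2 * (gk k x - fk k x) ^ 2) + M2 * σ * ϑ x ^ 2)) := by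
      have h3 : Integrable fun x => ((M1 + M2 / σ) * (ϑ x ^ 2 * (gk k x - fk k x) ^ 2) + M2 * σ * ϑ x ^ 2) :=
        (iE.const_mul _).add (iT.const_mul _)
      rw [integral_add iH h3, integral_add (iE.const_mul _) (iT.const_mul _), integral_const_mul, integral_const_mul]
    rw [e]
    have ptw : ∀ x, BI a1 c1 c2 C α ω χ (ζ x) ‖gradient ζ x‖ (v k x) (‖gradient (v k) x‖ ^ 2) (gg ω (v k) x)
        ≤ Hf (x, zk k x) + ((M1 + M2 / σ) * (ϑ x ^ 2 * (gk k x - fk k x) ^ 2) + M2 * σ * ϑ x ^ 2) := by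
      intro x
      have id1 : BI a1 c1 c2 C α ω χ (ζ x) ‖gradient ζ x‖ (v k x) (‖gradient (v k) x‖ ^ 2) (gg ω (v k) x)
          = Hf (x, zk k x) + (Af (x, zk k x) * (gk k x - fk k x) ^ 2 + Bf (x, zk k x) * (gk k x - fk k x)) := by
        simp only [hHf, hAf, hBf, BI, hzk, hgk, div_eq_mul_inv]; ring
      rw [id1]
      refine add_le_add le_rfl ?_
      have hr0 : 0 ≤ ((M1 + M2 / σ) * (ϑ x ^ 2 * (gk k x - fk k x) ^ 2) + M2 * σ * ϑ x ^ 2) := by positivity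
      by_cases hx : x ∈ K ∧ 2 * m ≤ ‖gradient u x‖
      · have h1 : ϑ x = 1 := hϑ1 x (hKV hx)
        rw [h1]
        set e := gk k x - fk k x
        have b1 := (abs_le.1 (k1 x hx.1)).2
        have b2 := k2 x hx.1
        have b3 : Bf (x, zk k x) * e ≤ M2 * |e| := by
          refine (le_abs_self _).trans ?_
          rw [abs_mul]; gcongr
        have b4 : |e| ≤ σ + e ^ 2 / σ := by
          rw [← sub_nonneg]
          have : σ + e ^ 2 / σ - |e| = (|e| ^ 2 + σ ^ 2 - |e| * σ) / σ := by
            rw [sq_abs]; field_simp; ring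
          rw [this]
          apply div_nonneg _ hσ.le
          nlinarith [sq_nonneg (|e| - σ), abs_nonneg e, mul_nonneg (abs_nonneg e) hσ.le]
        have b5 : Af (x, zk k x) * e ^ 2 ≤ M1 * e ^ 2 := by gcongr
        have b6 : M2 * |e| ≤ M2 * (σ + e ^ 2 / σ) := by gcongr
        calc _ ≤ M1 * e ^ 2 + M2 * (σ + e ^ 2 / σ) := by linarith
          _ = _ := by ring
      · have hz : Af (x, zk k x) = 0 ∧ Bf (x, zk k x) = 0 := by
          by_cases hxK : x ∈ K
          · have h1 : ‖gradient u x‖ < 2 * m := by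
              by_contra hcon; exact hx ⟨hxK, not_lt.1 hcon⟩
            have h2 := k3 x hxK
            have h3 : ‖gradient (v k) x‖ ≤ δ := by
              rw [dist_eq_norm] at h2
              have := norm_le_norm_add_norm_sub' (gradient (v k) x) (gradient u x)
              have : 3 * m = δ := by rw [hm]; ring
              linarith
            have h4 := chi_zero hδ (pow_le_pow_left₀ (norm_nonneg _) h3 2)
            simp [hAf, hBf, hzk, hχ, h4.1, h4.2]
          · simp [hAf, hBf, hζ0 x hxK]
        rw [hz.1, hz.2]; simpa using hr0
    have iB : Integrable fun x => BI a1 c1 c2 C α ω χ (ζ x) ‖gradient ζ x‖ (v k x) (‖gradient (v k) x‖ ^ 2) (gg ω (v k) x) := by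
      have this : Continuous (fun x => Hf (x, (v k x, gradient (v k) x, gk k x))) := cHf.comp_continuous (f := fun x => (x, (v k x, gradient (v k) x, gk k x))) (continuous_id.prodMk ((v1 k).continuous.prodMk ((cgv k).prodMk (cgk k)))) (fun x => vpos k x)
      exact int_cc this K hK (fun x hx => hH0 x hx (v k x, gradient (v k) x, gk k x))
    exact integral_mono iB i3 ptw
  have hfin : 0 ≤ ∫ x, Hf (x, z x) := by
    by_contra hcon
    push Not at hcon
    set Q := ∫ x, Hf (x, z x)
    have hT0 : 0 ≤ T := integral_nonneg fun x => by positivity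
    have := main (-Q / (2 * (M2 * T + 1))) (by apply div_pos <;> [linarith; positivity])
    have h2 : M2 * (-Q / (2 * (M2 * T + 1))) * T ≤ -Q / 2 := by
      rw [show M2 * (-Q / (2 * (M2 * T + 1))) * T = (-Q / 2) * (M2 * T / (M2 * T + 1)) by field_simp]
      have : M2 * T / (M2 * T + 1) ≤ 1 := by
        rw [div_le_one (by positivity)]; linarith
      have h3 : 0 ≤ -Q / 2 := by linarith
      nlinarith
    linarith
  exact hfin
end blim


section clim
variable {N : ℕ}

set_option maxHeartbeats 1000000 in
lemma int_ineq (hN : 1 ≤ N) {p α κ β q θ n : ℝ} (hp : 1 < p) (hθ : 0 < θ)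
    (hβ : β = 2 * κ - α) (hq : q * p = p - 1) (hn : n = 1 / N) :
    ∃ C : ℝ, 0 < C ∧ ∀ lam r : ℝ, 0 ≤ lam → ∀ u ζ : EE N → ℝ, ContDiff ℝ 1 u → (∀ x, 0 < u x) →
      IsSol p lam r u → ContDiff ℝ 1 ζ → HasCompactSupport ζ → tsupport ζ ⊆ ball 0 r →
      0 ≤ ∫ x, (ζ x ^ 2 * u x ^ α * ((1 - n + θ) * (u x ^ lam) ^ 2
            + (2 * κ * n - α + β * q) * u x ^ lam * (‖gradient u x‖ ^ p / u x)
            + (κ ^ 2 * (1 - n) - β * q * (α - 1) + θ) * (‖gradient u x‖ ^ p / u x) ^ 2)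
        + C * (u x ^ α * ‖gradient u x‖ ^ (2 * p - 2) * ‖gradient ζ x‖ ^ 2)) := by
  obtain ⟨C, hC, HB⟩ := bochner (N := N) (α := α) (κ := κ) hN hp hθ hβ hq hn
  refine ⟨C, hC, ?_⟩
  intro lam r hl u ζ hu hpos hsol hζ hζc hζs
  set a1 := 1 - n + θ with ha1
  set c1 := 2 * κ * n - α + β * q with hc1
  set c2 := κ ^ 2 * (1 - n) - β * q * (α - 1) + θ with hc2
  have ha1p : 0 ≤ a1 := by
    have : n ≤ 1 := by
      rw [hn, div_le_one (by exact_mod_cast hN)]; exact_mod_cast hN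
    rw [ha1]; linarith
  set K := tsupport ζ with hKdef
  have hK : IsCompact K := hζc
  have hgu := grad_cont hu
  have hgζ := grad_cont hζ
  have cζ := hζ.continuous
  have hζ0 : ∀ x, x ∉ K → ζ x = 0 := fun x hx => image_eq_zero_of_notMem_tsupport hx
  have hgζ0 : ∀ x, x ∉ K → gradient ζ x = 0 := fun x hx => grad_tsupport ζ hx
  have cf : Continuous fun y => u y ^ lam := hu.continuous.rpow_const fun x => Or.inr hl
  have ca : Continuous fun y => u y ^ α := hu.continuous.rpow_const fun x => Or.inl (hpos x).ne'
  have cs : Continuous fun y => ‖gradient u y‖ ^ p := hgu.norm.rpow_const fun x => Or.inr (by linarith)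
  have cs2 : Continuous fun y => ‖gradient u y‖ ^ (2 * p - 2) := hgu.norm.rpow_const fun x => Or.inr (by linarith)
  have cz : Continuous fun y => ‖gradient u y‖ ^ p / u y := cs.div hu.continuous fun x => (hpos x).ne'
  set P1 : EE N → ℝ := fun x => ζ x ^ 2 * u x ^ α * (a1 * (u x ^ lam) ^ 2
            + c1 * u x ^ lam * (‖gradient u x‖ ^ p / u x) + c2 * (‖gradient u x‖ ^ p / u x) ^ 2)
        + C * (u x ^ α * ‖gradient u x‖ ^ (2 * p - 2) * ‖gradient ζ x‖ ^ 2) with hP1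
  set P2 : EE N → ℝ := fun x => C * (ζ x ^ 2 * u x ^ α * ((u x ^ lam) ^ 2 + (‖gradient u x‖ ^ p / u x) ^ 2)) with hP2
  have cP1 : Continuous P1 := by
    exact (((cζ.pow 2).mul ca).mul (((continuous_const.mul (cf.pow 2)).add ((continuous_const.mul cf).mul cz)).add
      (continuous_const.mul (cz.pow 2)))).add (continuous_const.mul ((ca.mul cs2).mul (hgζ.norm.pow 2)))
  have cP2 : Continuous P2 := continuous_const.mul (((cζ.pow 2).mul ca).mul ((cf.pow 2).add (cz.pow 2)))
  have z1 : ∀ x, x ∉ K → P1 x = 0 := by intro x hx; simp [hP1, hζ0 x hx, hgζ0 x hx]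
  have z2 : ∀ x, x ∉ K → P2 x = 0 := by intro x hx; simp [hP2, hζ0 x hx]
  have i1 := int_cc cP1 K hK z1
  have i2 := int_cc cP2 K hK z2
  obtain ⟨B, hB0, hB⟩ := chi_tderiv
  set G : ℝ → EE N → ℝ := fun δ x => chi δ (‖gradient u x‖ ^ 2) * P1 x
    + deriv (chi δ) (‖gradient u x‖ ^ 2) * ‖gradient u x‖ ^ 2 * P2 x with hG
  have hnn : ∀ δ : ℝ, 0 < δ → 0 ≤ ∫ x, G δ x := by
    intro δ hδ
    obtain ⟨ω, hω, hωe, hωd⟩ := om_exists p (m := δ / 3) (by positivity)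
    have := blim_core (a1 := a1) (c1 := c1) (c2 := c2) (C := C) (α := α) hp hl hδ hω hωe hu hpos hsol hζ hζc hζs ?_
    · refine this.trans (le_of_eq (integral_congr_ae (Filter.Eventually.of_forall fun x => ?_)))
      simp only [BI, hG, hP1, hP2]
      rcases le_total (‖gradient u x‖) δ with h | h
      · have h4 := chi_zero hδ (pow_le_pow_left₀ (norm_nonneg _) h 2)
        rw [h4.1, h4.2]; ring
      · have h1 : ω (‖gradient u x‖ ^ 2) = ‖gradient u x‖ ^ (p - 2) := hωe _ (by linarith)
        have hs : 0 < ‖gradient u x‖ := lt_of_lt_of_le hδ h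
        have h2 : ‖gradient u x‖ ^ (p - 2) * ‖gradient u x‖ ^ 2 = ‖gradient u x‖ ^ p := by
          rw [← Real.rpow_natCast, ← Real.rpow_add hs]; congr 1; push_cast; ring
        have h3 : (‖gradient u x‖ ^ (p - 2)) ^ 2 * ‖gradient u x‖ ^ 2 = ‖gradient u x‖ ^ (2 * p - 2) := by
          rw [← mul_pow, ← Real.rpow_natCast, ← Real.rpow_add_one hs.ne', ← Real.rpow_mul hs.le]; congr 1; push_cast; ring
        rw [h1, h2, ← h3]; ring
    · intro v hv hvpos
      refine (HB ω (chi δ) hω (chi_contDiff δ) (chi_nonneg δ) (chi_deriv_nonneg δ) ?_ v ζ hv hvpos hζ hζc)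
      intro t
      rcases le_or_gt t (δ ^ 2) with h | h
      · exact Or.inl (chi_zero hδ h)
      · refine Or.inr ⟨lt_trans (by positivity) h, hωd t (lt_of_le_of_lt ?_ h)⟩
        exact pow_le_pow_left₀ (by positivity) (by linarith) 2
  set G0 : EE N → ℝ := fun x => if gradient u x = 0 then 0 else P1 x with hG0
  have hlim : Filter.Tendsto (fun k : ℕ => ∫ x, G (1 / ((k : ℝ) + 1)) x) Filter.atTop (nhds (∫ x, G0 x)) := by
    have ek : Filter.Tendsto (fun k : ℕ => 1 / ((k : ℝ) + 1)) Filter.atTop (nhds 0) :=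
      tendsto_one_div_add_atTop_nhds_zero_nat
    refine tendsto_integral_of_dominated_convergence (fun x => |P1 x| + B * |P2 x|) ?_ ?_ ?_ ?_
    · intro k
      have h1 := (chi_contDiff (1 / ((k : ℝ) + 1))).continuous
      have h2 := (chi_contDiff (1 / ((k : ℝ) + 1))).continuous_deriv (by norm_num)
      have : Continuous (G (1 / ((k : ℝ) + 1))) := by fun_prop
      exact this.aestronglyMeasurable
    · exact i1.abs.add (i2.abs.const_mul _)
    · intro k
      refine Filter.Eventually.of_forall fun x => ?_
      have hk : (0:ℝ) < 1 / ((k : ℝ) + 1) := by positivity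
      rw [Real.norm_eq_abs]
      refine (abs_add_le _ _).trans (add_le_add ?_ ?_)
      · rw [abs_mul, abs_of_nonneg (chi_nonneg _ _)]
        exact mul_le_of_le_one_left (abs_nonneg _) (chi_le_one _ _)
      · rw [abs_mul]; gcongr; exact hB _ _ hk
    · refine Filter.Eventually.of_forall fun x => ?_
      by_cases h : gradient u x = 0
      · have : ∀ k : ℕ, G (1 / ((k : ℝ) + 1)) x = G0 x := by
          intro k
          have hk : (0:ℝ) < 1 / ((k : ℝ) + 1) := by positivity
          have := chi_zero (t := 0) hk (by positivity)
          simp only [hG, hG0, h, norm_zero, if_true, ne_eq, OfNat.ofNat_ne_zero, not_false_eq_true, zero_pow, this.1]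
          ring
        simp only [this]; exact tendsto_const_nhds
      · refine Filter.Tendsto.congr' ?_ tendsto_const_nhds
        have hs : 0 < ‖gradient u x‖ := norm_pos_iff.2 h
        filter_upwards [ek.eventually_lt_const (half_pos hs)] with k hk
        have hk0 : (0:ℝ) < 1 / ((k : ℝ) + 1) := by positivity
        have := chi_one (t := ‖gradient u x‖ ^ 2) hk0 (by
          have := pow_le_pow_left₀ hk0.le hk.le 2
          nlinarith)
        simp only [hG, hG0, h, this.1, this.2, if_false]; ring
  have h0 : 0 ≤ ∫ x, G0 x := ge_of_tendsto hlim (Filter.Eventually.of_forall fun k => hnn _ (by positivity))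
  refine h0.trans ?_
  have hle : ∀ x, G0 x ≤ P1 x := by
    intro x
    by_cases h : gradient u x = 0
    · have h2 : (0:ℝ) ^ p = 0 := Real.zero_rpow (by linarith)
      have h3 : (0:ℝ) ^ (2 * p - 2) = 0 := Real.zero_rpow (by linarith)
      have hp0 := (hpos x).le
      simp only [hG0, hP1, h, if_true, norm_zero, h2, h3]
      have : 0 ≤ u x ^ α := by positivity
      simp only [zero_div, mul_zero, zero_mul, add_zero, ne_eq, OfNat.ofNat_ne_zero, not_false_eq_true, zero_pow]
      positivity
    · simp only [hG0, h, if_false]; exact le_rfl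
  refine integral_mono_ae ?_ i1 (Filter.Eventually.of_forall hle)
  refine Integrable.mono' i1.abs ?_ (Filter.Eventually.of_forall fun x => ?_)
  · exact (Measurable.ite (measurableSet_eq_fun hgu.measurable measurable_const) measurable_const cP1.measurable).aestronglyMeasurable
  · by_cases h : gradient u x = 0
    · simp [hG0, h]
    · simp [hG0, h]
end clim


section expo

lemma expo_sigma {Nr p α : ℝ} (hp : 1 < p) (h : p < Nr → -α * (Nr - p) < Nr * (p - 1)) :
    0 ≤ α + 2 * p - 2 ∨ ∃ σ : ℝ, 0 < σ ∧ Nr - p < σ * (p - 1) ∧ Nr - 2 * p - (α + 2 * p - 2) * σ < 0 := by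
  by_cases h0 : 0 ≤ α + 2 * p - 2
  · exact Or.inl h0
  refine Or.inr ?_
  push Not at h0
  set e := -(α + 2 * p - 2) with he
  have he0 : 0 < e := by linarith
  have key : max 0 ((Nr - p) / (p - 1)) < (2 * p - Nr) / e := by
    rcases lt_or_ge p Nr with hN | hN
    · have h1 := h hN
      have h2 : e * (Nr - p) < (2 * p - Nr) * (p - 1) := by rw [he]; linarith
      have h4 : (Nr - p) / (p - 1) < (2 * p - Nr) / e := by
        rw [div_lt_div_iff₀ (by linarith) he0]; linarith
      exact max_lt (lt_trans (div_pos (by linarith) (by linarith)) h4) h4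
    · have h3 : 0 < (2 * p - Nr) / e := div_pos (by linarith) he0
      exact max_lt h3 (lt_of_le_of_lt (div_nonpos_of_nonpos_of_nonneg (by linarith) (by linarith)) h3)
  obtain ⟨σ, h1, h2⟩ := exists_between key
  have h3 := lt_of_le_of_lt (le_max_left _ _) h1
  have h4 := lt_of_le_of_lt (le_max_right _ _) h1
  refine ⟨σ, h3, ?_, ?_⟩
  · rwa [div_lt_iff₀ (by linarith)] at h4
  · rw [lt_div_iff₀ he0] at h2
    rw [show α + 2 * p - 2 = -e by rw [he]; ring]; linarith

lemma expo (N : ℕ) (hN : 1 ≤ N) {p lam : ℝ} (hp : 1 < p) (hlam₁ : p - 1 < lam)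
    (hlam₂ : (N : ℝ) > p → lam < ((N : ℝ) * (p - 1) + p) / ((N : ℝ) - p)) :
    ∃ α κ β q n : ℝ, β = 2 * κ - α ∧ q * p = p - 1 ∧ n = 1 / N ∧
      (1 - n) * lam + β * (n + q) < 0 ∧ κ ^ 2 * (1 - n) - β * q * (α - 1) < 0 ∧
      0 < α + lam + p - 1 ∧ N * (lam + 1 - p) < p * (α + 2 * lam) ∧
      (0 ≤ α + 2 * p - 2 ∨ ∃ σ : ℝ, 0 < σ ∧ (N:ℝ) - p < σ * (p - 1) ∧ N - 2 * p - (α + 2 * p - 2) * σ < 0) := by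
  set q := (p - 1) / p with hq
  have hqp : q * p = p - 1 := by rw [hq]; field_simp
  have hq0 : 0 < q := by rw [hq]; apply div_pos <;> linarith
  have hl0 : 0 < lam := by linarith
  have hq1 : q < 1 := by rw [hq, div_lt_one (by linarith)]; linarith
  rcases Nat.eq_or_lt_of_le hN with h1 | h2
  · subst h1
    refine ⟨1 / 2, 0, - (1 / 2), q, 1, by norm_num, hqp, by norm_num, ?_, ?_, ?_, ?_, Or.inl ?_⟩ <;> push_cast <;> nlinarith
  set Nr : ℝ := (N : ℝ) with hNr
  have hNr2 : 2 ≤ Nr := by rw [hNr]; exact_mod_cast h2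
  set n := 1 / Nr with hn
  have hNn : Nr * n = 1 := by rw [hn]; field_simp
  have hn0 : 0 < n := by positivity
  have hn1 : n < 1 := by rw [hn, div_lt_one (by linarith)]; linarith
  have hS : 0 < p + Nr * (p - 1) - lam * (Nr - p) := by
    rcases lt_or_ge p Nr with h | h
    · have := hlam₂ h
      rw [lt_div_iff₀ (by linarith)] at this; linarith
    · have : 0 ≤ lam * (p - Nr) := mul_nonneg hl0.le (by linarith)
      have : 0 ≤ Nr * (p - 1) := mul_nonneg (by linarith) (by linarith)
      nlinarith
  have hD : 0 < n + q := by linarith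
  have hm : 0 < 1 - n := by linarith
  set b0 := (1 - n) * lam / (n + q) with hb0
  have hb0D : b0 * (n + q) = (1 - n) * lam := by rw [hb0]; field_simp
  have hb00 : 0 < b0 := by positivity
  set A := 1 - 2 * q / (1 - n) with hA
  have hAD : b0 * A * (n + q) = lam * (1 - n - 2 * q) := by
    rw [mul_right_comm, hb0D, hA]; field_simp
  have hpp : 0 < p := by linarith
  have hNp : 0 < Nr * p := by positivity
  have eD : Nr * p * (n + q) = p + Nr * (p - 1) := by
    calc _ = (Nr * n) * p + Nr * (q * p) := by ring
      _ = _ := by rw [hNn, hqp]; ring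
  have eq2 : Nr * p * (1 - n - 2 * q) = - (Nr * (p - 1)) + (Nr - p) := by
    calc _ = Nr * p - (Nr * n) * p - 2 * Nr * (q * p) := by ring
      _ = _ := by rw [hNn, hqp]; ring
  have eq1 : Nr * p * (1 - n - q) = Nr - p := by
    calc _ = Nr * p - (Nr * n) * p - Nr * (q * p) := by ring
      _ = _ := by rw [hNn, hqp]; ring
  have c2 : b0 * (1 - q / (1 - n)) < 1 := by
    have e : b0 * (1 - q / (1 - n)) * (Nr * p * (n + q)) = lam * (Nr - p) := by
      calc _ = b0 * (n + q) * (1 - q / (1 - n)) * (Nr * p) := by ring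
        _ = lam * (Nr * p * (1 - n - q)) := by rw [hb0D]; field_simp
        _ = _ := by rw [eq1]
    have : 0 < Nr * p * (n + q) := by positivity
    by_contra hcon
    push Not at hcon
    have := mul_le_mul_of_nonneg_right hcon this.le
    rw [e, eD] at this; linarith
  have c3 : 0 < b0 * A + lam + p - 1 := by
    have e : (b0 * A + lam + p - 1) * (n + q) = lam * (1 - q) + (p - 1) * (n + q) := by
      calc _ = b0 * A * (n + q) + (lam + p - 1) * (n + q) := by ring
        _ = _ := by rw [hAD]; ring
    have : 0 < (b0 * A + lam + p - 1) * (n + q) := by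
      rw [e]; have : 0 < 1 - q := by linarith
      have : 0 < p - 1 := by linarith
      positivity
    exact pos_of_mul_pos_left this hD.le
  have c4 : Nr * (lam + 1 - p) < p * (b0 * A + 2 * lam) := by
    have e : (p * (b0 * A + 2 * lam) - Nr * (lam + 1 - p)) * (n + q) * p
        = (p - 1) * (p + Nr * (p - 1) - lam * (Nr - p)) + p ^ 2 * lam * n := by
      have e2 : (p * (b0 * A + 2 * lam)) * (n + q) = p * lam * (1 + n) := by
        calc _ = p * (b0 * A * (n + q) + 2 * lam * (n + q)) := by ring
          _ = _ := by rw [hAD]; ring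
      calc _ = ((p * (b0 * A + 2 * lam)) * (n + q)) * p - (lam + 1 - p) * (Nr * p * (n + q)) := by ring
        _ = _ := by rw [e2, eD]; ring
    have : 0 < (p * (b0 * A + 2 * lam) - Nr * (lam + 1 - p)) * (n + q) * p := by
      rw [e]; have : 0 < p - 1 := by linarith
      positivity
    have := pos_of_mul_pos_left (pos_of_mul_pos_left this hpp.le) hD.le
    linarith
  have c5 : -(b0 * A) * (Nr - p) < Nr * (p - 1) := by
    have e : (Nr * (p - 1) + b0 * A * (Nr - p)) * (n + q) * (Nr * p)
        = Nr * (p - 1) * (p + Nr * (p - 1) - lam * (Nr - p)) + lam * (Nr - p) ^ 2 := by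
      calc _ = Nr * (p - 1) * (Nr * p * (n + q)) + b0 * A * (n + q) * (Nr - p) * (Nr * p) := by ring
        _ = Nr * (p - 1) * (Nr * p * (n + q)) + lam * (Nr - p) * (Nr * p * (1 - n - 2 * q)) := by rw [hAD]; ring
        _ = _ := by rw [eD, eq2]; ring
    have : 0 < (Nr * (p - 1) + b0 * A * (Nr - p)) * (n + q) * (Nr * p) := by
      rw [e]; have : 0 < p - 1 := by linarith
      have : 0 < Nr := by linarith
      positivity
    have := pos_of_mul_pos_left (pos_of_mul_pos_left this hNp.le) hD.le
    linarith
  have ev : ∀ᶠ b in nhdsWithin b0 (Set.Ioi b0), b0 < b ∧ b * (1 - q / (1 - n)) < 1 ∧ 0 < b * A + lam + p - 1 ∧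
      Nr * (lam + 1 - p) < p * (b * A + 2 * lam) ∧ -(b * A) * (Nr - p) < Nr * (p - 1) := by
    refine Filter.Eventually.and self_mem_nhdsWithin (nhdsWithin_le_nhds ?_)
    have g2 : ∀ᶠ b in nhds b0, b * (1 - q / (1 - n)) < 1 :=
      ContinuousAt.eventually_lt (f := fun b : ℝ => b * (1 - q / (1 - n))) (g := fun _ => 1) (by fun_prop) continuousAt_const c2
    have g3 : ∀ᶠ b in nhds b0, 0 < b * A + lam + p - 1 :=
      ContinuousAt.eventually_lt (f := fun _ : ℝ => (0:ℝ)) (g := fun b => b * A + lam + p - 1) continuousAt_const (by fun_prop) c3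
    have g4 : ∀ᶠ b in nhds b0, Nr * (lam + 1 - p) < p * (b * A + 2 * lam) :=
      ContinuousAt.eventually_lt (f := fun _ : ℝ => Nr * (lam + 1 - p)) (g := fun b => p * (b * A + 2 * lam)) continuousAt_const (by fun_prop) c4
    have g5 : ∀ᶠ b in nhds b0, -(b * A) * (Nr - p) < Nr * (p - 1) :=
      ContinuousAt.eventually_lt (f := fun b : ℝ => -(b * A) * (Nr - p)) (g := fun _ => Nr * (p - 1)) (by fun_prop) continuousAt_const c5
    exact g2.and (g3.and (g4.and g5))
  obtain ⟨b, hb, d2, d3, d4, d5⟩ := ev.exists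
  have hbp : 0 < b := by linarith
  refine ⟨b * A, -(b * q / (1 - n)), -b, q, n, ?_, hqp, rfl, ?_, ?_, d3, d4, expo_sigma hp fun _ => d5⟩
  · rw [hA]; field_simp; ring
  · have := mul_lt_mul_of_pos_right hb hD
    rw [hb0D] at this; linarith
  · have e : (-(b * q / (1 - n))) ^ 2 * (1 - n) - -b * q * (b * A - 1) = b * q * (b * (1 - q / (1 - n)) - 1) := by
      rw [hA]; field_simp; ring
    rw [e]
    exact mul_neg_of_pos_of_neg (by positivity) (by linarith)
end expo


section yng

lemma yng {E e σ : ℝ} (he : 0 ≤ e) (hE : e < E) (hσ : 0 < σ) : ∃ C : ℝ, 0 < C ∧ ∀ X Y : ℝ, 0 ≤ X → 0 ≤ Y →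
    X ^ e * Y ^ (E - e) ≤ σ * X ^ E + C * Y ^ E := by
  set τ := σ ^ (1 / (E - e)) with hτ
  have hd : 0 < E - e := by linarith
  have hτ0 : 0 < τ := Real.rpow_pos_of_pos hσ _
  have hτσ : τ ^ (E - e) = σ := by
    rw [hτ, ← Real.rpow_mul hσ.le, one_div, inv_mul_cancel₀ hd.ne', Real.rpow_one]
  refine ⟨(1 / τ) ^ e, by positivity, fun X Y hX hY => ?_⟩
  have hE0 : e + (E - e) ≠ 0 := by linarith
  rcases le_total Y (τ * X) with h | h
  · calc X ^ e * Y ^ (E - e) ≤ X ^ e * (τ * X) ^ (E - e) := by gcongr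
      _ = σ * X ^ E := by
        rw [Real.mul_rpow hτ0.le hX, hτσ]
        have : X ^ e * X ^ (E - e) = X ^ E := by
          rw [← Real.rpow_add' hX hE0]; congr 1; ring
        rw [← this]; ring
      _ ≤ _ := by have : 0 ≤ (1 / τ) ^ e * Y ^ E := by positivity
                  linarith
  · calc X ^ e * Y ^ (E - e) ≤ (1 / τ * Y) ^ e * Y ^ (E - e) := by
          gcongr; rw [one_div, ← div_eq_inv_mul, le_div_iff₀ hτ0]; linarith
      _ = (1 / τ) ^ e * Y ^ E := by
        rw [Real.mul_rpow (by positivity) hY, mul_assoc, ← Real.rpow_add' hY hE0]; congr 2; ring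
      _ ≤ _ := by have : 0 ≤ σ * X ^ E := by positivity
                  linarith

lemma wpow {w D m : ℝ} {k : ℕ} (hw : 0 < w) (hw1 : w ≤ 1) (hD : 0 ≤ D) (hk : m ≤ 2 * k) :
    (w ^ k) ^ 2 * (D / w) ^ m ≤ D ^ m := by
  rw [Real.div_rpow hD hw.le, ← pow_mul, ← Real.rpow_natCast, mul_div_assoc', div_le_iff₀ (by positivity), mul_comm]
  gcongr ?_ * ?_
  refine Real.rpow_le_rpow_of_exponent_ge hw hw1 ?_
  push_cast; linarith

set_option maxHeartbeats 1000000 in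
lemma young_all {p lam α m σ : ℝ} {k : ℕ} (hp : 1 < p) (hl : p - 1 < lam) (he1 : 0 < α + lam + p - 1)
    (hm : m = p * (α + 2 * lam) / (lam + 1 - p)) (hk2 : 2 ≤ k) (hkm : m ≤ 2 * k) (hkp : 2 * p ≤ 2 * k) (hσ : 0 < σ) :
    ∃ C : ℝ, 0 < C ∧ ∀ u s w g D B : ℝ, 0 < u → 0 ≤ s → 0 ≤ w → w ≤ 1 → 0 ≤ g → 0 ≤ D → 0 ≤ B →
      g ≤ D * w ^ (k - 1) → (0 ≤ α + 2 * p - 2 ∨ u ^ (α + 2 * p - 2) ≤ B) →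
      2 * (u ^ (α + lam) * s ^ (p - 1) * w ^ k * g) + u ^ α * s ^ (2 * p - 2) * g ^ 2 ≤
        σ * ((w ^ k) ^ 2 * u ^ α * (u ^ lam) ^ 2 + (w ^ k) ^ 2 * u ^ α * (u ^ lam * (s ^ p / u))
          + (w ^ k) ^ 2 * u ^ α * (s ^ p / u) ^ 2) + C * (D ^ m + D ^ (2 * p) * B) := by
  set E := α + 2 * lam with hE
  set e1 := α + lam + p - 1 with he1d
  set e2 := α + 2 * p - 2 with he2d
  have hd : 0 < lam + 1 - p := by linarith
  obtain ⟨C1, hC1, Y1⟩ := yng (E := p) (e := p - 1) (σ := σ / 2) (by linarith) (by linarith) (by linarith)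
  obtain ⟨C2, hC2, Y2⟩ := yng (E := 2 * p) (e := 2 * p - 2) (σ := σ) (by linarith) (by linarith) (by linarith)
  obtain ⟨C3, hC3, Y3⟩ := yng (E := E) (e := e1) (σ := σ / (4 * C1)) (by linarith) (by linarith) (by positivity)
  obtain ⟨C4, hC4, Y4⟩ : ∃ C4 : ℝ, 0 < C4 ∧ (0 ≤ e2 → ∀ X Y : ℝ, 0 ≤ X → 0 ≤ Y → X ^ e2 * Y ^ (E - e2) ≤ σ / (2 * C2) * X ^ E + C4 * Y ^ E) := by
    by_cases h : 0 ≤ e2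
    · obtain ⟨C4, h4, h5⟩ := yng (E := E) (e := e2) (σ := σ / (2 * C2)) h (by linarith) (by positivity)
      exact ⟨C4, h4, fun _ => h5⟩
    · exact ⟨1, one_pos, fun h' => absurd h' h⟩
  refine ⟨2 * C1 * C3 + C2 * C4 + C2, by positivity, ?_⟩
  intro u s w g D B hu hs hw hw1 hg hD hB hgD hcase
  have hDm : 0 ≤ D ^ m := by positivity
  have hDB : 0 ≤ D ^ (2 * p) * B := by positivity
  rcases hw.eq_or_lt with h0 | hw0
  · have hk0 : k - 1 ≠ 0 := by omega
    have : g = 0 := le_antisymm (by rw [← h0, zero_pow hk0, mul_zero] at hgD; exact hgD) hg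
    rw [this]
    have : 0 ≤ σ * ((w ^ k) ^ 2 * u ^ α * (u ^ lam) ^ 2 + (w ^ k) ^ 2 * u ^ α * (u ^ lam * (s ^ p / u))
          + (w ^ k) ^ 2 * u ^ α * (s ^ p / u) ^ 2) + (2 * C1 * C3 + C2 * C4 + C2) * (D ^ m + D ^ (2 * p) * B) := by positivity
    simpa using this
  set ζ := w ^ k with hζ
  have hζ0 : 0 < ζ := by positivity
  set d := D / w with hdd
  have hd0 : 0 ≤ d := by positivity
  have hg2 : g ≤ d * ζ := by
    refine hgD.trans (le_of_eq ?_)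
    rw [hdd, hζ, ← Nat.sub_add_cancel (show 1 ≤ k by omega)]
    simp only [Nat.add_sub_cancel, pow_succ]; field_simp
  set F0 := ζ ^ 2 * u ^ α * (u ^ lam) ^ 2 with hF0
  set J0 := ζ ^ 2 * u ^ α * (u ^ lam * (s ^ p / u)) with hJ0
  set K0 := ζ ^ 2 * u ^ α * (s ^ p / u) ^ 2 with hK0
  have eF : F0 = ζ ^ 2 * u ^ E := by
    rw [hF0, hE, Real.rpow_add hu, two_mul, Real.rpow_add hu]; ring
  have hY : 0 ≤ u * d := by positivity
  -- term 1
  have t1 : u ^ (α + lam) * s ^ (p - 1) * ζ * g ≤ σ / 2 * J0 + C1 * (ζ ^ 2 * (u ^ e1 * d ^ p)) := by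
    have h1 := Y1 s (u * d) hs hY
    rw [show p - (p - 1) = 1 by ring, Real.rpow_one] at h1
    calc u ^ (α + lam) * s ^ (p - 1) * ζ * g ≤ u ^ (α + lam) * s ^ (p - 1) * ζ * (d * ζ) := by gcongr
      _ = ζ ^ 2 * u ^ (α + lam - 1) * (s ^ (p - 1) * (u * d)) := by
        rw [Real.rpow_sub_one hu.ne']; field_simp
      _ ≤ ζ ^ 2 * u ^ (α + lam - 1) * (σ / 2 * s ^ p + C1 * (u * d) ^ p) := by gcongr
      _ = _ := by
        rw [hJ0, Real.mul_rpow hu.le hd0, he1d, show α + lam + p - 1 = (α + lam - 1) + p by ring, Real.rpow_add hu (α + lam - 1) p, Real.rpow_sub_one hu.ne', Real.rpow_add hu]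
        ring
  have t2 : u ^ α * s ^ (2 * p - 2) * g ^ 2 ≤ σ * K0 + C2 * (ζ ^ 2 * (u ^ e2 * d ^ (2 * p))) := by
    have h1 := Y2 s (u * d) hs hY
    rw [show 2 * p - (2 * p - 2) = 2 by ring, Real.rpow_two] at h1
    have h2 : u ^ α = u ^ (α - 2) * u ^ 2 := by
      rw [← Real.rpow_natCast, ← Real.rpow_add hu]; congr 1; push_cast; ring
    calc u ^ α * s ^ (2 * p - 2) * g ^ 2 ≤ u ^ α * s ^ (2 * p - 2) * (d * ζ) ^ 2 := by gcongr
      _ = ζ ^ 2 * u ^ (α - 2) * (s ^ (2 * p - 2) * (u * d) ^ 2) := by rw [h2]; ring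
      _ ≤ ζ ^ 2 * u ^ (α - 2) * (σ * s ^ (2 * p) + C2 * (u * d) ^ (2 * p)) := by gcongr
      _ = _ := by
        have h3 : s ^ (2 * p) = (s ^ p) ^ 2 := by
          rw [← Real.rpow_natCast, ← Real.rpow_mul hs]; congr 1; push_cast; ring
        rw [hK0, Real.mul_rpow hu.le hd0, he2d, show α + 2 * p - 2 = (α - 2) + 2 * p by ring, Real.rpow_add hu (α - 2) (2 * p), h2, h3]
        field_simp
  have hZ : ∀ a : ℝ, (d ^ (p / (lam + 1 - p))) ^ a = d ^ (p * a / (lam + 1 - p)) := by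
    intro a; rw [← Real.rpow_mul hd0]; congr 1; ring
  have hZ0 : 0 ≤ d ^ (p / (lam + 1 - p)) := by positivity
  have t3 : ζ ^ 2 * (u ^ e1 * d ^ p) ≤ σ / (4 * C1) * F0 + C3 * D ^ m := by
    have h1 := Y3 u (d ^ (p / (lam + 1 - p))) hu.le hZ0
    rw [hZ, hZ, show E - e1 = lam + 1 - p by rw [hE, he1d]; ring, mul_div_assoc, div_self hd.ne', mul_one, ← hm] at h1
    calc _ ≤ ζ ^ 2 * (σ / (4 * C1) * u ^ E + C3 * d ^ m) := by gcongr
      _ = σ / (4 * C1) * F0 + C3 * (ζ ^ 2 * d ^ m) := by rw [eF]; ring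
      _ ≤ _ := by
        have := wpow (m := m) hw0 hw1 hD hkm
        gcongr
  have t4 : ζ ^ 2 * (u ^ e2 * d ^ (2 * p)) ≤ σ / (2 * C2) * F0 + C4 * D ^ m + D ^ (2 * p) * B := by
    rcases hcase with h | h
    · have h1 := Y4 h u (d ^ (p / (lam + 1 - p))) hu.le hZ0
      rw [hZ, hZ, show p * (E - e2) / (lam + 1 - p) = 2 * p by rw [hE, he2d]; field_simp; ring, ← hm] at h1
      calc _ ≤ ζ ^ 2 * (σ / (2 * C2) * u ^ E + C4 * d ^ m) := by gcongr
        _ = σ / (2 * C2) * F0 + C4 * (ζ ^ 2 * d ^ m) := by rw [eF]; ring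
        _ ≤ σ / (2 * C2) * F0 + C4 * D ^ m := by
          have := wpow (m := m) hw0 hw1 hD hkm
          gcongr
        _ ≤ _ := by linarith
    · have := wpow (m := 2 * p) hw0 hw1 hD hkp
      calc ζ ^ 2 * (u ^ e2 * d ^ (2 * p)) = (ζ ^ 2 * d ^ (2 * p)) * u ^ e2 := by ring
        _ ≤ D ^ (2 * p) * B := by gcongr
        _ ≤ _ := by
          have : 0 ≤ σ / (2 * C2) * F0 + C4 * D ^ m := by positivity
          linarith
  have t3' := mul_le_mul_of_nonneg_left t3 (by positivity : 0 ≤ 2 * C1)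
  have t4' := mul_le_mul_of_nonneg_left t4 hC2.le
  have r1 : 2 * C1 * (σ / (4 * C1) * F0 + C3 * D ^ m) = σ / 2 * F0 + 2 * C1 * C3 * D ^ m := by field_simp; ring
  have r2 : C2 * (σ / (2 * C2) * F0 + C4 * D ^ m + D ^ (2 * p) * B) = σ / 2 * F0 + C2 * C4 * D ^ m + C2 * (D ^ (2 * p) * B) := by
    field_simp
  rw [r1] at t3'
  rw [r2] at t4'
  have x1 : 0 ≤ 2 * C1 * C3 * (D ^ (2 * p) * B) := by positivity
  have x2 : 0 ≤ C2 * C4 * (D ^ (2 * p) * B) := by positivity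
  have x3 : 0 ≤ C2 * D ^ m := by positivity
  linarith
end yng


section energy
variable {N : ℕ}

lemma energy_test {p lam α r : ℝ} (hp : 1 < p) (hl : 0 ≤ lam) {u ζ : EE N → ℝ} (hu : ContDiff ℝ 1 u)
    (hpos : ∀ x, 0 < u x) (hsol : IsSol p lam r u) (hζ : ContDiff ℝ 1 ζ) (hζ0 : ∀ x, 0 ≤ ζ x) (hζc : HasCompactSupport ζ)
    (hζs : tsupport ζ ⊆ ball 0 r) :
    ∃ X : ℝ, |X| ≤ ∫ x, 2 * (u x ^ (α + lam) * ‖gradient u x‖ ^ (p - 1) * ζ x * ‖gradient ζ x‖) ∧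
      ∫ x, ζ x ^ 2 * u x ^ α * (u x ^ lam) ^ 2 =
        (α + lam) * (∫ x, ζ x ^ 2 * u x ^ α * (u x ^ lam * (‖gradient u x‖ ^ p / u x))) + X := by
  set φ : EE N → ℝ := fun x => u x ^ (α + lam) * ζ x ^ 2 with hφ
  have cup : ContDiff ℝ 1 (fun x => u x ^ (α + lam)) := hu.rpow_const_of_ne fun x => (hpos x).ne'
  have cφ : ContDiff ℝ 1 φ := cup.mul (hζ.pow 2)
  have hK : IsCompact (tsupport ζ) := hζc
  have z0 : ∀ x, x ∉ tsupport ζ → ζ x = 0 := fun x hx => image_eq_zero_of_notMem_tsupport hx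
  have g0 : ∀ x, x ∉ tsupport ζ → gradient ζ x = 0 := fun x hx => grad_tsupport ζ hx
  have hgu := grad_cont hu
  have hgζ := grad_cont hζ
  have cζ := hζ.continuous
  have cV : Continuous fun x => Phi p (gradient u x) := (Phi_cont hp).comp hgu
  have cf : Continuous fun y => u y ^ lam := hu.continuous.rpow_const fun x => Or.inr hl
  have ca : Continuous fun y => u y ^ α := hu.continuous.rpow_const fun x => Or.inl (hpos x).ne'
  have cs : Continuous fun y => ‖gradient u y‖ ^ p := hgu.norm.rpow_const fun x => Or.inr (by linarith)
  have cs1 : Continuous fun y => ‖gradient u y‖ ^ (p - 1) := hgu.norm.rpow_const fun x => Or.inr (by linarith)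
  have cz : Continuous fun y => ‖gradient u y‖ ^ p / u y := cs.div hu.continuous fun x => (hpos x).ne'
  have cuc := cup.continuous
  have hφt : tsupport φ ⊆ tsupport ζ := by
    refine closure_minimal ?_ (isClosed_tsupport _)
    intro x hx
    by_contra h
    exact hx (by simp [hφ, z0 x h])
  have hφc : HasCompactSupport φ := HasCompactSupport.of_support_subset_isCompact hK (subset_closure.trans hφt)
  have ht := hsol φ cφ hφc (hφt.trans hζs)
  have hgφ : ∀ x, gradient φ x = (ζ x ^ 2 * ((α + lam) * u x ^ (α + lam - 1))) • gradient u x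
      + (2 * (u x ^ (α + lam) * ζ x)) • gradient ζ x := by
    intro x
    have d1 : DifferentiableAt ℝ u x := hu.differentiable (by norm_num) x
    have d2 : DifferentiableAt ℝ ζ x := hζ.differentiable (by norm_num) x
    have d3 : DifferentiableAt ℝ (fun x => u x ^ (α + lam)) x := cup.differentiable (by norm_num) x
    have e1 : gradient (fun x => u x ^ (α + lam)) x = ((α + lam) * u x ^ (α + lam - 1)) • gradient u x :=
      grad_comp (h := fun t => t ^ (α + lam)) (Real.hasDerivAt_rpow_const (Or.inl (hpos x).ne')) d1
    have e2 : gradient (fun x => ζ x ^ 2) x = (2 * ζ x) • gradient ζ x :=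
      grad_comp (h := fun t => t ^ 2) (by simpa using hasDerivAt_pow 2 (ζ x)) d2
    have d4 : DifferentiableAt ℝ (fun x => ζ x ^ 2) x := d2.pow 2
    rw [hφ, grad_mul d3 d4, e1, e2, smul_smul, smul_smul, add_comm]
    congr 2; ring
  set J := fun x => ζ x ^ 2 * u x ^ α * (u x ^ lam * (‖gradient u x‖ ^ p / u x)) with hJ
  set Xf := fun x => 2 * (u x ^ (α + lam) * ζ x) * ⟪Phi p (gradient u x), gradient ζ x⟫ with hXf
  have cJ : Continuous J := ((cζ.pow 2).mul ca).mul (cf.mul cz)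
  have iJ : Integrable J := int_cc cJ _ hK fun x hx => by simp [hJ, z0 x hx]
  have cX : Continuous Xf := (continuous_const.mul (cuc.mul cζ)).mul (cV.inner hgζ)
  have iX : Integrable Xf := int_cc cX _ hK fun x hx => by simp [hXf, z0 x hx]
  refine ⟨∫ x, Xf x, ?_, ?_⟩
  · refine (abs_integral_le_integral_abs).trans (integral_mono iX.abs ?_ fun x => ?_)
    · refine int_cc (continuous_const.mul (((cuc.mul cs1).mul cζ).mul hgζ.norm)) _ hK fun x hx => by simp [z0 x hx]
    · simp only [hXf]
      have h1 : 0 ≤ u x ^ (α + lam) := Real.rpow_nonneg (hpos x).le _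
      have h2 := hζ0 x
      have h3 := abs_real_inner_le_norm (Phi p (gradient u x)) (gradient ζ x)
      rw [norm_Phi hp] at h3
      rw [abs_mul, abs_of_nonneg (by positivity : 0 ≤ 2 * (u x ^ (α + lam) * ζ x))]
      calc _ ≤ 2 * (u x ^ (α + lam) * ζ x) * (‖gradient u x‖ ^ (p - 1) * ‖gradient ζ x‖) := by gcongr
        _ = _ := by ring
  · have hl1 : ∫ x, u x ^ lam * φ x = ∫ x, ζ x ^ 2 * u x ^ α * (u x ^ lam) ^ 2 := by
      refine integral_congr_ae (Filter.Eventually.of_forall fun x => ?_)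
      simp only [hφ]; rw [Real.rpow_add (hpos x)]; ring
    rw [← hl1, ← ht, ← integral_const_mul, ← integral_add (iJ.const_mul _) iX]
    refine integral_congr_ae (Filter.Eventually.of_forall fun x => ?_)
    simp only [hgφ, inner_add_right, real_inner_smul_right, inner_Phi_self hp, hJ, hXf]
    congr 1
    rw [Real.rpow_sub_one (hpos x).ne', Real.rpow_add (hpos x)]; ring

set_option maxHeartbeats 1000000 in
lemma energy (hN : 1 ≤ N) {p lam α κ β q n : ℝ} (hp : 1 < p) (hl : 0 ≤ lam) 
    (hβ : β = 2 * κ - α) (hq : q * p = p - 1) (hn : n = 1 / N)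
    (hcJ : (1 - n) * lam + β * (n + q) < 0) (hcK : κ ^ 2 * (1 - n) - β * q * (α - 1) < 0) :
    ∃ Q : ℝ, 0 < Q ∧ ∀ r : ℝ, ∀ u ζ : EE N → ℝ, ContDiff ℝ 1 u → (∀ x, 0 < u x) →
      IsSol p lam r u → ContDiff ℝ 1 ζ → (∀ x, 0 ≤ ζ x) → HasCompactSupport ζ → tsupport ζ ⊆ ball 0 r →
      ∫ x, (ζ x ^ 2 * u x ^ α * (u x ^ lam) ^ 2 + ζ x ^ 2 * u x ^ α * (u x ^ lam * (‖gradient u x‖ ^ p / u x))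
          + ζ x ^ 2 * u x ^ α * (‖gradient u x‖ ^ p / u x) ^ 2) ≤
      Q * ∫ x, (2 * (u x ^ (α + lam) * ‖gradient u x‖ ^ (p - 1) * ζ x * ‖gradient ζ x‖)
        + u x ^ α * ‖gradient u x‖ ^ (2 * p - 2) * ‖gradient ζ x‖ ^ 2) := by
  set a := -((1 - n) * lam + β * (n + q)) with ha
  set b := -(κ ^ 2 * (1 - n) - β * q * (α - 1)) with hb
  have ha0 : 0 < a := by linarith
  have hb0 : 0 < b := by linarith
  set l := |α + lam| with hl'
  have hl0 : 0 ≤ l := abs_nonneg _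
  set θ := min (min 1 (a / (2 * (l + 1)))) (b / 2) with hθ
  have hθ0 : 0 < θ := by positivity
  have hθ1 : θ ≤ 1 := (min_le_left _ _).trans (min_le_left _ _)
  have hθ2 : θ ≤ a / (2 * (l + 1)) := (min_le_left _ _).trans (min_le_right _ _)
  have hθ3 : θ ≤ b / 2 := min_le_right _ _
  have hn1 : n ≤ 1 := by
    rw [hn, div_le_one (by exact_mod_cast hN)]; exact_mod_cast hN
  have hn0 : 0 ≤ n := by rw [hn]; positivity
  obtain ⟨C, hC, H⟩ := int_ineq (N := N) (α := α) (κ := κ) hN hp hθ0 hβ hq hn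
  set Q := 1 + ((l + 1) * (2 / a) + 2 / b) * (2 + C) with hQ
  refine ⟨Q, by positivity, ?_⟩
  intro r u ζ hu hpos hsol hζ hζ0 hζc hζs
  have hI := H lam r hl u ζ hu hpos hsol hζ hζc hζs
  obtain ⟨X, hX, hF⟩ := energy_test (α := α) hp hl hu hpos hsol hζ hζ0 hζc hζs
  have hK : IsCompact (tsupport ζ) := hζc
  have z0 : ∀ x, x ∉ tsupport ζ → ζ x = 0 := fun x hx => image_eq_zero_of_notMem_tsupport hx
  have g0 : ∀ x, x ∉ tsupport ζ → gradient ζ x = 0 := fun x hx => grad_tsupport ζ hx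
  have hgu := grad_cont hu
  have hgζ := grad_cont hζ
  have cζ := hζ.continuous
  have cuc : Continuous fun y => u y ^ (α + lam) := hu.continuous.rpow_const fun x => Or.inl (hpos x).ne'
  have cf : Continuous fun y => u y ^ lam := hu.continuous.rpow_const fun x => Or.inr hl
  have ca : Continuous fun y => u y ^ α := hu.continuous.rpow_const fun x => Or.inl (hpos x).ne'
  have cs : Continuous fun y => ‖gradient u y‖ ^ p := hgu.norm.rpow_const fun x => Or.inr (by linarith)
  have cs1 : Continuous fun y => ‖gradient u y‖ ^ (p - 1) := hgu.norm.rpow_const fun x => Or.inr (by linarith)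
  have cs2 : Continuous fun y => ‖gradient u y‖ ^ (2 * p - 2) := hgu.norm.rpow_const fun x => Or.inr (by linarith)
  have cz : Continuous fun y => ‖gradient u y‖ ^ p / u y := cs.div hu.continuous fun x => (hpos x).ne'
  set f0 := fun x => ζ x ^ 2 * u x ^ α * (u x ^ lam) ^ 2 with hf0
  set j0 := fun x => ζ x ^ 2 * u x ^ α * (u x ^ lam * (‖gradient u x‖ ^ p / u x)) with hj0
  set k0 := fun x => ζ x ^ 2 * u x ^ α * (‖gradient u x‖ ^ p / u x) ^ 2 with hk0
  set x0 := fun x => 2 * (u x ^ (α + lam) * ‖gradient u x‖ ^ (p - 1) * ζ x * ‖gradient ζ x‖) with hx0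
  set l0 := fun x => u x ^ α * ‖gradient u x‖ ^ (2 * p - 2) * ‖gradient ζ x‖ ^ 2 with hl0'
  have i1 : Integrable f0 := int_cc (((cζ.pow 2).mul ca).mul (cf.pow 2)) _ hK fun x hx => by simp [hf0, z0 x hx]
  have i2 : Integrable j0 := int_cc (((cζ.pow 2).mul ca).mul (cf.mul cz)) _ hK fun x hx => by simp [hj0, z0 x hx]
  have i3 : Integrable k0 := int_cc (((cζ.pow 2).mul ca).mul (cz.pow 2)) _ hK fun x hx => by simp [hk0, z0 x hx]
  have i4 : Integrable x0 := int_cc (continuous_const.mul (((cuc.mul cs1).mul cζ).mul hgζ.norm)) _ hK fun x hx => by simp [hx0, z0 x hx]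
  have i5 : Integrable l0 := int_cc ((ca.mul cs2).mul (hgζ.norm.pow 2)) _ hK fun x hx => by simp [hl0', g0 x hx]
  have pα : ∀ x, 0 ≤ u x ^ α := fun x => Real.rpow_nonneg (hpos x).le _
  have pl : ∀ x, 0 ≤ u x ^ lam := fun x => Real.rpow_nonneg (hpos x).le _
  have hJ0 : 0 ≤ ∫ x, j0 x := integral_nonneg fun x => by
    have := pα x; have := pl x; have := (hpos x).le
    simp only [hj0]; positivity
  have hK0 : 0 ≤ ∫ x, k0 x := integral_nonneg fun x => by
    have := pα x; have := pl x; have := (hpos x).le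
    simp only [hk0]; positivity
  have hX0 : 0 ≤ ∫ x, x0 x := (abs_nonneg X).trans hX
  have hL0 : 0 ≤ ∫ x, l0 x := integral_nonneg fun x => by
    have := pα x
    simp only [hl0']; positivity
  have i12 : Integrable fun x => f0 x + j0 x := i1.add i2
  have eL : ∫ x, (f0 x + j0 x + k0 x) = (∫ x, f0 x) + (∫ x, j0 x) + ∫ x, k0 x := by
    rw [integral_add i12 i3, integral_add i1 i2]
  have eR : ∫ x, (x0 x + l0 x) = (∫ x, x0 x) + ∫ x, l0 x := integral_add i4 i5
  have eI : ∫ x, (ζ x ^ 2 * u x ^ α * ((1 - n + θ) * (u x ^ lam) ^ 2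
            + (2 * κ * n - α + β * q) * u x ^ lam * (‖gradient u x‖ ^ p / u x)
            + (κ ^ 2 * (1 - n) - β * q * (α - 1) + θ) * (‖gradient u x‖ ^ p / u x) ^ 2)
        + C * (u x ^ α * ‖gradient u x‖ ^ (2 * p - 2) * ‖gradient ζ x‖ ^ 2))
      = (1 - n + θ) * (∫ x, f0 x) + (2 * κ * n - α + β * q) * (∫ x, j0 x)
        + (κ ^ 2 * (1 - n) - β * q * (α - 1) + θ) * (∫ x, k0 x) + C * ∫ x, l0 x := by
    have a1 : Integrable fun x => (1 - n + θ) * f0 x + (2 * κ * n - α + β * q) * j0 x := (i1.const_mul _).add (i2.const_mul _)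
    have a2 : Integrable fun x => (1 - n + θ) * f0 x + (2 * κ * n - α + β * q) * j0 x + (κ ^ 2 * (1 - n) - β * q * (α - 1) + θ) * k0 x :=
      a1.add (i3.const_mul _)
    rw [← integral_const_mul, ← integral_const_mul, ← integral_const_mul, ← integral_const_mul,
      ← integral_add (i1.const_mul _) (i2.const_mul _), ← integral_add a1 (i3.const_mul _), ← integral_add a2 (i5.const_mul _)]
    refine integral_congr_ae (Filter.Eventually.of_forall fun x => ?_)
    simp only [hf0, hj0, hk0, hl0']; ring
  rw [eI] at hI
  change ∫ x, (f0 x + j0 x + k0 x) ≤ Q * ∫ x, (x0 x + l0 x)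
  rw [eL, eR]
  change ∫ x, f0 x = (α + lam) * (∫ x, j0 x) + X at hF
  change |X| ≤ ∫ x, x0 x at hX
  generalize (∫ x, f0 x) = F at *
  generalize (∫ x, j0 x) = J at *
  generalize (∫ x, k0 x) = K at *
  generalize (∫ x, x0 x) = XX at *
  generalize (∫ x, l0 x) = L at *
  have s1 : (1 - n + θ) * F + (2 * κ * n - α + β * q) * J = (-a + θ * (α + lam)) * J + (1 - n + θ) * X := by
    rw [hF, ha, hβ]; ring
  have s2 : θ * (α + lam) ≤ a / 2 := by
    calc θ * (α + lam) ≤ θ * l := by gcongr; exact le_abs_self _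
      _ ≤ a / (2 * (l + 1)) * (l + 1) := by gcongr; linarith
      _ = a / 2 := by field_simp
  have s3 : (1 - n + θ) * X ≤ 2 * XX := by
    have h1 : (1 - n + θ) * X ≤ (1 - n + θ) * XX := mul_le_mul_of_nonneg_left ((le_abs_self X).trans hX) (by linarith)
    have h2 : (1 - n + θ) * XX ≤ 2 * XX := mul_le_mul_of_nonneg_right (by linarith) hX0
    linarith
  have s4 : (-a + θ * (α + lam)) * J ≤ -(a / 2) * J := mul_le_mul_of_nonneg_right (by linarith) hJ0
  have s5 : (κ ^ 2 * (1 - n) - β * q * (α - 1) + θ) * K ≤ -(b / 2) * K := mul_le_mul_of_nonneg_right (by linarith) hK0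
  have s6 : a / 2 * J + b / 2 * K ≤ (2 + C) * (XX + L) := by
    have : 0 ≤ C * XX := by positivity
    nlinarith
  have t1 : J ≤ 2 / a * ((2 + C) * (XX + L)) := by
    have : 0 ≤ b / 2 * K := by positivity
    calc J = 2 / a * (a / 2 * J) := by field_simp
      _ ≤ _ := mul_le_mul_of_nonneg_left (by linarith) (by positivity)
  have t2 : K ≤ 2 / b * ((2 + C) * (XX + L)) := by
    have : 0 ≤ a / 2 * J := by positivity
    calc K = 2 / b * (b / 2 * K) := by field_simp
      _ ≤ _ := mul_le_mul_of_nonneg_left (by linarith) (by positivity)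
  have t3 : F ≤ l * J + XX := by
    have : (α + lam) * J ≤ l * J := mul_le_mul_of_nonneg_right (le_abs_self _) hJ0
    have := (le_abs_self X).trans hX
    linarith
  have t4 : (l + 1) * J ≤ (l + 1) * (2 / a * ((2 + C) * (XX + L))) := by gcongr
  calc F + J + K ≤ XX + (l + 1) * J + K := by linarith
    _ ≤ (XX + L) + (l + 1) * (2 / a * ((2 + C) * (XX + L))) + 2 / b * ((2 + C) * (XX + L)) := by linarith
    _ = _ := by rw [hQ]; ring
end energy


section liouv
variable {N : ℕ}

lemma zeta_exists (k : ℕ) (hk : 2 ≤ k) : ∃ E0 : ℝ, 0 ≤ E0 ∧ ∀ R : ℝ, 1 ≤ R → ∃ w : EE N → ℝ,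
    ContDiff ℝ 1 w ∧ (∀ x, 0 ≤ w x ∧ w x ≤ 1) ∧ HasCompactSupport (fun x => w x ^ k) ∧
    tsupport (fun x => w x ^ k) ⊆ closedBall 0 (2 * R) ∧ (∀ x ∈ closedBall (0 : EE N) R, w x = 1) ∧
    ∀ x, ‖gradient (fun x => w x ^ k) x‖ ≤ (E0 / R) * w x ^ (k - 1) := by
  obtain ⟨A, hA0, hA⟩ := st_bound
  refine ⟨4 * k * A, by positivity, fun R hR => ?_⟩
  have hR0 : 0 < R := by linarith
  have hs : 0 < 1 / R ^ 2 := by positivity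
  have hts : tsupport (fun x => (rcut (1 / R ^ 2) (2 * R ^ 2) x : ℝ) ^ k) ⊆ tsupport (rcut (1 / R ^ 2) (2 * R ^ 2) : EE N → ℝ) := by
    refine closure_mono fun x hx => ?_
    intro h
    exact hx (by simp only; rw [h]; simp; omega)
  have hb : tsupport (rcut (1 / R ^ 2) (2 * R ^ 2) : EE N → ℝ) ⊆ closedBall 0 (2 * R) :=
    (rcut_tsupport_ball hs (by positivity) (by nlinarith)).trans ball_subset_closedBall
  have hc1 : ContDiff ℝ 1 (rcut (1 / R ^ 2) (2 * R ^ 2) : EE N → ℝ) := rcut_contDiff (n := 1)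
  refine ⟨rcut (1 / R ^ 2) (2 * R ^ 2), hc1, fun x => ⟨rcut_nonneg x, rcut_le_one x⟩,
    (rcut_hcs hs).of_isClosed_subset (isClosed_tsupport _) hts, hts.trans hb, fun x hx => rcut_one ?_, fun x => ?_⟩
  · rw [mem_closedBall_zero_iff] at hx
    have : ‖x‖ ^ 2 ≤ R ^ 2 := by gcongr
    rw [div_mul_eq_mul_div, le_div_iff₀ (by positivity)]; linarith
  · have hw := rcut_nonneg (s := 1 / R ^ 2) (ρ := 2 * R ^ 2) x
    have d1 : DifferentiableAt ℝ (rcut (1 / R ^ 2) (2 * R ^ 2) : EE N → ℝ) x := hc1.differentiable (by norm_num) x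
    rw [grad_comp (h := fun t => t ^ k) (hasDerivAt_pow k _) d1, norm_smul, Real.norm_of_nonneg (by positivity)]
    have hg : ‖gradient (rcut (1 / R ^ 2) (2 * R ^ 2)) x‖ ≤ 4 * A / R := by
      by_cases hx : x ∈ tsupport (rcut (1 / R ^ 2) (2 * R ^ 2) : EE N → ℝ)
      · have h1 := hb hx
        rw [mem_closedBall_zero_iff] at h1
        calc _ ≤ A * (2 * (1 / R ^ 2) * ‖x‖) := rcut_grad hA hs x
          _ ≤ A * (2 * (1 / R ^ 2) * (2 * R)) := by gcongr
          _ = _ := by field_simp; ring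
      · rw [grad_tsupport _ hx]; simp; positivity
    calc _ ≤ (k * rcut (1 / R ^ 2) (2 * R ^ 2) x ^ (k - 1)) * (4 * A / R) := by gcongr
      _ = _ := by ring

lemma lower_B {p lam α c0 ρ0 : ℝ} (hp : 1 < p) (hc0 : 0 < c0) (hρ0 : 0 < ρ0)
    (h : 0 ≤ α + 2 * p - 2 ∨ ∃ σ : ℝ, 0 < σ ∧ (N:ℝ) - p < σ * (p - 1) ∧ N - 2 * p - (α + 2 * p - 2) * σ < 0) :
    ∃ B0 τ : ℝ, 0 ≤ B0 ∧ (N:ℝ) - 2 * p + τ < 0 ∧ ∀ R : ℝ, 1 ≤ R → ∀ r, 4 * R < r → ∀ u : EE N → ℝ, ContDiff ℝ 1 u →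
      (∀ x, 0 < u x) → IsSol p lam r u → (∀ x ∈ ball (0 : EE N) ρ0, c0 ≤ u x) →
      ∀ x ∈ closedBall (0 : EE N) (2 * R), 0 ≤ α + 2 * p - 2 ∨ u x ^ (α + 2 * p - 2) ≤ B0 * R ^ τ := by
  by_cases h0 : 0 ≤ α + 2 * p - 2
  · exact ⟨0, -N, le_refl _, by linarith, fun _ _ _ _ _ _ _ _ _ _ _ => Or.inl h0⟩
  · obtain ⟨σ, hσ, hσN, hσ2⟩ := h.resolve_left h0
    push Not at h0
    obtain ⟨c, hc, H⟩ := barrier (N := N) (lam := lam) hp hσ hσN hc0 hρ0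
    refine ⟨(c * 2 ^ (-σ)) ^ (α + 2 * p - 2), -σ * (α + 2 * p - 2), by positivity, by linarith, ?_⟩
    intro R hR r hr u hu hpos hsol hlow x hx
    right
    have hR0 : 0 < R := by linarith
    have := H (2 * R) r (by linarith) (by linarith) u hu (fun x => (hpos x).le) hsol hlow x hx
    calc u x ^ (α + 2 * p - 2) ≤ (c * (2 * R) ^ (-σ)) ^ (α + 2 * p - 2) :=
          Real.rpow_le_rpow_of_nonpos (by positivity) this h0.le
      _ = _ := by
        rw [Real.mul_rpow (by norm_num) hR0.le, ← mul_assoc, Real.mul_rpow (by positivity) (by positivity),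
          ← Real.rpow_mul hR0.le]

lemma decay {m p τ G1 G2 δ : ℝ} (hm : (N:ℝ) < m) (hτ : (N:ℝ) - 2 * p + τ < 0) (hδ : 0 < δ) (ρ : ℝ) :
    ∃ R : ℝ, 1 ≤ R ∧ ρ ≤ R ∧ G1 * R ^ (N - m) + G2 * R ^ (N - 2 * p + τ) < δ := by
  have h1 : Filter.Tendsto (fun R : ℝ => R ^ (N - m)) Filter.atTop (nhds 0) := by
    have := tendsto_rpow_neg_atTop (y := m - N) (by linarith)
    simpa using this
  have h2 : Filter.Tendsto (fun R : ℝ => R ^ (N - 2 * p + τ)) Filter.atTop (nhds 0) := by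
    have := tendsto_rpow_neg_atTop (y := -(N - 2 * p + τ)) (by linarith)
    simpa using this
  have h3 := (h1.const_mul G1).add (h2.const_mul G2)
  simp only [mul_zero, add_zero] at h3
  obtain ⟨R, a, b, c⟩ := ((Filter.eventually_ge_atTop 1).and ((Filter.eventually_ge_atTop ρ).and (h3.eventually_lt_const hδ))).exists
  exact ⟨R, a, b, c⟩

set_option maxHeartbeats 1000000 in
lemma liouv (hN : 1 ≤ N) {p lam c0 ρ0 : ℝ} (hp : 1 < p) (hlam₁ : p - 1 < lam)
    (hlam₂ : (N : ℝ) > p → lam < ((N : ℝ) * (p - 1) + p) / ((N : ℝ) - p)) (hc0 : 0 < c0) (hρ0 : 0 < ρ0) :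
    ∃ R0 : ℝ, 0 < R0 ∧ ∀ u : EE N → ℝ, ContDiff ℝ 1 u → (∀ x, 0 < u x) → IsSol p lam R0 u →
      (∀ x ∈ ball (0 : EE N) ρ0, c0 ≤ u x) → False := by
  obtain ⟨α, κ, β, q, n, hβ, hq, hn, hcJ, hcK, he1, hmN, hσ⟩ := expo N hN hp hlam₁ hlam₂
  have hl : 0 ≤ lam := by linarith
  have hd : 0 < lam + 1 - p := by linarith
  obtain ⟨Q, hQ, HQ⟩ := energy hN hp hl hβ hq hn hcJ hcK
  set m := p * (α + 2 * lam) / (lam + 1 - p) with hm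
  have hNm : (N : ℝ) < m := by rw [hm, lt_div_iff₀ hd]; exact hmN
  have hE : 0 < α + 2 * lam := by
    have : (0:ℝ) ≤ N := by positivity
    have : 0 < p * (α + 2 * lam) := lt_of_le_of_lt (by positivity) hmN
    exact pos_of_mul_pos_right this (by linarith)
  obtain ⟨k0, hk0⟩ := exists_nat_ge (max m p)
  set k := k0 + 2 with hk
  have hkm : m ≤ 2 * (k : ℝ) := by
    have := (le_max_left m p).trans hk0
    push_cast [hk]; linarith
  have hkp : 2 * p ≤ 2 * (k : ℝ) := by
    have := (le_max_right m p).trans hk0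
    push_cast [hk]; linarith
  obtain ⟨C, hC, HY⟩ := young_all (α := α) (σ := 1 / (2 * Q)) (k := k) hp hlam₁ he1 hm (by omega) hkm hkp (by positivity)
  obtain ⟨E0, hE0, HZ⟩ := zeta_exists (N := N) k (by omega)
  obtain ⟨B0, τ, hB0, hτ, HB⟩ := lower_B (N := N) (lam := lam) hp hc0 hρ0 hσ
  set v1 := volume.real (ball (0 : EE N) ρ0) with hv1
  have hv1p : 0 < v1 := ENNReal.toReal_pos (measure_ball_pos _ _ hρ0).ne' measure_ball_lt_top.ne
  set v2 := volume.real (closedBall (0 : EE N) 2) with hv2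
  obtain ⟨R, hR1, hRρ, hRδ⟩ := decay (N := N) (m := m) (p := p) (τ := τ) (G1 := 2 * Q * C * E0 ^ m * v2)
    (G2 := 2 * Q * C * E0 ^ (2 * p) * B0 * v2) (δ := c0 ^ (α + 2 * lam) * v1) hNm hτ (by positivity) ρ0
  have hR0 : 0 < R := by linarith
  refine ⟨4 * R + 1, by linarith, fun u hu hpos hsol hlow => ?_⟩
  obtain ⟨w, hw, hw01, hwc, hws, hw1, hwg⟩ := HZ R hR1
  have hen := HQ (4 * R + 1) u (fun x => w x ^ k) hu hpos hsol (hw.pow k) (fun x => pow_nonneg (hw01 x).1 k) hwc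
    (hws.trans (closedBall_subset_ball (by linarith)))
  have hBx := HB R hR1 (4 * R + 1) (by linarith) u hu hpos hsol hlow
  have hζ : ContDiff ℝ 1 (fun x => w x ^ k) := hw.pow k
  have hK : IsCompact (tsupport fun x => w x ^ k) := hwc
  have z0 : ∀ x, x ∉ tsupport (fun x => w x ^ k) → w x ^ k = 0 := fun x hx => by
    have := image_eq_zero_of_notMem_tsupport hx
    exact this
  have g0 : ∀ x, x ∉ tsupport (fun x => w x ^ k) → gradient (fun x => w x ^ k) x = 0 := fun x hx => grad_tsupport _ hx
  have hgu := grad_cont hu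
  have hgζ := grad_cont hζ
  have cζ := hζ.continuous
  have cuc : Continuous fun y => u y ^ (α + lam) := hu.continuous.rpow_const fun x => Or.inl (hpos x).ne'
  have cf : Continuous fun y => u y ^ lam := hu.continuous.rpow_const fun x => Or.inr hl
  have ca : Continuous fun y => u y ^ α := hu.continuous.rpow_const fun x => Or.inl (hpos x).ne'
  have cs : Continuous fun y => ‖gradient u y‖ ^ p := hgu.norm.rpow_const fun x => Or.inr (by linarith)
  have cs1 : Continuous fun y => ‖gradient u y‖ ^ (p - 1) := hgu.norm.rpow_const fun x => Or.inr (by linarith)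
  have cs2 : Continuous fun y => ‖gradient u y‖ ^ (2 * p - 2) := hgu.norm.rpow_const fun x => Or.inr (by linarith)
  have cz : Continuous fun y => ‖gradient u y‖ ^ p / u y := cs.div hu.continuous fun x => (hpos x).ne'
  set S := fun x => (w x ^ k) ^ 2 * u x ^ α * (u x ^ lam) ^ 2 + (w x ^ k) ^ 2 * u x ^ α * (u x ^ lam * (‖gradient u x‖ ^ p / u x))
          + (w x ^ k) ^ 2 * u x ^ α * (‖gradient u x‖ ^ p / u x) ^ 2 with hS
  set T := fun x => 2 * (u x ^ (α + lam) * ‖gradient u x‖ ^ (p - 1) * w x ^ k * ‖gradient (fun x => w x ^ k) x‖)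
        + u x ^ α * ‖gradient u x‖ ^ (2 * p - 2) * ‖gradient (fun x => w x ^ k) x‖ ^ 2 with hT
  have iS : Integrable S := int_cc (((((cζ.pow 2).mul ca).mul (cf.pow 2)).add (((cζ.pow 2).mul ca).mul (cf.mul cz))).add
    (((cζ.pow 2).mul ca).mul (cz.pow 2))) _ hK fun x hx => by simp only [hS, z0 x hx]; simp
  have iT : Integrable T := int_cc ((continuous_const.mul (((cuc.mul cs1).mul cζ).mul hgζ.norm)).add
    ((ca.mul cs2).mul (hgζ.norm.pow 2))) _ hK fun x hx => by simp only [hT, z0 x hx, g0 x hx]; simp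
  have hen' : ∫ x, S x ≤ Q * ∫ x, T x := hen
  set Z := C * ((E0 / R) ^ m + (E0 / R) ^ (2 * p) * (B0 * R ^ τ)) with hZ
  set b2 := closedBall (0 : EE N) (2 * R) with hb2
  have ib : Integrable (b2.indicator fun _ => Z) :=
    (integrable_indicator_iff measurableSet_closedBall).mpr (integrableOn_const measure_closedBall_lt_top.ne)
  have Tle : ∀ x, T x ≤ 1 / (2 * Q) * S x + b2.indicator (fun _ => Z) x := by
    intro x
    by_cases hx : x ∈ b2
    · rw [Set.indicator_of_mem hx]
      exact HY (u x) ‖gradient u x‖ (w x) ‖gradient (fun x => w x ^ k) x‖ (E0 / R) (B0 * R ^ τ) (hpos x) (norm_nonneg _) (hw01 x).1 (hw01 x).2 (norm_nonneg _)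
        (by positivity) (by positivity) (hwg x) (hBx x hx)
    · have hx' : x ∉ tsupport (fun x => w x ^ k) := fun h => hx (hws h)
      rw [Set.indicator_of_notMem hx]
      simp only [hS, hT, z0 x hx', g0 x hx']; simp
  have hinteg0 : ∫ x, T x ≤ 1 / (2 * Q) * (∫ x, S x) + volume.real b2 * Z := by
    calc ∫ x, T x ≤ ∫ x, (1 / (2 * Q) * S x + b2.indicator (fun _ => Z) x) :=
          integral_mono iT ((iS.const_mul _).add ib) Tle
      _ = _ := by
        rw [integral_add (iS.const_mul _) ib, integral_const_mul, integral_indicator_const _ measurableSet_closedBall]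
        rfl
  have hSle : ∫ x, S x ≤ 2 * Q * (volume.real b2 * Z) := by
    have h1 : Q * ∫ x, T x ≤ Q * (1 / (2 * Q) * (∫ x, S x) + volume.real b2 * Z) := by gcongr
    have h2 : Q * (1 / (2 * Q) * (∫ x, S x) + volume.real b2 * Z) = (∫ x, S x) / 2 + Q * (volume.real b2 * Z) := by
      field_simp
    linarith
  have hvol : volume.real b2 = R ^ N * v2 := by
    rw [hb2, hv2, show (2 * R) = R * 2 by ring, measureReal_def, Measure.addHaar_closedBall_mul _ _ hR0.le (by norm_num), ENNReal.toReal_mul,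
      ENNReal.toReal_ofReal (by positivity), measureReal_def]
    simp
  set cc := c0 ^ (α + 2 * lam) with hcc
  have ib1 : Integrable ((ball (0 : EE N) ρ0).indicator fun _ => cc) :=
    (integrable_indicator_iff measurableSet_ball).mpr (integrableOn_const measure_ball_lt_top.ne)
  have hSge : v1 * cc ≤ ∫ x, S x := by
    have : ∫ x, (ball (0 : EE N) ρ0).indicator (fun _ => cc) x = v1 * cc := by
      rw [integral_indicator_const _ measurableSet_ball]; simp [hv1]
    rw [← this]
    refine integral_mono ib1 iS fun x => ?_
    have hux := (hpos x).le
    have p1 : 0 ≤ (w x ^ k) ^ 2 * u x ^ α * (u x ^ lam * (‖gradient u x‖ ^ p / u x)) := by positivity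
    have p2 : 0 ≤ (w x ^ k) ^ 2 * u x ^ α * (‖gradient u x‖ ^ p / u x) ^ 2 := by positivity
    have p3 : 0 ≤ (w x ^ k) ^ 2 * u x ^ α * (u x ^ lam) ^ 2 := by positivity
    by_cases hx : x ∈ ball (0 : EE N) ρ0
    · rw [Set.indicator_of_mem hx]
      have hx1 : w x = 1 := hw1 x (closedBall_subset_closedBall hRρ (ball_subset_closedBall hx))
      have : (w x ^ k) ^ 2 * u x ^ α * (u x ^ lam) ^ 2 = u x ^ (α + 2 * lam) := by
        rw [hx1, Real.rpow_add (hpos x), mul_comm 2 lam, Real.rpow_mul hux]; simp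
      have h3 : cc ≤ u x ^ (α + 2 * lam) := Real.rpow_le_rpow hc0.le (hlow x hx) hE.le
      simp only [hS]; linarith
    · rw [Set.indicator_of_notMem hx]; simp only [hS]; linarith
  have hfin : 2 * Q * (volume.real b2 * Z) = 2 * Q * C * E0 ^ m * v2 * R ^ (N - m) + 2 * Q * C * E0 ^ (2 * p) * B0 * v2 * R ^ (N - 2 * p + τ) := by
    rw [hvol, hZ, Real.div_rpow hE0 hR0.le, Real.div_rpow hE0 hR0.le, Real.rpow_add hR0, Real.rpow_sub hR0, Real.rpow_sub hR0, Real.rpow_natCast]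
    ring
  rw [hfin] at hSle
  linarith
end liouv


section rescale
variable {N : ℕ}

lemma Phi_smul {p c : ℝ} (hc : 0 < c) (ξ : EE N) : Phi p (c • ξ) = c ^ (p - 1) • Phi p ξ := by
  unfold Phi
  rw [norm_smul, Real.norm_of_nonneg hc.le, Real.mul_rpow hc.le (norm_nonneg _), smul_smul, smul_smul]
  congr 1
  rw [show p - 1 = (p - 2) + 1 by ring, Real.rpow_add_one hc.ne']; ring

lemma grad_affine {f : EE N → ℝ} (hf : ContDiff ℝ 1 f) (y : EE N) (μ : ℝ) (z : EE N) :
    gradient (fun z => f (y + μ • z)) z = μ • gradient f (y + μ • z) := by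
  unfold gradient
  have h1 : HasFDerivAt (fun z : EE N => y + μ • z) (μ • ContinuousLinearMap.id ℝ (EE N)) z :=
    ((hasFDerivAt_id z).const_smul μ).const_add y
  have h2 := ((hf.differentiable (by norm_num) (y + μ • z)).hasFDerivAt.comp z h1).fderiv
  unfold Function.comp at h2
  rw [h2]
  simp

/-- solution tested on the ball of centre `y` -/
lemma rescale {p lam γ ρ μ : ℝ} (hγ : γ * (lam + 1 - p) = p) (hμ : 0 < μ) {u : EE N → ℝ} {y : EE N}
    (hu : ContDiff ℝ 1 u) (hu0 : ∀ x, 0 ≤ u x)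
    (h : ∀ φ : EE N → ℝ, ContDiff ℝ 1 φ → HasCompactSupport φ → tsupport φ ⊆ ball y ρ →
      ∫ x, ⟪Phi p (gradient u x), gradient φ x⟫ = ∫ x, u x ^ lam * φ x) :
    IsSol p lam (ρ / μ) (fun z => μ ^ γ * u (y + μ • z)) := by
  intro φ h1 h2 h3
  set ψ : EE N → ℝ := fun x => φ (-(μ⁻¹ • y) + μ⁻¹ • x) with hψ
  have cψ : ContDiff ℝ 1 ψ := h1.comp (by fun_prop)
  have hψφ : ∀ z, ψ (y + μ • z) = φ z := by
    intro z; simp only [hψ]; congr 1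
    rw [smul_add, smul_smul, inv_mul_cancel₀ hμ.ne', one_smul]; abel
  have hgψ : ∀ z, gradient ψ (y + μ • z) = μ⁻¹ • gradient φ z := by
    intro z
    rw [hψ, grad_affine h1]
    congr 2
    rw [smul_add, smul_smul, inv_mul_cancel₀ hμ.ne', one_smul]; abel
  have hts : tsupport ψ ⊆ (fun x => -(μ⁻¹ • y) + μ⁻¹ • x) ⁻¹' tsupport φ := by
    apply closure_minimal
    · intro x hx; exact subset_tsupport _ hx
    · exact (isClosed_tsupport φ).preimage (by fun_prop)
  have hK : IsCompact ((fun z => y + μ • z) '' tsupport φ) := h2.isCompact.image (by fun_prop)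
  have hts2 : tsupport ψ ⊆ (fun z => y + μ • z) '' tsupport φ := by
    intro x hx
    refine ⟨_, hts hx, ?_⟩
    simp only
    rw [smul_add, smul_neg, smul_smul, smul_smul, mul_inv_cancel₀ hμ.ne', one_smul, one_smul]; abel
  have hψc : HasCompactSupport ψ := hK.of_isClosed_subset (isClosed_tsupport _) hts2
  have hψb : tsupport ψ ⊆ ball y ρ := by
    intro x hx
    obtain ⟨z, hz, rfl⟩ := hts2 hx
    have := h3 hz
    rw [mem_ball_zero_iff, lt_div_iff₀ hμ] at this
    rw [mem_ball, dist_eq_norm]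
    simp only [add_sub_cancel_left, norm_smul, Real.norm_of_nonneg hμ.le]; linarith
  have key := h ψ cψ hψc hψb
  have cov : ∀ G : EE N → ℝ, ∫ z, G (y + μ • z) = |(μ ^ Module.finrank ℝ (EE N))⁻¹| • ∫ x, G x := by
    intro G
    rw [Measure.integral_comp_smul volume (fun x => G (y + x)) μ, integral_add_left_eq_self]
  have e : ∫ z, ⟪Phi p (gradient u (y + μ • z)), gradient ψ (y + μ • z)⟫ = ∫ z, u (y + μ • z) ^ lam * ψ (y + μ • z) := by
    rw [cov (fun x => ⟪Phi p (gradient u x), gradient ψ x⟫), cov (fun x => u x ^ lam * ψ x), key]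
  have e1 : ∀ z, ⟪Phi p (gradient (fun z => μ ^ γ * u (y + μ • z)) z), gradient φ z⟫ =
      μ ^ (γ * lam) * ⟪Phi p (gradient u (y + μ • z)), gradient ψ (y + μ • z)⟫ := by
    intro z
    have hd : DifferentiableAt ℝ (fun z => u (y + μ • z)) z :=
      (hu.comp (by fun_prop : ContDiff ℝ 1 fun z : EE N => y + μ • z)).differentiable (by norm_num) z
    have hc : 0 < μ ^ γ * μ := by positivity
    rw [grad_const_mul _ hd, grad_affine hu, smul_smul, Phi_smul hc, hgψ, real_inner_smul_left, real_inner_smul_right, ← mul_assoc]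
    congr 1
    rw [← Real.rpow_add_one hμ.ne', ← Real.rpow_mul hμ.le, ← Real.rpow_neg_one, ← Real.rpow_add hμ]
    congr 1; linarith
  have e2 : ∀ z, (μ ^ γ * u (y + μ • z)) ^ lam * φ z = μ ^ (γ * lam) * (u (y + μ • z) ^ lam * ψ (y + μ • z)) := by
    intro z
    rw [Real.mul_rpow (by positivity) (hu0 _), ← Real.rpow_mul hμ.le, hψφ]; ring
  simp_rw [e1, e2]
  rw [integral_const_mul, integral_const_mul, e]

lemma IsSol.translate {p lam r r' : ℝ} (hl : p - 1 < lam) {u : EE N → ℝ} {y : EE N} (h : IsSol p lam r u)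
    (hu : ContDiff ℝ 1 u) (hu0 : ∀ x, 0 ≤ u x) (hr : ‖y‖ + r' ≤ r) : IsSol p lam r' (fun z => u (y + z)) := by
  have := rescale (p := p) (lam := lam) (γ := p / (lam + 1 - p)) (ρ := r') (y := y) (div_mul_cancel₀ _ (by linarith)) one_pos hu hu0
    (fun φ h1 h2 h3 => h φ h1 h2 (h3.trans (ball_subset_ball' (by rw [dist_zero_right]; linarith))))
  simpa using this

lemma core1 (hN : 1 ≤ N) {p lam M c : ℝ} (hp : 1 < p) (hlam₁ : p - 1 < lam)
    (hlam₂ : (N : ℝ) > p → lam < ((N : ℝ) * (p - 1) + p) / ((N : ℝ) - p)) (hM : 0 ≤ M) (hc : 0 < c) :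
    ∃ K : ℝ, 0 < K ∧ ∀ u : EE N → ℝ, ContDiff ℝ 1 u → (∀ x, 0 ≤ u x) → IsSol p lam K u →
      (∀ x ∈ ball (0 : EE N) K, ‖gradient u x‖ ≤ M) → c ≤ u 0 → False := by
  set ρ := min 1 (c / (2 * (M + 1))) with hρ
  have hρ0 : 0 < ρ := by positivity
  have hρ1 : ρ ≤ 1 := min_le_left _ _
  have hρ2 : M * ρ ≤ c / 2 := by
    have : ρ ≤ c / (2 * (M + 1)) := min_le_right _ _
    calc M * ρ ≤ (M + 1) * (c / (2 * (M + 1))) := by gcongr; linarith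
      _ = c / 2 := by field_simp
  obtain ⟨R0, hR0, HL⟩ := liouv hN hp hlam₁ hlam₂ (c0 := min (c / 2) 1) (by positivity) hρ0
  have hN' : (1:ℝ) ≤ N := by exact_mod_cast hN
  obtain ⟨b, hb, HB⟩ := barrier (N := N) (lam := lam) (σ := N / (p - 1)) hp (div_pos (by linarith) (by linarith))
    (by rw [div_mul_cancel₀ _ (by linarith)]; linarith) (half_pos hc) hρ0
  set R := R0 + 1 with hR
  refine ⟨2 * R + 1, by linarith, fun u hu hu0 hsol hg hc0 => ?_⟩
  have hlow : ∀ x ∈ ball (0 : EE N) ρ, c / 2 ≤ u x := by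
    intro x hx
    have := (convex_ball (0 : EE N) ρ).norm_image_sub_le_of_norm_fderiv_le (𝕜 := ℝ) (f := u) (C := M)
      (fun z _ => hu.differentiable (by norm_num) z)
      (fun z hz => by rw [← norm_grad]; exact hg z (ball_subset_ball (by linarith) hz)) (mem_ball_self hρ0) hx
    rw [sub_zero, Real.norm_eq_abs, abs_le] at this
    rw [mem_ball_zero_iff] at hx
    have : M * ‖x‖ ≤ M * ρ := by gcongr
    linarith
  have hpos := HB R (2 * R + 1) (by linarith) (by linarith) u hu hu0 hsol hlow
  obtain ⟨θ, hθ, -, hθs, hθ01, V, -, hKV, hθ1⟩ := exists_cutoff (isCompact_closedBall (0 : EE N) R0) isOpen_ball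
    (closedBall_subset_ball (by linarith : R0 < R))
  have hθ' : ContDiff ℝ 1 θ := hθ.of_le (by exact_mod_cast le_top)
  refine HL (fun x => u x * θ x + (1 - θ x)) ((hu.mul hθ').add (contDiff_const.sub hθ')) (fun x => ?_)
    ((hsol.mono (by linarith)).congr fun x hx => ?_) (fun x hx => ?_)
  · have h1 := hθ01 x
    by_cases hx : x ∈ tsupport θ
    · have h2 := hpos x (ball_subset_closedBall (hθs hx))
      have h3 : 0 < u x := lt_of_lt_of_le (by positivity) h2
      rcases h1.1.eq_or_lt with h4 | h4
      · rw [← h4]; simp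
      · have := mul_pos h3 h4; linarith
    · rw [image_eq_zero_of_notMem_tsupport hx]; simp
  · rw [hθ1 x (hKV (ball_subset_closedBall hx))]; simp
  · have h1 := hθ01 x
    have h2 := hlow x hx
    have h3 : min (c / 2) 1 ≤ c / 2 := min_le_left _ _
    have h4 : min (c / 2) 1 ≤ 1 := min_le_right _ _
    calc min (c / 2) 1 = min (c / 2) 1 * θ x + min (c / 2) 1 * (1 - θ x) := by ring
      _ ≤ u x * θ x + 1 * (1 - θ x) := add_le_add (mul_le_mul_of_nonneg_right (by linarith) h1.1) (mul_le_mul_of_nonneg_right h4 (by linarith))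
      _ = _ := by ring

lemma core (hN : 1 ≤ N) {p lam M c : ℝ} (hp : 1 < p) (hlam₁ : p - 1 < lam)
    (hlam₂ : (N : ℝ) > p → lam < ((N : ℝ) * (p - 1) + p) / ((N : ℝ) - p)) (hM : 0 ≤ M) (hc : 0 < c) :
    ∃ K : ℝ, 0 < K ∧ ∀ u : EE N → ℝ, ContDiff ℝ 1 u → (∀ x, 0 ≤ u x) → IsSol p lam K u →
      (∀ x ∈ ball (0 : EE N) K, ‖gradient u x‖ ≤ M) → (c ≤ u 0 ∨ c ≤ ‖gradient u 0‖) → False := by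
  obtain ⟨ε, hε, HS⟩ := small_grad (M := M) (lam := lam) hN hp (by linarith) hc
  obtain ⟨K1, hK1, H1⟩ := core1 hN hp hlam₁ hlam₂ hM hc
  obtain ⟨K2, hK2, H2⟩ := core1 hN hp hlam₁ hlam₂ hM hε
  set K := K1 + K2 + 4 with hK
  refine ⟨K, by positivity, fun u hu hu0 hsol hg hor => ?_⟩
  rcases hor with h | h
  · exact H1 u hu hu0 (hsol.mono (by linarith)) (fun x hx => hg x (ball_subset_ball (by linarith) hx)) h
  · by_cases hall : ∀ x ∈ ball (0 : EE N) 4, u x ≤ ε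
    · have := HS u hu hu0 (hsol.mono (by linarith)) (fun x hx => ⟨hg x (ball_subset_ball (by linarith) hx), hall x hx⟩)
      linarith
    · push Not at hall
      obtain ⟨y, hy, hyε⟩ := hall
      rw [mem_ball_zero_iff] at hy
      refine H2 (fun z => u (y + z)) (hu.comp (by fun_prop)) (fun x => hu0 _) (hsol.translate hlam₁ hu hu0 (by linarith)) (fun x hx => ?_)
        (by simpa using hyε.le)
      have : gradient (fun z => u (y + z)) x = gradient u (y + x) := by
        simpa using grad_affine hu y 1 x
      rw [this]
      apply hg
      rw [mem_ball_zero_iff] at hx ⊢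
      have := norm_add_le y x
      linarith
end rescale


section final
variable {N : ℕ}

/-- localisation of a solution near a closed ball -/
lemma localise {p lam r : ℝ} (hp : 1 < p) (hl : 0 ≤ lam) {Ω : Set (EE N)} (hΩ : IsOpen Ω) {u : EE N → ℝ}
    (hu : ContDiffOn ℝ 1 u Ω) (hu0 : ∀ x ∈ Ω, 0 ≤ u x)
    (h : ∀ φ : EE N → ℝ, ContDiff ℝ (⊤ : ℕ∞) φ → HasCompactSupport φ → tsupport φ ⊆ Ω →
      ∫ x in Ω, ‖gradient u x‖ ^ (p - 2) * ⟪gradient u x, gradient φ x⟫ = ∫ x in Ω, u x ^ lam * φ x)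
    {x0 : EE N} (hb : closedBall x0 r ⊆ Ω) :
    ∃ v : EE N → ℝ, ContDiff ℝ 1 v ∧ (∀ x, 0 ≤ v x) ∧ (∀ x ∈ closedBall x0 r, v x = u x ∧ gradient v x = gradient u x) ∧
      ∀ φ : EE N → ℝ, ContDiff ℝ 1 φ → HasCompactSupport φ → tsupport φ ⊆ ball x0 r →
      ∫ x, ⟪Phi p (gradient v x), gradient φ x⟫ = ∫ x, v x ^ lam * φ x := by
  obtain ⟨θ, hθ, -, hθs, hθ01, V, hV, hKV, hθ1⟩ := exists_cutoff (isCompact_closedBall x0 r) hΩ hb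
  have hθ' : ContDiff ℝ 1 θ := hθ.of_le (by exact_mod_cast le_top)
  set v : EE N → ℝ := fun x => u x * θ x with hv
  have cv : ContDiff ℝ 1 v := by
    rw [contDiff_iff_contDiffAt]
    intro x
    by_cases hx : x ∈ tsupport θ
    · exact (hu.contDiffAt (hΩ.mem_nhds (hθs hx))).mul hθ'.contDiffAt
    · have h0 : v =ᶠ[nhds x] fun _ => 0 := by
        filter_upwards [(isClosed_tsupport θ).isOpen_compl.mem_nhds hx] with z hz
        simp [hv, image_eq_zero_of_notMem_tsupport hz]
      exact contDiffAt_const.congr_of_eventuallyEq h0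
  have v0 : ∀ x, 0 ≤ v x := by
    intro x
    by_cases hx : x ∈ tsupport θ
    · exact mul_nonneg (hu0 x (hθs hx)) (hθ01 x).1
    · simp [hv, image_eq_zero_of_notMem_tsupport hx]
  have hloc : ∀ x ∈ closedBall x0 r, v x = u x ∧ gradient v x = gradient u x := by
    intro x hx
    refine ⟨by simp [hv, hθ1 x (hKV hx)], ?_⟩
    have : v =ᶠ[nhds x] u := by
      filter_upwards [hV.mem_nhds (hKV hx)] with y hy
      simp [hv, hθ1 y hy]
    unfold gradient
    rw [this.fderiv_eq]
  refine ⟨v, cv, v0, hloc, fun φ h1 h2 h3 => ?_⟩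
  refine weak_ext ((Phi_cont hp).comp (grad_cont cv)) (cv.continuous.rpow_const fun x => Or.inr hl) isOpen_ball
    (fun φ h1 h2 h3 => ?_) h1 h2 h3
  have h3' : tsupport φ ⊆ closedBall x0 r := h3.trans ball_subset_closedBall
  have hk := h φ h1 h2 (h3'.trans hb)
  have z0 : ∀ x, x ∉ tsupport φ → φ x = 0 ∧ gradient φ x = 0 := fun x hx =>
    ⟨image_eq_zero_of_notMem_tsupport hx, grad_tsupport _ hx⟩
  rw [setIntegral_eq_integral_of_forall_compl_eq_zero, setIntegral_eq_integral_of_forall_compl_eq_zero] at hk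
  · have a1 : ∀ x, ⟪Phi p (gradient v x), gradient φ x⟫ = ‖gradient u x‖ ^ (p - 2) * ⟪gradient u x, gradient φ x⟫ := by
      intro x
      by_cases hx : x ∈ tsupport φ
      · rw [(hloc x (h3' hx)).2, Phi, real_inner_smul_left]
      · simp [(z0 x hx).2]
    have a2 : ∀ x, v x ^ lam * φ x = u x ^ lam * φ x := by
      intro x
      by_cases hx : x ∈ tsupport φ
      · rw [(hloc x (h3' hx)).1]
      · simp [(z0 x hx).1]
    simp only [Function.comp_apply]
    simp_rw [a1, a2]; exact hk
  · intro x hx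
    simp [(z0 x fun h => hx (hb (h3' h))).1]
  · intro x hx
    simp [(z0 x fun h => hx (hb (h3' h))).2]

/-- the doubling argument -/
lemma doubling (hN : 1 ≤ N) {p lam : ℝ} (hp : 1 < p) (hlam₁ : p - 1 < lam)
    (hlam₂ : (N : ℝ) > p → lam < ((N : ℝ) * (p - 1) + p) / ((N : ℝ) - p)) :
    ∃ K : ℝ, 0 < K ∧ ∀ (x0 : EE N) (r : ℝ), 0 < r → ∀ u : EE N → ℝ, ContDiff ℝ 1 u → (∀ x, 0 ≤ u x) →
      (∀ φ : EE N → ℝ, ContDiff ℝ 1 φ → HasCompactSupport φ → tsupport φ ⊆ ball x0 r →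
        ∫ x, ⟪Phi p (gradient u x), gradient φ x⟫ = ∫ x, u x ^ lam * φ x) →
      (u x0 ^ ((lam + 1 - p) / p) + ‖gradient u x0‖ ^ ((lam + 1 - p) / (lam + 1))) * r ≤ K := by
  have hd : 0 < lam + 1 - p := by linarith
  have hl : 0 < lam := by linarith
  set a := (lam + 1 - p) / p with ha
  set b := (lam + 1 - p) / (lam + 1) with hb
  set γ := p / (lam + 1 - p) with hγ
  have ha0 : 0 < a := by positivity
  have hb0 : 0 < b := by positivity
  have hγ1 : γ * (lam + 1 - p) = p := div_mul_cancel₀ _ hd.ne'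
  have hγa : γ * a = 1 := by rw [hγ, ha]; field_simp
  have hγb : (γ + 1) * b = 1 := by rw [hγ, hb]; field_simp; ring
  obtain ⟨K, hK, H⟩ := core hN hp hlam₁ hlam₂ (M := 2 ^ (1 / b)) (c := min ((1/2) ^ (1 / a)) ((1/2) ^ (1 / b)))
    (by positivity) (by positivity)
  refine ⟨2 * K, by positivity, fun x0 r hr u hu hu0 hsol => ?_⟩
  set F : EE N → ℝ := fun x => u x ^ a + ‖gradient u x‖ ^ b with hF
  have cF : Continuous F := (hu.continuous.rpow_const fun x => Or.inr ha0.le).add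
    ((grad_cont hu).norm.rpow_const fun x => Or.inr hb0.le)
  have F0 : ∀ x, 0 ≤ F x := fun x => add_nonneg (Real.rpow_nonneg (hu0 x) _) (Real.rpow_nonneg (norm_nonneg _) _)
  obtain ⟨y, hy, hmax⟩ := (isCompact_closedBall x0 r).exists_isMaxOn ⟨x0, mem_closedBall_self hr.le⟩
    (f := fun x => F x * (r - dist x x0)) (by fun_prop)
  have hmax' : ∀ x ∈ closedBall x0 r, F x * (r - dist x x0) ≤ F y * (r - dist y x0) := fun x hx => hmax hx
  have hx0 := hmax' x0 (mem_closedBall_self hr.le)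
  simp only [dist_self, sub_zero] at hx0
  change F x0 * r ≤ 2 * K
  set ρ := (r - dist y x0) / 2 with hρ
  by_contra hcon
  push Not at hcon
  have hρK : K < F y * ρ := by rw [hρ]; linarith
  have hρ0 : 0 < ρ := by
    by_contra hh
    have : F y * ρ ≤ 0 := mul_nonpos_of_nonneg_of_nonpos (F0 y) (by linarith)
    linarith
  have hFy : 0 < F y := by
    rcases (F0 y).eq_or_lt with h | h
    · rw [← h] at hρK; simp at hρK; linarith
    · exact h
  set μ := 1 / F y with hμ
  have hμ0 : 0 < μ := by positivity
  have hμF : μ * F y = 1 := by rw [hμ]; field_simp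
  set v : EE N → ℝ := fun z => μ ^ γ * u (y + μ • z) with hv
  have hvsol : IsSol p lam (ρ / μ) v := rescale hγ1 hμ0 hu hu0 fun φ h1 h2 h3 =>
    hsol φ h1 h2 (h3.trans (ball_subset_ball' (by linarith)))
  have hKρ : K ≤ ρ / μ := by
    have : ρ / μ = F y * ρ := by rw [hμ]; field_simp
    linarith
  have haff : ContDiff ℝ 1 fun z : EE N => y + μ • z := by fun_prop
  have cv : ContDiff ℝ 1 v := contDiff_const.mul (hu.comp haff)
  have hgv : ∀ z, ‖gradient v z‖ = μ ^ (γ + 1) * ‖gradient u (y + μ • z)‖ := by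
    intro z
    have hdv : DifferentiableAt ℝ (fun z => u (y + μ • z)) z := (hu.comp haff).differentiable (by norm_num) z
    rw [hv, grad_const_mul _ hdv, grad_affine hu, smul_smul, norm_smul, Real.norm_of_nonneg (by positivity), Real.rpow_add_one hμ0.ne']
  have hva : ∀ z, v z ^ a = μ * u (y + μ • z) ^ a := by
    intro z
    rw [hv, Real.mul_rpow (by positivity) (hu0 _), ← Real.rpow_mul hμ0.le, hγa, Real.rpow_one]
  have hvb : ∀ z, ‖gradient v z‖ ^ b = μ * ‖gradient u (y + μ • z)‖ ^ b := by
    intro z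
    rw [hgv, Real.mul_rpow (by positivity) (norm_nonneg _), ← Real.rpow_mul hμ0.le, hγb, Real.rpow_one]
  have hv0 : ∀ z, 0 ≤ v z := fun z => mul_nonneg (by positivity) (hu0 _)
  have hvF : ∀ z, v z ^ a + ‖gradient v z‖ ^ b = μ * F (y + μ • z) := by
    intro z; rw [hva, hvb, hF]; ring
  refine H v cv hv0 (hvsol.mono hKρ) (fun z hz => ?_) ?_
  · have hz' : ‖z‖ < ρ / μ := by rw [mem_ball_zero_iff] at hz; linarith
    rw [lt_div_iff₀ hμ0] at hz'
    have hdist : dist (y + μ • z) x0 ≤ dist y x0 + ρ := by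
      refine (dist_triangle _ y _).trans ?_
      rw [dist_eq_norm (y + μ • z) y, add_sub_cancel_left, norm_smul, Real.norm_of_nonneg hμ0.le]; linarith
    have h1 := hmax' (y + μ • z) (by rw [mem_closedBall]; linarith)
    have h2 : F (y + μ • z) * ρ ≤ F (y + μ • z) * (r - dist (y + μ • z) x0) :=
      mul_le_mul_of_nonneg_left (by linarith) (F0 _)
    have h3 : F (y + μ • z) ≤ 2 * F y := by
      have : F (y + μ • z) * ρ ≤ 2 * F y * ρ := by
        have : F y * (r - dist y x0) = 2 * F y * ρ := by rw [hρ]; ring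
        linarith
      exact le_of_mul_le_mul_right this hρ0
    have h4 : μ * F (y + μ • z) ≤ 2 := by
      have := mul_le_mul_of_nonneg_left h3 hμ0.le
      linarith
    have h5 : ‖gradient v z‖ ^ b ≤ 2 := by
      have := hvF z
      have := Real.rpow_nonneg (hv0 z) a
      linarith
    rw [one_div]
    exact (Real.le_rpow_inv_iff_of_pos (norm_nonneg _) (by norm_num) hb0).mpr h5
  · have h1 := hvF 0
    rw [smul_zero, add_zero, hμF] at h1
    by_cases h2 : 1 / 2 ≤ v 0 ^ a
    · left
      refine (min_le_left _ _).trans ?_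
      rw [one_div a]
      exact (Real.rpow_inv_le_iff_of_pos (by norm_num) (hv0 0) ha0).mpr h2
    · right
      refine (min_le_right _ _).trans ?_
      rw [one_div b]
      exact (Real.rpow_inv_le_iff_of_pos (by norm_num) (norm_nonneg _) hb0).mpr (by linarith)

lemma ball_sub_dom {Ω : Set (EE N)} (hΩ : IsOpen Ω) {x : EE N} (hx : x ∈ Ω) {r : ℝ} (hr : r < infDist x (frontier Ω)) : closedBall x r ⊆ Ω := by
  by_cases hr0 : 0 ≤ r
  swap
  · rw [closedBall_eq_empty.mpr (by linarith)]; simp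
  have hpre : IsPreconnected (closedBall x r) := (convex_closedBall x r).isPreconnected
  have hdis : ∀ z ∈ closedBall x r, z ∉ frontier Ω := by
    intro z hz hzf
    have := infDist_le_dist_of_mem (x := x) hzf
    rw [mem_closedBall, dist_comm] at hz
    linarith
  have hcl : IsOpen (closure Ω)ᶜ := isClosed_closure.isOpen_compl
  refine hpre.subset_left_of_subset_union hΩ hcl ?_ ?_ ⟨x, mem_closedBall_self hr0, hx⟩
  · rw [Set.disjoint_compl_right_iff_subset]; exact subset_closure
  · intro z hz
    by_cases h : z ∈ closure Ω
    · left
      by_contra h2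
      exact hdis z hz (by rw [hΩ.frontier_eq]; exact ⟨h, h2⟩)
    · right; exact h

end final
theorem singularity_estimate_lane_emden
    (N : ℕ) (p lam : ℝ) (hp : 1 < p)
    (hlam₁ : p - 1 < lam)
    (hlam₂ : (N : ℝ) > p → lam < ((N : ℝ) * (p - 1) + p) / ((N : ℝ) - p)) :
    ∃ C : ℝ, 0 < C ∧
      ∀ Ω : Set (EuclideanSpace ℝ (Fin N)),
        IsOpen Ω → IsConnected Ω → Ω ≠ Set.univ →
        ∀ u : EuclideanSpace ℝ (Fin N) → ℝ, ContDiffOn ℝ 1 u Ω →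
          (∀ x ∈ Ω, 0 ≤ u x) →
          -- `u` is a weak solution of `-Δ_p u = u^λ` on `Ω`
          (∀ φ : EuclideanSpace ℝ (Fin N) → ℝ,
            ContDiff ℝ (⊤ : ℕ∞) φ → HasCompactSupport φ → tsupport φ ⊆ Ω →
            ∫ x in Ω, ‖gradient u x‖ ^ (p - 2) * ⟪gradient u x, gradient φ x⟫ =
              ∫ x in Ω, u x ^ lam * φ x) →
          ∀ x ∈ Ω,
            u x + ‖gradient u x‖ ^ (p / (lam + 1)) ≤
              C * infDist x (frontier Ω) ^ (-(p / (lam + 1 - p))) := by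
  rcases Nat.eq_zero_or_pos N with h0 | hN
  · subst h0
    refine ⟨1, one_pos, fun Ω _ _ hne u _ _ _ x hx => ?_⟩
    exact absurd (Set.eq_univ_of_forall fun y => by rw [Subsingleton.elim y x]; exact hx) hne
  have hd : 0 < lam + 1 - p := by linarith
  have hl : 0 < lam := by linarith
  obtain ⟨K, hK, H⟩ := doubling hN hp hlam₁ hlam₂
  set γ := p / (lam + 1 - p) with hγ
  have hγ0 : 0 < γ := by positivity
  refine ⟨2 * (2 * K) ^ γ, by positivity, fun Ω hΩ hconn hne u hu hu0 hsol x hx => ?_⟩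
  have hfr : (frontier Ω).Nonempty := by
    by_contra hemp
    rw [Set.not_nonempty_iff_eq_empty, ← isClopen_iff_frontier_eq_empty] at hemp
    rcases isClopen_iff.mp hemp with h | h
    · rw [h] at hx; exact hx
    · exact hne h
  have hdp : 0 < infDist x (frontier Ω) := by
    refine (isClosed_frontier.notMem_iff_infDist_pos hfr).mp fun hxf => ?_
    rw [hΩ.frontier_eq] at hxf
    exact hxf.2 hx
  set d := infDist x (frontier Ω) with hdd
  obtain ⟨v, cv, v0, hloc, hv⟩ := localise hp hl.le hΩ hu hu0 hsol (ball_sub_dom hΩ hx (by linarith : d / 2 < d))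
  have key := H x (d / 2) (by linarith) v cv v0 hv
  obtain ⟨e1, e2⟩ := hloc x (mem_closedBall_self (by linarith))
  rw [e1, e2] at key
  have hux := hu0 x hx
  set A := u x ^ ((lam + 1 - p) / p) with hA
  set B := ‖gradient u x‖ ^ ((lam + 1 - p) / (lam + 1)) with hB
  have hA0 : 0 ≤ A := by positivity
  have hB0 : 0 ≤ B := by positivity
  have hAB : A + B ≤ 2 * K / d := by
    rw [le_div_iff₀ hdp]; linarith
  have f1 : u x = A ^ γ := by
    rw [hA, ← Real.rpow_mul hux, show (lam + 1 - p) / p * γ = 1 by rw [hγ]; field_simp, Real.rpow_one]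
  have f2 : ‖gradient u x‖ ^ (p / (lam + 1)) = B ^ γ := by
    rw [hB, ← Real.rpow_mul (norm_nonneg _)]; congr 1; rw [hγ]; field_simp
  have g1 : A ^ γ ≤ (2 * K / d) ^ γ := Real.rpow_le_rpow hA0 (by linarith) hγ0.le
  have g2 : B ^ γ ≤ (2 * K / d) ^ γ := Real.rpow_le_rpow hB0 (by linarith) hγ0.le
  have g3 : (2 * K / d) ^ γ = (2 * K) ^ γ * d ^ (-γ) := by
    rw [Real.div_rpow (by positivity) hdp.le, Real.rpow_neg hdp.le]; ring
  rw [f2]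
  calc u x + B ^ γ = A ^ γ + B ^ γ := by rw [← f1]
    _ ≤ (2 * K / d) ^ γ + (2 * K / d) ^ γ := by linarith
    _ = _ := by rw [g3]; ring
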